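/- arXiv:0706.1536 — 5 statements merged into one kernel-verified Lean document; each statement's English description precedes it below -/
import Mathlib

section
/- Let A be an n×n complex matrix and 1 ≤ k ≤ n. Then the rank-k numerical range of A equals the intersection over all ξ ∈ [0, 2π) of the closed half-planes {μ ∈ ℂ : e^{iξ}μ + e^{-iξ}μ̄ ≤ λ_k(e^{iξ}A + e^{-iξ}A*)}. -/
open Matrix

/-- The `k`-th largest eigenvalue (counted with multiplicity) of a Hermitian matrix `H`;
junk value `0` if `H` is not Hermitian. -/
noncomputable def lambdaKth {n : ℕ} (H : Matrix (Fin n) (Fin n) ℂ) (k : ℕ) : ℝ :=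
  if hH : H.IsHermitian then
    ((Finset.univ.val.map hH.eigenvalues).sort (· ≤ ·)).getD (n - k) 0
  else 0

/-- The rank-`k` numerical range of a matrix `A`:
`{λ : PAP = λP` for some rank-`k` orthogonal projection `P}`. -/
def rankKRange {n : ℕ} (k : ℕ) (A : Matrix (Fin n) (Fin n) ℂ) : Set ℂ :=
  {μ | ∃ P : Matrix (Fin n) (Fin n) ℂ,
    P.IsHermitian ∧ P * P = P ∧ P.rank = k ∧ P * A * P = μ • P}

universe u

theorem prod_sub_mul_prod_sub_pos {J : Finset ℝ} {a b : ℝ} (ha : ∀ i ∈ J, a < i)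
    (hb : ∀ i ∈ J, b < i) : 0 < (∏ i ∈ J, (a - i)) * ∏ i ∈ J, (b - i) := by
  rw [← Finset.prod_mul_distrib]
  exact Finset.prod_pos fun i hi ↦ mul_pos_of_neg_of_neg (by linarith [ha i hi])
    (by linarith [hb i hi])

theorem exists_gt_forall_lt (S : Finset ℝ) (m : ℝ) (h : ∀ s ∈ S, m < s) :
    ∃ t, m < t ∧ ∀ s ∈ S, t < s := by
  induction S using Finset.induction_on with
  | empty => exact ⟨m + 1, by simp⟩
  | insert a S _ ih =>
    obtain ⟨t, ht, hS⟩ := ih fun s hs ↦ h s (Finset.mem_insert_of_mem hs)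
    obtain ⟨u, hu, hu'⟩ := exists_between
      (lt_min ht (h a (Finset.mem_insert_self a S)))
    refine ⟨u, hu, fun s hs ↦ ?_⟩
    rcases Finset.mem_insert.1 hs with rfl | hs
    · exact hu'.trans_le (min_le_right _ _)
    · exact (hu'.trans_le (min_le_left _ _)).trans (hS s hs)

/-- A sign pattern `c` on `ℝ \ S` whose jumps are compatible with the signs `ε` is matched by
`σ * ∏ i ∈ J, (t - i)` for some `J ⊆ S` along which `ε` alternates. -/
theorem exists_alternating_subset (S : Finset ℝ) (ε c : ℝ → ℝ) (σ : ℝ) (hσ0 : σ ≠ 0)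
    (hε : ∀ s ∈ S, ε s ≠ 0)
    (hconst : ∀ t t', t < t' → (∀ s ∈ S, ¬ (t ≤ s ∧ s ≤ t')) → c t = c t')
    (hjump : ∀ t m t', t < m → m < t' → m ∈ S → (∀ s ∈ S, t ≤ s → s ≤ t' → s = m) →
      0 < ε m * c t → c t' = c t)
    (hσ : ∀ t, (∀ s ∈ S, s < t) → c t ≠ 0 → 0 < c t * σ) :
    ∃ J ⊆ S, (∀ j ∈ J, 0 < σ * ε j * ∏ i ∈ J.erase j, (j - i)) ∧
      ∀ t ∉ S, c t ≠ 0 → 0 < c t * (σ * ∏ i ∈ J, (t - i)) := by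
  suffices H : ∀ S' : Finset ℝ, S' ⊆ S → (∀ s ∈ S, s ∉ S' → ∀ s' ∈ S', s < s') →
      ∃ J ⊆ S', (∀ j ∈ J, 0 < σ * ε j * ∏ i ∈ J.erase j, (j - i)) ∧
      ∀ t ∉ S, (∀ s ∈ S, s ∉ S' → s < t) → c t ≠ 0 → 0 < c t * (σ * ∏ i ∈ J, (t - i)) by
    obtain ⟨J, hJ, h1, h2⟩ := H S subset_rfl (fun s hs h ↦ absurd hs h)
    exact ⟨J, hJ, h1, fun t ht ↦ h2 t ht (fun s hs h ↦ absurd hs h)⟩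
  intro S'
  induction S' using Finset.induction_on_min with
  | empty =>
    intro _ _
    refine ⟨∅, subset_rfl, by simp, fun t _ h hc ↦ ?_⟩
    simpa using hσ t (fun s hs ↦ h s hs (Finset.notMem_empty s)) hc
  | insert m S' hm ih =>
    intro hS' hup
    have hmS : m ∈ S := hS' (Finset.mem_insert_self _ _)
    have hmS' : m ∉ S' := fun h ↦ lt_irrefl _ (hm m h)
    obtain ⟨J, hJ, h1, h2⟩ := ih ((Finset.subset_insert _ _).trans hS') (by
      intro s hs hs' s' hs''
      by_cases h : s = m
      · exact h ▸ hm s' hs''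
      · exact hup s hs (by simp [h, hs']) s' (Finset.mem_insert_of_mem hs''))
    have hmJ : m ∉ J := fun h ↦ hmS' (hJ h)
    have hmJ' : ∀ j ∈ J, m < j := fun j hj ↦ hm j (hJ hj)
    by_cases hall : ∀ t ∉ S, (∀ s ∈ S, s ∉ insert m S' → s < t) → c t ≠ 0 →
        0 < c t * (σ * ∏ i ∈ J, (t - i))
    · exact ⟨J, hJ.trans (Finset.subset_insert _ _), h1, hall⟩
    push Not at hall
    obtain ⟨t0, ht0S, ht0, hc0, hneg⟩ := hall
    have below : ∀ t ∉ S, (∀ s ∈ S, s ∉ insert m S' → s < t) → m < t →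
        ∀ s ∈ S, s ∉ S' → s < t := by
      intro t _ h hmt s hs hs'
      by_cases h' : s = m
      · exact h' ▸ hmt
      · exact h s hs (by simp [h', hs'])
    have ht0m : t0 < m := by
      by_contra h
      have hlt : m < t0 := lt_of_le_of_ne (not_lt.1 h) (fun h ↦ ht0S (h ▸ hmS))
      exact absurd (h2 t0 ht0S (below t0 ht0S ht0 hlt) hc0) (not_lt.2 hneg)
    have ht0J : ∀ i ∈ J, t0 < i := fun i hi ↦ ht0m.trans (hmJ' i hi)
    have hp0 : (∏ i ∈ J, (t0 - i)) ≠ 0 :=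
      Finset.prod_ne_zero_iff.2 fun i hi ↦ sub_ne_zero.2 (ht0J i hi).ne
    have hneg' : c t0 * (σ * ∏ i ∈ J, (t0 - i)) < 0 :=
      lt_of_le_of_ne hneg (mul_ne_zero hc0 (mul_ne_zero hσ0 hp0))
    have hcm : ε m * c t0 < 0 := by
      refine lt_of_le_of_ne (not_lt.1 fun hpos ↦ ?_) (mul_ne_zero (hε m hmS) hc0)
      obtain ⟨t1, hmt1, ht1⟩ := exists_gt_forall_lt S' m hm
      have hbetween : ∀ s ∈ S, t0 ≤ s → s ≤ t1 → s = m := by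
        intro s hs h0 h1
        by_contra hsm
        by_cases hs' : s ∈ S'
        · exact absurd (ht1 s hs') (not_lt.2 h1)
        · exact absurd (ht0 s hs (by simp [hsm, hs'])) (not_lt.2 h0)
      have hc1 := hjump t0 m t1 ht0m hmt1 hmS hbetween hpos
      have ht1S : t1 ∉ S := fun h ↦ hmt1.ne' (hbetween t1 h (ht0m.trans hmt1).le le_rfl)
      have := h2 t1 ht1S (below t1 ht1S (fun s hs hs' ↦
        (ht0 s hs hs').trans (ht0m.trans hmt1)) hmt1) (hc1 ▸ hc0)
      rw [hc1] at this
      have hpp := prod_sub_mul_prod_sub_pos (J := J) ht0J (fun i hi ↦ ht1 i (hJ hi))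
      nlinarith [mul_pos_of_neg_of_neg hneg' (neg_neg_of_pos this),
        mul_pos hpp (mul_pos (sq_pos_of_ne_zero hc0) (sq_pos_of_ne_zero hσ0))]
    refine ⟨insert m J, Finset.insert_subset_insert _ hJ, ?_, ?_⟩
    · intro j hj
      rcases Finset.mem_insert.1 hj with rfl | hj
      · rw [Finset.erase_insert hmJ]
        have hpp := prod_sub_mul_prod_sub_pos (J := J) ht0J hmJ'
        by_contra hle
        have hle := not_lt.1 hle
        have h3 := mul_pos_of_neg_of_neg hneg' hcm
        have h4 := mul_pos (mul_pos hpp (sq_pos_of_ne_zero hc0)) (sq_pos_of_ne_zero hp0)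
        have h5 : 0 < (σ * ε j * ∏ i ∈ J, (j - i)) *
            ((c t0) ^ 2 * ((∏ i ∈ J, (t0 - i)) ^ 2)) := by
          have := mul_pos h3 hpp
          calc 0 < _ := this
            _ = _ := by ring
        exact absurd h5 (not_lt.2 (mul_nonpos_of_nonpos_of_nonneg hle (by positivity)))
      · have hne : m ≠ j := (hmJ' j hj).ne
        rw [Finset.erase_insert_of_ne hne, Finset.prod_insert (by simp [hmJ])]
        have := mul_pos (h1 j hj) (sub_pos.2 (hmJ' j hj))
        calc 0 < _ := this
          _ = _ := by ring
    · intro t htS ht hct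
      rw [Finset.prod_insert hmJ]
      rcases lt_trichotomy t m with htm | rfl | htm
      · have hcc : c t = c t0 := by
          have key : ∀ a b, (∀ s ∈ S, s ∉ insert m S' → s < a) → b < m → a < b → c a = c b := by
            intro a b ha hb hab
            refine hconst a b hab fun s hs ⟨h1, h2⟩ ↦ ?_
            by_cases hs' : s ∈ insert m S'
            · rcases Finset.mem_insert.1 hs' with rfl | hs'
              · linarith
              · linarith [hm s hs']
            · linarith [ha s hs hs']
          rcases lt_trichotomy t t0 with h | rfl | h
          · exact key t t0 ht ht0m h
          · rfl
          · exact (key t0 t ht0 htm h).symm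
        rw [hcc]
        have hpp := prod_sub_mul_prod_sub_pos (J := J) ht0J
          (fun i hi ↦ htm.trans (hmJ' i hi))
        have h6 := mul_pos_of_neg_of_neg hneg' (sub_neg.2 htm)
        by_contra hle
        have hle := not_lt.1 hle
        have h5 : 0 < (c t0 * (σ * ((t - m) * ∏ i ∈ J, (t - i)))) *
            ((∏ i ∈ J, (t0 - i)) ^ 2) := by
          have := mul_pos h6 hpp
          calc 0 < _ := this
            _ = _ := by ring
        exact absurd h5 (not_lt.2 (mul_nonpos_of_nonpos_of_nonneg hle (by positivity)))
      · exact absurd hmS htS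
      · have := mul_pos (h2 t htS (below t htS ht htm) hct) (sub_pos.2 htm)
        calc 0 < _ := this
          _ = _ := by ring

theorem exists_nonempty_alternating_subset (S : Finset ℝ) (hS : S.Nonempty) (ε c : ℝ → ℝ)
    (hε : ∀ s ∈ S, ε s ≠ 0)
    (hconst : ∀ t t', t < t' → (∀ s ∈ S, ¬ (t ≤ s ∧ s ≤ t')) → c t = c t')
    (hjump : ∀ t m t', t < m → m < t' → m ∈ S → (∀ s ∈ S, t ≤ s → s ≤ t' → s = m) →
      0 < ε m * c t → c t' = c t)
    (hanti : ∀ t t', (∀ s ∈ S, t < s ∧ s < t') → c t = - c t') :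
    ∃ σ : ℝ, ∃ J ⊆ S, J.Nonempty ∧ σ ≠ 0 ∧
      (∀ j ∈ J, 0 < σ * ε j * ∏ i ∈ J.erase j, (j - i)) ∧
      ∀ t ∉ S, c t ≠ 0 → 0 < c t * (σ * ∏ i ∈ J, (t - i)) := by
  have hb : ∀ s ∈ S, S.min' hS - 1 < s ∧ s < S.max' hS + 1 := fun s hs ↦
    ⟨by linarith [S.min'_le s hs], by linarith [S.le_max' s hs]⟩
  set a := S.min' hS - 1
  set b := S.max' hS + 1
  have htop : ∀ t, (∀ s ∈ S, s < t) → c t = c b := fun t ht ↦ by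
    have h1 := hanti a t fun s hs ↦ ⟨(hb s hs).1, ht s hs⟩
    have h2 := hanti a b hb
    linarith
  have haS : a ∉ S := fun h ↦ lt_irrefl _ (hb a h).1
  by_cases hcb : c b = 0
  · have hσ : ∀ σ t, (∀ s ∈ S, s < t) → c t ≠ 0 → 0 < c t * σ := fun σ t ht h ↦
      absurd ((htop t ht).trans hcb) h
    obtain ⟨J, hJ, h1, h2⟩ :=
      exists_alternating_subset S ε c 1 one_ne_zero hε hconst hjump (hσ 1)
    obtain ⟨J', hJ', h1', h2'⟩ :=
      exists_alternating_subset S ε c (-1) (by norm_num) hε hconst hjump (hσ (-1))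
    rcases J.eq_empty_or_nonempty with rfl | hne
    · rcases J'.eq_empty_or_nonempty with rfl | hne'
      · have hzero : ∀ t ∉ S, c t = 0 := fun t ht ↦ by
          by_contra h
          have := h2 t ht h
          have := h2' t ht h
          simp at *
          linarith
        obtain ⟨s, hs⟩ := hS
        refine ⟨ε s, {s}, by simpa using hs, by simp, hε s hs, ?_, fun t ht h ↦
          absurd (hzero t ht) h⟩
        simpa using hε s hs
      · exact ⟨-1, J', hJ', hne', by norm_num, h1', h2'⟩
    · exact ⟨1, J, hJ, hne, one_ne_zero, h1, h2⟩
  · obtain ⟨J, hJ, h1, h2⟩ := exists_alternating_subset S ε c (c b) hcb hε hconst hjump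
      (fun t ht h ↦ by rw [htop t ht]; exact mul_self_pos.2 hcb)
    refine ⟨c b, J, hJ, ?_, hcb, h1, h2⟩
    rw [Finset.nonempty_iff_ne_empty]
    rintro rfl
    have h3 := hanti a b hb
    have := h2 a haS (by rw [h3]; exact neg_ne_zero.2 hcb)
    rw [h3] at this
    simp at this
    nlinarith [mul_self_nonneg (c b)]

open Module in
/-- `B` is nonnegative on some subspace of `W` of dimension at least `k`. -/
def HasNonnegSubspace {V : Type*} [AddCommGroup V] [Module ℂ V]
    (B : V →ₗ⋆[ℂ] V →ₗ[ℂ] ℂ) (W : Submodule ℂ V) (k : ℕ) : Prop :=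
  ∃ U ≤ W, k ≤ finrank ℂ U ∧ ∀ x ∈ U, 0 ≤ (B x x).re

section SesquilinearForms

open Module

variable {V : Type*} [AddCommGroup V] [Module ℂ V] {B : V →ₗ⋆[ℂ] V →ₗ[ℂ] ℂ}

theorem LinearMap.IsSymm.real_smul_sub {H K : V →ₗ⋆[ℂ] V →ₗ[ℂ] ℂ} (hH : H.IsSymm) (hK : K.IsSymm)
    (t : ℝ) : ((t : ℂ) • K - H).IsSymm :=
  ⟨fun x y ↦ by simp [hH.eq x y, hK.eq x y]⟩

theorem LinearMap.IsSymm.neg_sesq (hB : B.IsSymm) : (-B).IsSymm :=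
  ⟨fun x y ↦ by simp [hB.eq x y]⟩

theorem LinearMap.IsSymm.apply_eq_zero_comm (hB : B.IsSymm) {x y : V} (h : B x y = 0) :
    B y x = 0 := by
  rw [← hB.eq x y, h, map_zero]

theorem LinearMap.IsSymm.ofReal_re_self (hB : B.IsSymm) (x : V) : ((B x x).re : ℂ) = B x x :=
  Complex.conj_eq_iff_re.1 (hB.eq x x)

/-- A vector that is isotropic for a form nonnegative on `U` is orthogonal to `U`. -/
theorem LinearMap.IsSymm.apply_eq_zero_of_nonneg (hB : B.IsSymm) {U : Submodule ℂ V}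
    (hU : ∀ x ∈ U, 0 ≤ (B x x).re) {l u : V} (hl : l ∈ U) (hu : u ∈ U) (hll : B l l = 0) :
    B l u = 0 := by
  by_contra hne
  have hpos : 0 < Complex.normSq (B l u) := Complex.normSq_pos.2 hne
  have key : ∀ r : ℝ, 0 ≤ (B u u).re + 2 * r * Complex.normSq (B l u) := by
    intro r
    have h := hU (u + ((r : ℂ) * B l u) • l) (U.add_mem hu (U.smul_mem _ hl))
    have h1 : B (u + ((r : ℂ) * B l u) • l) (u + ((r : ℂ) * B l u) • l) =
        B u u + 2 * r * (Complex.normSq (B l u) : ℂ) := by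
      rw [Complex.normSq_eq_conj_mul_self]
      simp only [map_add, LinearMap.add_apply, map_smulₛₗ, LinearMap.smul_apply, hll, map_mul,
        ← hB.eq l u, Complex.conj_ofReal, smul_eq_mul, RingHom.id_apply]
      ring
    rw [h1] at h
    have h2 : (B u u + 2 * (r : ℂ) * (Complex.normSq (B l u) : ℂ)) =
      B u u + ((2 * r * Complex.normSq (B l u) : ℝ) : ℂ) := by push_cast; ring
    rw [h2, Complex.add_re, Complex.ofReal_re] at h
    exact h
  have := key (-((B u u).re + 1) / (2 * Complex.normSq (B l u)))
  have h3 : 2 * (-((B u u).re + 1) / (2 * Complex.normSq (B l u))) * Complex.normSq (B l u) =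
      -((B u u).re + 1) := by field_simp
  linarith

/-- A nonnegative subspace can be projected into the orthogonal complement of a negative vector. -/
theorem LinearMap.IsSymm.hasNonnegSubspace_ker (hB : B.IsSymm) {k : ℕ} {z : V}
    (hz : (B z z).re < 0) (h : HasNonnegSubspace B ⊤ k) :
    HasNonnegSubspace B (LinearMap.ker (B z)) k := by
  obtain ⟨U, -, hk, hU⟩ := h
  have hz0 : B z z ≠ 0 := fun h ↦ by simp [h] at hz
  let p : V →ₗ[ℂ] V := LinearMap.id - ((B z z)⁻¹ • B z).smulRight z
  have hp : ∀ y, p y = y - ((B z z)⁻¹ * B z y) • z := fun y ↦ by simp [p]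
  have hpz : ∀ y, B z (p y) = 0 := fun y ↦ by
    rw [hp, map_sub, map_smul, smul_eq_mul]
    field_simp
    ring
  refine ⟨U.map p, ?_, ?_, ?_⟩
  · rintro _ ⟨y, -, rfl⟩
    exact hpz y
  · have hinj : Function.Injective (p.domRestrict U) := by
      rw [← LinearMap.ker_eq_bot, LinearMap.ker_eq_bot']
      rintro ⟨y, hy⟩ h
      have hy' : y = ((B z z)⁻¹ * B z y) • z := by
        rw [LinearMap.domRestrict_apply, hp] at h
        exact sub_eq_zero.1 h
      generalize (B z z)⁻¹ * B z y = c at hy'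
      have h0 := hU y hy
      by_cases hc : c = 0
      · ext
        simpa [hc] using hy'
      · exfalso
        have h1 : B y y = (Complex.normSq c : ℂ) * B z z := by
          rw [hy', Complex.normSq_eq_conj_mul_self]
          simp only [map_smulₛₗ, LinearMap.smul_apply, smul_eq_mul, RingHom.id_apply]
          ring
        rw [h1, Complex.re_ofReal_mul] at h0
        nlinarith [Complex.normSq_pos.2 hc]
    have h1 := LinearMap.finrank_range_of_inj hinj
    rw [LinearMap.range_domRestrict] at h1
    omega
  · rintro _ ⟨y, hy, rfl⟩
    set c := (B z z)⁻¹ * B z y with hc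
    have hy' : y = p y + c • z := by rw [hp]; simp [c]
    have h0 := hU y hy
    have h1 : B y y = B (p y) (p y) + (Complex.normSq c : ℂ) * B z z := by
      have e1 := hpz y
      have e2 := hB.apply_eq_zero_comm e1
      generalize p y = w at *
      rw [hy', Complex.normSq_eq_conj_mul_self]
      simp only [map_add, LinearMap.add_apply, map_smulₛₗ, LinearMap.smul_apply, smul_eq_mul,
        RingHom.id_apply, e1, e2]
      ring
    rw [h1, Complex.add_re, Complex.re_ofReal_mul] at h0
    nlinarith [Complex.normSq_nonneg c]

variable [FiniteDimensional ℂ V]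

theorem finrank_le_finrank_inf_orthogonalBilin_add (B : V →ₗ⋆[ℂ] V →ₗ[ℂ] ℂ)
    (U L : Submodule ℂ V) :
    finrank ℂ U ≤ finrank ℂ (U ⊓ L.orthogonalBilin B : Submodule ℂ V) + finrank ℂ L := by
  let b := finBasis ℂ L
  let f : V →ₗ[ℂ] (Fin (finrank ℂ L) → ℂ) := LinearMap.pi fun i ↦ B (b i)
  have hker : LinearMap.ker f = L.orthogonalBilin B := by
    ext y
    rw [LinearMap.mem_ker, Submodule.mem_orthogonalBilin_iff]
    constructor
    · intro h l hl
      have hl' := congrArg Subtype.val (b.sum_repr ⟨l, hl⟩)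
      change B (Subtype.val (⟨l, hl⟩ : L)) y = 0
      rw [← hl']
      simp only [Submodule.coe_sum, Submodule.coe_smul, map_sum, map_smulₛₗ,
        LinearMap.sum_apply, LinearMap.smul_apply]
      exact Finset.sum_eq_zero fun i _ ↦ by
        have := congrFun h i
        simp only [f, LinearMap.pi_apply, Pi.zero_apply] at this
        rw [this, smul_zero]
    · intro h
      funext i
      exact h _ (b i).2
  rw [← hker]
  have h1 := LinearMap.finrank_range_add_finrank_ker (f.domRestrict U)
  have h2 : finrank ℂ (LinearMap.range (f.domRestrict U)) ≤ finrank ℂ L := by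
    simpa using Submodule.finrank_le (LinearMap.range (f.domRestrict U))
  have h3 : finrank ℂ (LinearMap.ker (f.domRestrict U)) =
      finrank ℂ (U ⊓ LinearMap.ker f : Submodule ℂ V) := by
    rw [LinearMap.ker_domRestrict]
    rw [← Submodule.map_comap_subtype, Submodule.finrank_map_subtype_eq]
  omega

/-- A nonnegative subspace can be enlarged to contain a given isotropic subspace, at the cost of
intersecting it with the orthogonal complement of the latter. -/
theorem LinearMap.IsSymm.finrank_le_finrank_inf_sup (hB : B.IsSymm) {U L : Submodule ℂ V}
    (hU : ∀ x ∈ U, 0 ≤ (B x x).re) (hL : ∀ x ∈ L, ∀ y ∈ L, B x y = 0) :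
    finrank ℂ U ≤ finrank ℂ ((U ⊓ L.orthogonalBilin B) ⊔ L : Submodule ℂ V) ∧
      ∀ x ∈ (U ⊓ L.orthogonalBilin B) ⊔ L, 0 ≤ (B x x).re := by
  constructor
  · obtain ⟨C, hC⟩ := Submodule.exists_isCompl (U ⊓ L)
    have hsup : (U ⊓ L) ⊔ (C ⊓ L) = L := by
      rw [← sup_inf_assoc_of_le C (inf_le_right : U ⊓ L ≤ L), hC.sup_eq_top, top_inf_eq]
    have hinf : (U ⊓ L) ⊓ (C ⊓ L) = ⊥ :=
      le_bot_iff.1 (hC.inf_eq_bot ▸ inf_le_inf_left _ inf_le_left)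
    have h1 := Submodule.finrank_sup_add_finrank_inf_eq (U ⊓ L) (C ⊓ L)
    rw [hsup, hinf, finrank_bot] at h1
    have h2 := finrank_le_finrank_inf_orthogonalBilin_add B U (C ⊓ L)
    have h3 : U ⊓ (C ⊓ L).orthogonalBilin B ≤ U ⊓ L.orthogonalBilin B := by
      rintro y ⟨hyU, hy⟩
      refine ⟨hyU, fun l hl ↦ ?_⟩
      rw [← hsup] at hl
      obtain ⟨a, ha, c, hc, rfl⟩ := Submodule.mem_sup.1 hl
      change B (a + c) y = 0
      rw [map_add, LinearMap.add_apply,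
        hB.apply_eq_zero_of_nonneg hU ha.1 hyU (hL a ha.2 a ha.2), hy c hc, add_zero]
    have h4 := Submodule.finrank_mono h3
    have h5 := Submodule.finrank_sup_add_finrank_inf_eq (U ⊓ L.orthogonalBilin B) L
    have h6 : finrank ℂ ((U ⊓ L.orthogonalBilin B) ⊓ L : Submodule ℂ V) ≤
        finrank ℂ (U ⊓ L : Submodule ℂ V) :=
      Submodule.finrank_mono (inf_le_inf_right _ inf_le_left)
    omega
  · intro x hx
    obtain ⟨u, hu, l, hl, rfl⟩ := Submodule.mem_sup.1 hx
    have h1 : B l u = 0 := hu.2 l hl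
    simp only [map_add, LinearMap.add_apply, h1, hB.apply_eq_zero_comm h1, hL l hl l hl, add_zero]
    exact hU u hu.1

theorem hasNonnegSubspace_ker_of_lt {k : ℕ} (f : V →ₗ[ℂ] ℂ)
    (h : HasNonnegSubspace B ⊤ (k + 1)) : HasNonnegSubspace B (LinearMap.ker f) k := by
  obtain ⟨U, -, hk, hU⟩ := h
  refine ⟨U ⊓ LinearMap.ker f, inf_le_right, ?_, fun x hx ↦ hU x hx.1⟩
  have h1 := LinearMap.finrank_range_add_finrank_ker (f.domRestrict U)
  have h2 : finrank ℂ (LinearMap.range (f.domRestrict U)) ≤ 1 := by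
    simpa using Submodule.finrank_le (LinearMap.range (f.domRestrict U))
  have h3 : finrank ℂ (LinearMap.ker (f.domRestrict U)) =
      finrank ℂ (U ⊓ LinearMap.ker f : Submodule ℂ V) := by
    rw [LinearMap.ker_domRestrict]
    rw [← Submodule.map_comap_subtype, Submodule.finrank_map_subtype_eq]
  omega

theorem HasNonnegSubspace.inf_compl (hB : B.IsSymm) {k : ℕ} {L C W : Submodule ℂ V}
    (hC : IsCompl L C) (hL : ∀ x ∈ L, ∀ y ∈ L, B x y = 0) (hLW : L ≤ W)
    (hW : L.orthogonalBilin B ≤ W) (h : HasNonnegSubspace B ⊤ k) :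
    HasNonnegSubspace B (W ⊓ C) (k - finrank ℂ L) := by
  obtain ⟨U, -, hk, hU⟩ := h
  obtain ⟨h1, h2⟩ := hB.finrank_le_finrank_inf_sup hU hL
  set U' := (U ⊓ L.orthogonalBilin B) ⊔ L
  have hLU' : L ≤ U' := le_sup_right
  refine ⟨U' ⊓ C, inf_le_inf_right _ (sup_le (inf_le_right.trans hW) hLW), ?_,
    fun x hx ↦ h2 x hx.1⟩
  have h3 : L ⊔ (U' ⊓ C) = U' := by
    rw [inf_comm, ← sup_inf_assoc_of_le C hLU', hC.sup_eq_top, top_inf_eq]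
  have h4 : L ⊓ (U' ⊓ C) = ⊥ := le_bot_iff.1 (hC.inf_eq_bot ▸ inf_le_inf_left _ inf_le_right)
  have h5 := Submodule.finrank_sup_add_finrank_inf_eq L (U' ⊓ C)
  rw [h3, h4, finrank_bot] at h5
  omega

end SesquilinearForms

section Pencils

open Module Filter

variable {V : Type*} [AddCommGroup V] [Module ℂ V]

/-- Almost all members of the real pencil `t • K - H`, restricted to `W`, are nonnegative on a
`k`-dimensional subspace and nonpositive on another one. -/
def PencilBalanced (H K : V →ₗ⋆[ℂ] V →ₗ[ℂ] ℂ) (W : Submodule ℂ V) (k : ℕ) : Prop :=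
  ∀ᶠ t : ℝ in cofinite, HasNonnegSubspace ((t : ℂ) • K - H) W k ∧
    HasNonnegSubspace (-((t : ℂ) • K - H)) W k

/-- `W` contains a subspace of dimension at least `k` that is totally isotropic for both forms. -/
def HasCommonIsotropic (H K : V →ₗ⋆[ℂ] V →ₗ[ℂ] ℂ) (W : Submodule ℂ V) (k : ℕ) : Prop :=
  ∃ S ≤ W, k ≤ finrank ℂ S ∧ ∀ x ∈ S, ∀ y ∈ S, H x y = 0 ∧ K x y = 0

variable [FiniteDimensional ℂ V] {H K : V →ₗ⋆[ℂ] V →ₗ[ℂ] ℂ}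

theorem HasCommonIsotropic.of_isotropic (hH : H.IsSymm) (hK : K.IsSymm) {k : ℕ}
    (hbal : PencilBalanced H K ⊤ k) {L : Submodule ℂ V} (hL0 : L ≠ ⊥)
    (hL : ∀ x ∈ L, ∀ y ∈ L, H x y = 0 ∧ K x y = 0)
    (hperp : ∀ᶠ t : ℝ in cofinite, L.orthogonalBilin ((t : ℂ) • K - H) ≤
      L.orthogonalBilin H ⊓ L.orthogonalBilin K)
    (ih : ∀ W : Submodule ℂ V, finrank ℂ W < finrank ℂ V → ∀ k, PencilBalanced H K W k →
      HasCommonIsotropic H K W k) :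
    HasCommonIsotropic H K ⊤ k := by
  obtain ⟨C, hC⟩ := Submodule.exists_isCompl L
  set W := L.orthogonalBilin H ⊓ L.orthogonalBilin K
  have hLW : L ≤ W := fun y hy ↦ ⟨fun x hx ↦ (hL x hx y hy).1, fun x hx ↦ (hL x hx y hy).2⟩
  have hLpos : 0 < finrank ℂ L := Submodule.one_le_finrank_iff.2 hL0
  have hLC := Submodule.finrank_add_eq_of_isCompl hC
  have hWC : finrank ℂ (W ⊓ C : Submodule ℂ V) ≤ finrank ℂ C :=
    Submodule.finrank_mono inf_le_right
  have hbal' : PencilBalanced H K (W ⊓ C) (k - finrank ℂ L) := by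
    filter_upwards [hbal, hperp] with t ht hpt
    have hB := hH.real_smul_sub hK t
    have hLB : ∀ x ∈ L, ∀ y ∈ L, ((t : ℂ) • K - H) x y = 0 := fun x hx y hy ↦ by
      simp [(hL x hx y hy).1, (hL x hx y hy).2]
    refine ⟨ht.1.inf_compl hB hC hLB hLW hpt, ht.2.inf_compl hB.neg_sesq hC (fun x hx y hy ↦ ?_)
      hLW (fun y hy ↦ hpt fun x hx ↦ ?_)⟩
    · rw [LinearMap.neg_apply, LinearMap.neg_apply, hLB x hx y hy, neg_zero]
    · exact neg_eq_zero.1 (hy x hx)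
  obtain ⟨S, hSW, hkS, hS⟩ := ih _ (by omega) _ hbal'
  refine ⟨L ⊔ S, le_top, ?_, ?_⟩
  · have h1 := Submodule.finrank_sup_add_finrank_inf_eq L S
    have h2 : L ⊓ S = ⊥ :=
      le_bot_iff.1 (hC.inf_eq_bot ▸ inf_le_inf_left _ (hSW.trans inf_le_right))
    rw [h2, finrank_bot] at h1
    omega
  · intro x hx y hy
    obtain ⟨l, hl, s, hs, rfl⟩ := Submodule.mem_sup.1 hx
    obtain ⟨l', hl', s', hs', rfl⟩ := Submodule.mem_sup.1 hy
    have e1 : H l s' = 0 := (hSW hs').1.1 l hl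
    have e2 : K l s' = 0 := (hSW hs').1.2 l hl
    have e3 : H s l' = 0 := hH.apply_eq_zero_comm ((hSW hs).1.1 l' hl')
    have e4 : K s l' = 0 := hK.apply_eq_zero_comm ((hSW hs).1.2 l' hl')
    simp [e1, e2, e3, e4, hL l hl l' hl', hS s hs _ hs']

/-- A polynomial family of null vectors of the pencil spans a common isotropic subspace to which
`HasCommonIsotropic.of_isotropic` applies. -/
theorem HasCommonIsotropic.of_chain (hH : H.IsSymm) (hK : K.IsSymm) {k : ℕ}
    (hbal : PencilBalanced H K ⊤ k) (x : ℕ → V) (hx0 : H (x 0) = 0)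
    (hx : ∀ i, H (x (i + 1)) = K (x i)) (hne : ∃ i, x i ≠ 0)
    (ih : ∀ W : Submodule ℂ V, finrank ℂ W < finrank ℂ V → ∀ k, PencilBalanced H K W k →
      HasCommonIsotropic H K W k) :
    HasCommonIsotropic H K ⊤ k := by
  have hHx : ∀ j i, H (x i) (x j) = 0 := by
    intro j
    induction j with
    | zero => exact fun i ↦ hH.apply_eq_zero_comm (by simp [hx0])
    | succ j ihj =>
      intro i
      apply hH.apply_eq_zero_comm
      rw [hx, ← hK.eq, ← hx, ihj, map_zero]
  have hKx : ∀ i j, K (x i) (x j) = 0 := fun i j ↦ by rw [← hx, hHx]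
  have horth : ∀ (B : V →ₗ⋆[ℂ] V →ₗ[ℂ] ℂ) (y : V), (∀ i, B (x i) y = 0) →
      ∀ l ∈ Submodule.span ℂ (Set.range x), B l y = 0 := by
    intro B y h l hl
    induction hl using Submodule.span_induction with
    | mem l hl => obtain ⟨i, rfl⟩ := hl; exact h i
    | zero => simp
    | add a b _ _ ha hb => simp [ha, hb]
    | smul c a _ ha => simp [ha]
  have hiso : ∀ B : V →ₗ⋆[ℂ] V →ₗ[ℂ] ℂ, B.IsSymm → (∀ i j, B (x i) (x j) = 0) →
      ∀ l ∈ Submodule.span ℂ (Set.range x), ∀ y ∈ Submodule.span ℂ (Set.range x), B l y = 0 :=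
    fun B hB h l hl y hy ↦ horth B y (fun i ↦ hB.apply_eq_zero_comm
      (horth B (x i) (fun j ↦ h j i) y hy)) l hl
  refine .of_isotropic hH hK hbal (L := Submodule.span ℂ (Set.range x)) ?_
    (fun l hl y hy ↦ ⟨hiso H hH (fun i j ↦ hHx j i) l hl y hy, hiso K hK hKx l hl y hy⟩) ?_ ih
  · obtain ⟨i, hi⟩ := hne
    exact fun h ↦ hi ((Submodule.mem_bot ℂ).1 (h ▸ Submodule.subset_span ⟨i, rfl⟩))
  · filter_upwards [eventually_cofinite_ne (0 : ℝ)] with t ht y hy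
    have hty : ∀ i, (t : ℂ) * K (x i) y = H (x i) y := fun i ↦ by
      have := hy (x i) (Submodule.subset_span ⟨i, rfl⟩)
      simpa [sub_eq_zero] using this
    have hHy : ∀ i, H (x i) y = 0 := by
      intro i
      induction i with
      | zero => simp [hx0]
      | succ i ihi =>
        have := hty i
        rw [ihi, mul_eq_zero, Complex.ofReal_eq_zero] at this
        rw [hx]
        exact this.resolve_left ht
    exact ⟨fun l hl ↦ horth H y hHy l hl, fun l hl ↦ horth K y (fun i ↦ by rw [← hx, hHy]) l hl⟩

/-- The case of an eigenvector of the pencil that is isotropic for `K`. -/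
theorem HasCommonIsotropic.of_eigenvector (hH : H.IsSymm) (hK : K.IsSymm) {k : ℕ}
    (hbal : PencilBalanced H K ⊤ k) {x : V} (hx : x ≠ 0) {a : ℂ} (hxa : H x = a • K x)
    (hKx : K x x = 0)
    (ih : ∀ W : Submodule ℂ V, finrank ℂ W < finrank ℂ V → ∀ k, PencilBalanced H K W k →
      HasCommonIsotropic H K W k) :
    HasCommonIsotropic H K ⊤ k := by
  refine .of_isotropic hH hK hbal (L := Submodule.span ℂ {x}) (by simpa using hx) ?_ ?_ ih
  · intro y hy z hz
    obtain ⟨b, rfl⟩ := Submodule.mem_span_singleton.1 hy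
    obtain ⟨c, rfl⟩ := Submodule.mem_span_singleton.1 hz
    simp [hxa, hKx]
  · filter_upwards [eventually_cofinite_ne a.re] with t ht y hy
    have h1 := hy x (Submodule.mem_span_singleton_self x)
    have h2 : ((t : ℂ) - a) * K x y = 0 := by
      simpa [hxa, sub_mul] using h1
    have h3 : K x y = 0 := (mul_eq_zero.1 h2).resolve_left fun h ↦
      ht (by rw [← sub_eq_zero.1 h, Complex.ofReal_re])
    constructor <;> intro l hl <;> obtain ⟨b, rfl⟩ := Submodule.mem_span_singleton.1 hl <;>
      simp [hxa, h3]

/-- A decomposition of `V` into pieces `E s` on which `H = s • K` and `ε s • K` is positive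
definite, mutually orthogonal for `K`. -/
structure DefiniteDecomposition (H K : V →ₗ⋆[ℂ] V →ₗ[ℂ] ℂ) (S : Finset ℝ) (E : ℝ → Submodule ℂ V)
    (ε : ℝ → ℝ) : Prop where
  apply_eq : ∀ s ∈ S, ∀ x ∈ E s, H x = (s : ℂ) • K x
  orthogonal : ∀ s ∈ S, ∀ s' ∈ S, s ≠ s' → ∀ x ∈ E s, ∀ y ∈ E s', K x y = 0
  definite : ∀ s ∈ S, ∀ x ∈ E s, x ≠ 0 → 0 < ε s * (K x x).re
  ne_bot : ∀ s ∈ S, E s ≠ ⊥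
  sup_eq_top : S.sup E = ⊤

namespace DefiniteDecomposition

variable {S : Finset ℝ} {E : ℝ → Submodule ℂ V} {ε : ℝ → ℝ}

omit [FiniteDimensional ℂ V] in
theorem sign_ne_zero (h : DefiniteDecomposition H K S E ε) {s : ℝ} (hs : s ∈ S) : ε s ≠ 0 := by
  obtain ⟨x, hx, hx0⟩ := Submodule.exists_mem_ne_zero_of_ne_bot (h.ne_bot s hs)
  intro h0
  simpa [h0] using h.definite s hs x hx hx0

/-- The sum of the pieces on which `δ • (t • K - H)` is positive definite. -/
noncomputable def signedPart (S : Finset ℝ) (E : ℝ → Submodule ℂ V) (ε : ℝ → ℝ) (δ t : ℝ) :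
    Submodule ℂ V :=
  {s ∈ S | 0 < δ * (ε s * (t - s))}.sup E

omit [FiniteDimensional ℂ V] in
theorem signedPart_mono {δ δ' t t' : ℝ}
    (h : ∀ s ∈ S, 0 < δ * (ε s * (t - s)) → 0 < δ' * (ε s * (t' - s))) :
    signedPart S E ε δ t ≤ signedPart S E ε δ' t' :=
  Finset.sup_mono fun s hs ↦ by
    rw [Finset.mem_filter] at hs ⊢
    exact ⟨hs.1, h s hs.1 hs.2⟩

omit [FiniteDimensional ℂ V] in
theorem le_signedPart {δ t s : ℝ} (hs : s ∈ S) (h : 0 < δ * (ε s * (t - s))) :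
    E s ≤ signedPart S E ε δ t :=
  Finset.le_sup (f := E) (Finset.mem_filter.2 ⟨hs, h⟩)

omit [FiniteDimensional ℂ V] in
theorem apply_sum_self (h : DefiniteDecomposition H K S E ε) {F : Finset ℝ} (hF : F ⊆ S)
    {x : ℝ → V} (hx : ∀ s ∈ F, x s ∈ E s) (t : ℝ) :
    (((t : ℂ) • K - H) (∑ s ∈ F, x s) (∑ s ∈ F, x s)).re =
      ∑ s ∈ F, (t - s) * (K (x s) (x s)).re := by
  rw [LinearMap.map_sum₂, Complex.re_sum]
  refine Finset.sum_congr rfl fun s hs ↦ ?_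
  have hH := h.apply_eq s (hF hs) (x s) (hx s hs)
  rw [map_sum, Finset.sum_eq_single_of_mem s hs]
  · rw [LinearMap.sub_apply, hH, LinearMap.smul_apply, ← sub_smul, LinearMap.smul_apply,
      smul_eq_mul, ← Complex.ofReal_sub, Complex.re_ofReal_mul]
  · intro s' hs' hne
    rw [LinearMap.sub_apply, hH, LinearMap.smul_apply, ← sub_smul, LinearMap.smul_apply,
      h.orthogonal s (hF hs) s' (hF hs') hne.symm _ (hx s hs) _ (hx s' hs'), smul_zero]

omit [FiniteDimensional ℂ V] in
theorem pos_of_mem_signedPart (h : DefiniteDecomposition H K S E ε) {δ t : ℝ} {y : V}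
    (hy : y ∈ signedPart S E ε δ t) (hy0 : y ≠ 0) :
    0 < δ * (((t : ℂ) • K - H) y y).re := by
  rw [signedPart, Finset.sup_eq_iSup, Submodule.mem_iSup_finset_iff_exists_sum] at hy
  obtain ⟨x, rfl⟩ := hy
  have hterm : ∀ s ∈ {s ∈ S | 0 < δ * (ε s * (t - s))}, (x s : V) ≠ 0 →
      0 < δ * ((t - s) * (K (x s) (x s)).re) := by
    intro s hs hne
    rw [Finset.mem_filter] at hs
    have h1 := mul_pos hs.2 (h.definite s hs.1 _ (x s).2 hne)
    have h2 : 0 < ε s ^ 2 := sq_pos_of_ne_zero (h.sign_ne_zero hs.1)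
    refine (pos_iff_pos_of_mul_pos (a := ε s ^ 2) ?_).1 h2
    calc 0 < _ := h1
      _ = _ := by ring
  rw [h.apply_sum_self (Finset.filter_subset _ _) (x := fun s ↦ x s) (fun s _ ↦ (x s).2) t,
    Finset.mul_sum]
  obtain ⟨s, hs, hne⟩ := Finset.exists_ne_zero_of_sum_ne_zero hy0
  refine Finset.sum_pos' (fun s hs ↦ ?_) ⟨s, hs, hterm s hs hne⟩
  by_cases h0 : (x s : V) = 0
  · simp [h0]
  · exact (hterm s hs h0).le

theorem finrank_signedPart_add (h : DefiniteDecomposition H K S E ε) {t : ℝ} (ht : t ∉ S) :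
    finrank ℂ (signedPart S E ε 1 t) + finrank ℂ (signedPart S E ε (-1) t) = finrank ℂ V := by
  refine Submodule.finrank_add_eq_of_isCompl ⟨?_, ?_⟩
  · rw [Submodule.disjoint_def]
    intro x hx hx'
    by_contra h0
    have h1 := h.pos_of_mem_signedPart hx h0
    have h2 := h.pos_of_mem_signedPart hx' h0
    linarith
  · rw [codisjoint_iff, eq_top_iff, ← h.sup_eq_top]
    refine Finset.sup_le fun s hs ↦ ?_
    have hne : ε s * (t - s) ≠ 0 :=
      mul_ne_zero (h.sign_ne_zero hs) (sub_ne_zero.2 fun e ↦ ht (e ▸ hs))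
    rcases lt_or_gt_of_ne hne with h0 | h0
    · exact (le_signedPart hs (by linarith)).trans le_sup_right
    · exact (le_signedPart hs (by linarith)).trans le_sup_left

theorem add_finrank_signedPart_le (h : DefiniteDecomposition H K S E ε) {δ t : ℝ} {k : ℕ}
    {B : V →ₗ⋆[ℂ] V →ₗ[ℂ] ℂ} (hB : ∀ y, (B y y).re = -(δ * (((t : ℂ) • K - H) y y).re))
    (hk : HasNonnegSubspace B ⊤ k) : k + finrank ℂ (signedPart S E ε δ t) ≤ finrank ℂ V := by
  obtain ⟨U, -, hkU, hU⟩ := hk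
  refine (Nat.add_le_add_right hkU _).trans (Submodule.finrank_add_finrank_le_of_disjoint ?_)
  rw [Submodule.disjoint_def]
  intro x hx hx'
  by_contra h0
  have h1 := h.pos_of_mem_signedPart hx' h0
  have h2 := hU x hx
  rw [hB] at h2
  linarith

/-- The dimension of the positive part is controlled for every `t ∉ S`, since it is locally
constant. -/
theorem le_finrank_signedPart (h : DefiniteDecomposition H K S E ε) {k : ℕ}
    (hbal : PencilBalanced H K ⊤ k) {t : ℝ} (ht : t ∉ S) :
    k ≤ finrank ℂ (signedPart S E ε 1 t) ∧
      finrank ℂ (signedPart S E ε 1 t) + k ≤ finrank ℂ V := by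
  have hopen : ∀ᶠ u in nhds t, ∀ s ∈ S,
      (0 < 1 * (ε s * (u - s)) → 0 < 1 * (ε s * (t - s))) ∧
      (0 < 1 * (ε s * (t - s)) → 0 < 1 * (ε s * (u - s))) := by
    rw [Filter.eventually_all_finset]
    intro s hs
    have hcont : ContinuousAt (fun u : ℝ ↦ 1 * (ε s * (u - s))) t := by fun_prop
    have hne : 1 * (ε s * (t - s)) ≠ 0 := by
      rw [one_mul]
      exact mul_ne_zero (h.sign_ne_zero hs) (sub_ne_zero.2 fun e ↦ ht (e ▸ hs))
    rcases lt_or_gt_of_ne hne with h0 | h0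
    · filter_upwards [hcont.eventually_lt_const h0] with u hu
      exact ⟨fun h ↦ absurd hu h.not_gt, fun h ↦ absurd h0 h.not_gt⟩
    · filter_upwards [hcont.eventually_const_lt h0] with u hu
      exact ⟨fun _ ↦ h0, fun _ ↦ hu⟩
  have hinf : Set.Infinite {u : ℝ | ∀ s ∈ S,
      (0 < 1 * (ε s * (u - s)) → 0 < 1 * (ε s * (t - s))) ∧
      (0 < 1 * (ε s * (t - s)) → 0 < 1 * (ε s * (u - s)))} := infinite_of_mem_nhds t hopen
  have hgood : ∀ᶠ u : ℝ in cofinite, u ∉ S ∧ HasNonnegSubspace ((u : ℂ) • K - H) ⊤ k ∧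
      HasNonnegSubspace (-((u : ℂ) • K - H)) ⊤ k :=
    (S.eventually_cofinite_notMem).and hbal
  obtain ⟨u, hu, huS, hu1, hu2⟩ :=
    ((Filter.frequently_cofinite_iff_infinite.2 hinf).and_eventually hgood).exists
  have heq : signedPart S E ε 1 u = signedPart S E ε 1 t :=
    le_antisymm (signedPart_mono fun s hs ↦ (hu s hs).1)
      (signedPart_mono fun s hs ↦ (hu s hs).2)
  rw [← heq]
  have h1 := h.add_finrank_signedPart_le (δ := 1) (t := u) (fun y ↦ by simp) hu2
  have h2 := h.add_finrank_signedPart_le (δ := -1) (t := u) (fun y ↦ by simp) hu1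
  have h3 := h.finrank_signedPart_add huS
  omega

omit [FiniteDimensional ℂ V] in
theorem signedPart_le_of_pos {t t' : ℝ} (htt' : t < t')
    (hε : ∀ s ∈ S, t ≤ s → s ≤ t' → 0 < ε s) :
    signedPart S E ε 1 t ≤ signedPart S E ε 1 t' := by
  refine signedPart_mono fun s hs h ↦ ?_
  rw [one_mul] at h ⊢
  rcases lt_or_ge s t with h1 | h1
  · have := pos_of_mul_pos_left h (sub_pos.2 h1).le
    exact mul_pos this (by linarith)
  · rcases le_or_gt s t' with h2 | h2
    · nlinarith [hε s hs h1 h2]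
    · nlinarith

omit [FiniteDimensional ℂ V] in
theorem signedPart_le_of_neg {t t' : ℝ} (htt' : t < t')
    (hε : ∀ s ∈ S, t ≤ s → s ≤ t' → ε s < 0) :
    signedPart S E ε 1 t' ≤ signedPart S E ε 1 t := by
  refine signedPart_mono fun s hs h ↦ ?_
  rw [one_mul] at h ⊢
  rcases lt_or_ge s t with h1 | h1
  · have := pos_of_mul_pos_left h (by linarith)
    exact mul_pos this (by linarith)
  · rcases le_or_gt s t' with h2 | h2
    · nlinarith [hε s hs h1 h2]
    · nlinarith

omit [FiniteDimensional ℂ V] in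
theorem apply_self (h : DefiniteDecomposition H K S E ε) {s : ℝ} (hs : s ∈ S) {x : V}
    (hx : x ∈ E s) (t : ℝ) : (((t : ℂ) • K - H) x x).re = (t - s) * (K x x).re := by
  simpa using h.apply_sum_self (F := {s}) (by simpa using hs) (x := fun _ ↦ x) (by simpa using hx) t

theorem two_mul_ne_finrank (h : DefiniteDecomposition H K S E ε) (hS : S.Nonempty) {k : ℕ}
    (hbal : PencilBalanced H K ⊤ k) : k + k ≠ finrank ℂ V := by
  intro hk
  set m := S.min' hS
  have hm : m ∈ S := S.min'_mem hS
  obtain ⟨t1, hmt1, ht1⟩ := exists_gt_forall_lt (S.erase m) m fun s hs ↦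
    lt_of_le_of_ne (S.min'_le s (Finset.mem_of_mem_erase hs)) (Finset.ne_of_mem_erase hs).symm
  have hm0 : m - 1 < m := by linarith
  have hbetween : ∀ s ∈ S, m - 1 ≤ s → s ≤ t1 → s = m := fun s hs _ h1 ↦ by
    by_contra hne
    exact absurd (ht1 s (Finset.mem_erase.2 ⟨hne, hs⟩)) (not_lt.2 h1)
  have ht0S : m - 1 ∉ S := fun hs ↦ absurd (S.min'_le _ hs) (not_le.2 hm0)
  have ht1S : t1 ∉ S := fun hs ↦ hmt1.ne' (hbetween t1 hs (hm0.trans hmt1).le le_rfl)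
  have h0 := h.le_finrank_signedPart hbal ht0S
  have h1 := h.le_finrank_signedPart hbal ht1S
  have hfin : finrank ℂ (signedPart S E ε 1 (m - 1)) = finrank ℂ (signedPart S E ε 1 t1) := by
    omega
  obtain ⟨x, hx, hx0⟩ := Submodule.exists_mem_ne_zero_of_ne_bot (h.ne_bot m hm)
  have hdef := h.definite m hm x hx hx0
  rcases lt_or_gt_of_ne (h.sign_ne_zero hm) with hε | hε
  · have heq := Submodule.eq_of_le_of_finrank_eq (signedPart_le_of_neg (E := E) (hm0.trans hmt1)
      fun s hs ha hb ↦ by rwa [hbetween s hs ha hb]) hfin.symm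
    have hx1 : x ∈ signedPart S E ε 1 (m - 1) := le_signedPart hm (by nlinarith) hx
    have := h.pos_of_mem_signedPart (heq ▸ hx1) hx0
    rw [h.apply_self hm hx, one_mul] at this
    nlinarith [pos_of_mul_pos_right this (by linarith)]
  · have heq := Submodule.eq_of_le_of_finrank_eq (signedPart_le_of_pos (E := E) (hm0.trans hmt1)
      fun s hs ha hb ↦ by rwa [hbetween s hs ha hb]) hfin
    have hx1 : x ∈ signedPart S E ε 1 t1 := le_signedPart hm (by nlinarith) hx
    have := h.pos_of_mem_signedPart (heq ▸ hx1) hx0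
    rw [h.apply_self hm hx, one_mul] at this
    nlinarith [pos_of_mul_pos_right hdef hε.le]

/-- Comparison of the inertia of the pencil with the sign of a rational function
`1 / (σ * ∏ j ∈ J, (t - j))` whose residues match the signs `ε`. -/
theorem exists_residues (h : DefiniteDecomposition H K S E ε) (hS : S.Nonempty) {k : ℕ}
    (hbal : PencilBalanced H K ⊤ k) :
    ∃ σ : ℝ, ∃ J ⊆ S, J.Nonempty ∧ σ ≠ 0 ∧
      (∀ j ∈ J, 0 < σ * ε j * ∏ i ∈ J.erase j, (j - i)) ∧
      ∀ t ∉ S, (0 < σ * ∏ i ∈ J, (t - i) → k + 1 ≤ finrank ℂ (signedPart S E ε 1 t)) ∧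
        (σ * ∏ i ∈ J, (t - i) < 0 → k + 1 ≤ finrank ℂ (signedPart S E ε (-1) t)) := by
  have hne := h.two_mul_ne_finrank hS hbal
  have hbd := fun t ht ↦ h.le_finrank_signedPart hbal (t := t) ht
  have hadd := fun t ht ↦ h.finrank_signedPart_add (t := t) ht
  obtain ⟨N, hN⟩ : ∃ N : ℝ → ℕ, ∀ t, finrank ℂ (signedPart S E ε 1 t) = N t := ⟨_, fun _ ↦ rfl⟩
  simp only [hN] at hbd hadd ⊢
  generalize finrank ℂ V = n at hne hbd hadd
  let c : ℝ → ℝ := fun t ↦ if N t + k = n then 1 else if N t = k then -1 else 0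
  have hc : ∀ t, c t = if N t + k = n then 1 else if N t = k then -1 else 0 := fun t ↦ rfl
  have hup : ∀ t t', t < t' → (∀ s ∈ S, t ≤ s → s ≤ t' → 0 < ε s) → N t ≤ N t' :=
    fun t t' htt' hε ↦ by
      rw [← hN, ← hN]
      exact Submodule.finrank_mono (signedPart_le_of_pos htt' hε)
  have hdown : ∀ t t', t < t' → (∀ s ∈ S, t ≤ s → s ≤ t' → ε s < 0) → N t' ≤ N t :=
    fun t t' htt' hε ↦ by
      rw [← hN, ← hN]
      exact Submodule.finrank_mono (signedPart_le_of_neg htt' hε)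
  obtain ⟨σ, J, hJ, hJne, hσ, h1, h2⟩ := exists_nonempty_alternating_subset S hS ε c
    (fun s hs ↦ h.sign_ne_zero hs)
    (fun t t' htt' hst ↦ by
      have e : N t = N t' := le_antisymm (hup t t' htt' fun s hs a b ↦ absurd ⟨a, b⟩ (hst s hs))
        (hdown t t' htt' fun s hs a b ↦ absurd ⟨a, b⟩ (hst s hs))
      rw [hc, hc, e])
    (fun t m t' htm hmt' hm hbetween hpos ↦ by
      have htS : t ∉ S := fun hs ↦ htm.ne (hbetween t hs le_rfl (htm.trans hmt').le)
      have htS' : t' ∉ S := fun hs ↦ hmt'.ne' (hbetween t' hs (htm.trans hmt').le le_rfl)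
      have hb := hbd t htS
      have hb' := hbd t' htS'
      by_cases e1 : N t + k = n
      · have : 0 < ε m := by simpa [hc, e1] using hpos
        have := hup t t' (htm.trans hmt') fun s hs a b ↦ by rwa [hbetween s hs a b]
        rw [hc, hc, if_pos e1, if_pos (by omega)]
      · by_cases e2 : N t = k
        · have : ε m < 0 := by simpa [hc, e2, hne] using hpos
          have := hdown t t' (htm.trans hmt') fun s hs a b ↦ by rwa [hbetween s hs a b]
          rw [hc, hc, if_neg e1, if_pos e2, if_neg (by omega), if_pos (by omega)]
        · simp [hc, e1, e2] at hpos)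
    (fun t t' hst ↦ by
      have htS : t ∉ S := fun hs ↦ lt_irrefl _ (hst t hs).1
      have htS' : t' ∉ S := fun hs ↦ lt_irrefl _ (hst t' hs).2
      have e : signedPart S E ε 1 t = signedPart S E ε (-1) t' := by
        refine le_antisymm (signedPart_mono fun s hs hp ↦ ?_) (signedPart_mono fun s hs hp ↦ ?_)
        · obtain ⟨a, b⟩ := hst s hs
          have : ε s < 0 := by
            by_contra hge
            nlinarith
          nlinarith
        · obtain ⟨a, b⟩ := hst s hs
          have : ε s < 0 := by
            by_contra hge
            nlinarith
          nlinarith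
      have e1 : N t' + N t = n := by
        have := hadd t' htS'
        rwa [← e, hN] at this
      rw [hc, hc]
      split_ifs <;> first | omega | norm_num)
  refine ⟨σ, J, hJ, hJne, hσ, h1, fun t ht ↦ ⟨fun hp ↦ ?_, fun hp ↦ ?_⟩⟩
  · have hb := hbd t ht
    by_contra hlt
    have e : N t = k := by omega
    have hct : c t = -1 := by rw [hc, if_neg (by omega), if_pos e]
    have := h2 t ht (by rw [hct]; norm_num)
    rw [hct] at this
    linarith
  · have hb := hbd t ht
    have ha := hadd t ht
    by_contra hlt
    have hct : c t = 1 := by rw [hc, if_pos (by omega)]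
    have := h2 t ht (by rw [hct]; norm_num)
    rw [hct] at this
    linarith

omit [FiniteDimensional ℂ V] in
theorem exists_mem_apply_self_eq (h : DefiniteDecomposition H K S E ε) {s r : ℝ}
    (hs : s ∈ S) (hr : 0 < r * ε s) : ∃ x ∈ E s, (K x x).re = r := by
  obtain ⟨e, he, he0⟩ := Submodule.exists_mem_ne_zero_of_ne_bot (h.ne_bot s hs)
  have hdef := h.definite s hs e he he0
  have hne : (K e e).re ≠ 0 := fun h0 ↦ by simp [h0] at hdef
  have hpos : 0 ≤ r / (K e e).re := by
    have h1 : 0 < r * (K e e).re := by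
      refine (pos_iff_pos_of_mul_pos (a := ε s ^ 2) ?_).1 (sq_pos_of_ne_zero (h.sign_ne_zero hs))
      calc 0 < _ := mul_pos hr hdef
        _ = _ := by ring
    rw [← mul_div_mul_right r _ hne]
    exact div_nonneg h1.le (mul_self_nonneg _)
  refine ⟨(√(r / (K e e).re) : ℂ) • e, Submodule.smul_mem _ _ he, ?_⟩
  simp only [map_smulₛₗ, LinearMap.smul_apply, smul_eq_mul, RingHom.id_apply, Complex.conj_ofReal]
  rw [← mul_assoc, ← Complex.ofReal_mul, Real.mul_self_sqrt hpos, Complex.re_ofReal_mul]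
  field_simp

theorem hasCommonIsotropic (h : DefiniteDecomposition H K S E ε) (hS : S.Nonempty)
    (hH : H.IsSymm) (hK : K.IsSymm) {k : ℕ} (hbal : PencilBalanced H K ⊤ k)
    (ih : ∀ W : Submodule ℂ V, finrank ℂ W < finrank ℂ V → ∀ k, PencilBalanced H K W k →
      HasCommonIsotropic H K W k) :
    HasCommonIsotropic H K ⊤ k := by
  obtain ⟨σ, J, hJ, hJne, hσ, hres, hsign⟩ := h.exists_residues hS hbal
  have hx : ∀ j, ∃ x, j ∈ J → x ∈ E j ∧ (K x x).re = σ * Lagrange.nodalWeight J id j := by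
    intro j
    by_cases hj : j ∈ J
    · obtain ⟨x, hx, hx'⟩ := h.exists_mem_apply_self_eq (hJ hj)
        (r := σ * Lagrange.nodalWeight J id j) (by
          have h1 := hres j hj
          have h2 : ∏ i ∈ J.erase j, (j - i) ≠ 0 := fun h0 ↦ by simp [h0] at h1
          rw [Lagrange.nodalWeight, Finset.prod_inv_distrib]
          simp only [id]
          refine (pos_iff_pos_of_mul_pos (a := (∏ i ∈ J.erase j, (j - i)) ^ 2) ?_).1 (by positivity)
          calc 0 < _ := h1
            _ = _ := by field_simp)
      exact ⟨x, fun _ ↦ ⟨hx, hx'⟩⟩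
    · exact ⟨0, fun h ↦ absurd h hj⟩
  choose x hx using hx
  set v := ∑ j ∈ J, x j
  let z : ℝ → V := fun t ↦ ∑ j ∈ J, (((t - j)⁻¹ : ℝ) : ℂ) • x j
  have hz : ∀ t ∉ S, ((t : ℂ) • K - H) (z t) = K v := by
    intro t ht
    simp only [z, v, map_sum]
    refine Finset.sum_congr rfl fun j hj ↦ ?_
    have hne : (t : ℂ) - j ≠ 0 := by
      rw [← Complex.ofReal_sub, Complex.ofReal_ne_zero]
      exact sub_ne_zero.2 fun e ↦ ht (e ▸ hJ hj)
    rw [map_smulₛₗ, LinearMap.sub_apply, h.apply_eq j (hJ hj) _ (hx j hj).1, LinearMap.smul_apply,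
      ← sub_smul, smul_smul, Complex.conj_ofReal]
    push_cast
    rw [inv_mul_cancel₀ hne, one_smul]
  have hzz : ∀ t ∉ S, (((t : ℂ) • K - H) (z t) (z t)).re * (σ * ∏ i ∈ J, (t - i)) = σ ^ 2 := by
    intro t ht
    have htJ : ∀ j ∈ J, t ≠ id j := fun j hj e ↦ ht (by rw [e]; exact hJ hj)
    rw [h.apply_sum_self hJ (fun j hj ↦ Submodule.smul_mem _ _ (hx j hj).1)]
    have h1 : ∑ j ∈ J, (t - j) *
        (K ((((t - j)⁻¹ : ℝ) : ℂ) • x j) ((((t - j)⁻¹ : ℝ) : ℂ) • x j)).re =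
        σ * ∑ j ∈ J, Lagrange.nodalWeight J id j * (t - id j)⁻¹ := by
      rw [Finset.mul_sum]
      refine Finset.sum_congr rfl fun j hj ↦ ?_
      have hne : t - j ≠ 0 := sub_ne_zero.2 (htJ j hj)
      simp only [map_smulₛₗ, LinearMap.smul_apply, smul_eq_mul, RingHom.id_apply,
        Complex.conj_ofReal, Complex.re_ofReal_mul, (hx j hj).2, id]
      field_simp
    have h2 := Lagrange.eval_interpolate_not_at_node (s := J) (v := id) (1 : ℝ → ℝ) htJ
    rw [Lagrange.interpolate_one (v := (id : ℝ → ℝ)) Function.injective_id.injOn hJne,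
      Polynomial.eval_one, Lagrange.eval_nodal] at h2
    simp only [Pi.one_apply, mul_one] at h2
    rw [h1]
    calc _ = σ ^ 2 * ((∏ i ∈ J, (t - id i)) *
          ∑ j ∈ J, Lagrange.nodalWeight J id j * (t - id j)⁻¹) := by simp only [id]; ring
      _ = _ := by rw [← h2, mul_one]
  have hσ2 : 0 < σ ^ 2 := sq_pos_of_ne_zero hσ
  have hW : finrank ℂ (LinearMap.ker (K v)) < finrank ℂ V := by
    refine Submodule.finrank_lt fun htop ↦ ?_
    obtain ⟨t, ht⟩ := Infinite.exists_notMem_finset S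
    have := hzz t ht
    rw [hz t ht, LinearMap.ker_eq_top.1 htop] at this
    simp only [LinearMap.zero_apply, Complex.zero_re, zero_mul] at this
    exact hσ2.ne this
  obtain ⟨S', -, hS'⟩ := ih (LinearMap.ker (K v)) hW k (by
    filter_upwards [hbal, S.eventually_cofinite_notMem] with t hbt ht
    have hB := hH.real_smul_sub hK t
    have hq := hzz t ht
    rcases lt_trichotomy (((t : ℂ) • K - H) (z t) (z t)).re 0 with h0 | h0 | h0
    · refine ⟨hz t ht ▸ hB.hasNonnegSubspace_ker h0 hbt.1, hasNonnegSubspace_ker_of_lt _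
        ⟨_, le_top, (hsign t ht).2 (by nlinarith), fun y hy ↦ ?_⟩⟩
      by_cases hy0 : y = 0
      · simp [hy0]
      · simpa using (h.pos_of_mem_signedPart hy hy0).le
    · rw [h0, zero_mul] at hq
      exact absurd hq hσ2.ne
    · refine ⟨hasNonnegSubspace_ker_of_lt _
        ⟨_, le_top, (hsign t ht).1 (by nlinarith), fun y hy ↦ ?_⟩, ?_⟩
      · by_cases hy0 : y = 0
        · simp [hy0]
        · simpa using (h.pos_of_mem_signedPart hy hy0).le
      · have h1 := hB.neg_sesq.hasNonnegSubspace_ker (z := z t) (by simpa using h0) hbt.2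
        have h2 : LinearMap.ker ((-((t : ℂ) • K - H)) (z t)) = LinearMap.ker (K v) := by
          rw [← hz t ht]
          ext y
          simp only [LinearMap.mem_ker, LinearMap.neg_apply, neg_eq_zero]
        rwa [h2] at h1)
  exact ⟨S', le_top, hS'⟩

end DefiniteDecomposition

omit [FiniteDimensional ℂ V] in
/-- A Hermitian form without isotropic vectors on a subspace is definite there. -/
theorem LinearMap.IsSymm.exists_definite (hK : K.IsSymm) (L : Submodule ℂ V)
    (hL : ∀ x ∈ L, x ≠ 0 → K x x ≠ 0) : ∃ e : ℝ, ∀ x ∈ L, x ≠ 0 → 0 < e * (K x x).re := by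
  have hre : ∀ x ∈ L, x ≠ 0 → (K x x).re ≠ 0 := fun x hx hx0 h ↦
    hL x hx hx0 (by rw [← hK.ofReal_re_self, h, Complex.ofReal_zero])
  by_cases hbot : L = ⊥
  · exact ⟨1, fun x hx hx0 ↦ absurd ((Submodule.mem_bot ℂ).1 (hbot ▸ hx)) hx0⟩
  obtain ⟨y, hy, hy0⟩ := Submodule.exists_mem_ne_zero_of_ne_bot hbot
  refine ⟨(K y y).re, fun x hx hx0 ↦ ?_⟩
  by_contra hneg
  have hlt : (K y y).re * (K x x).re < 0 :=
    lt_of_le_of_ne (not_lt.1 hneg) (mul_ne_zero (hre y hy hy0) (hre x hx hx0))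
  have hexp : ∀ r : ℝ, (K (y + (r : ℂ) • x) (y + (r : ℂ) • x)).re =
      (K x x).re * (r * r) + 2 * (K y x).re * r + (K y y).re := by
    intro r
    have h1 : (K x y).re = (K y x).re := by rw [← hK.eq y x, Complex.conj_re]
    simp only [map_add, LinearMap.add_apply, map_smulₛₗ, LinearMap.smul_apply, smul_eq_mul,
      RingHom.id_apply, Complex.conj_ofReal, Complex.add_re, Complex.re_ofReal_mul, h1]
    ring
  obtain ⟨r, hr⟩ := exists_quadratic_eq_zero (b := 2 * (K y x).re) (c := (K y y).re)
    (hre x hx hx0) ⟨√(discrim (K x x).re (2 * (K y x).re) (K y y).re), by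
      rw [Real.mul_self_sqrt]
      unfold discrim
      nlinarith [sq_nonneg (2 * (K y x).re)]⟩
  have hzero : y + (r : ℂ) • x = 0 := by
    by_contra h0
    exact hre _ (L.add_mem hy (L.smul_mem _ hx)) h0 ((hexp r).trans hr)
  have hyx : y = ((-r : ℝ) : ℂ) • x := by
    rw [Complex.ofReal_neg, neg_smul]
    exact eq_neg_of_add_eq_zero_left hzero
  have : (K y y).re = r * r * (K x x).re := by
    rw [hyx]
    simp only [map_smulₛₗ, LinearMap.smul_apply, smul_eq_mul, RingHom.id_apply,
      Complex.conj_ofReal, Complex.re_ofReal_mul]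
    ring
  rw [this] at hlt
  nlinarith [mul_self_nonneg (r * (K x x).re)]

/-- The case in which `H` is represented by an endomorphism through `K`. -/
theorem HasCommonIsotropic.of_endomorphism [Nontrivial V] (hH : H.IsSymm) (hK : K.IsSymm) {k : ℕ}
    (hbal : PencilBalanced H K ⊤ k) (T : End ℂ V) (hT : ∀ x y, K y (T x) = H y x)
    (ih : ∀ W : Submodule ℂ V, finrank ℂ W < finrank ℂ V → ∀ k, PencilBalanced H K W k →
      HasCommonIsotropic H K W k) :
    HasCommonIsotropic H K ⊤ k := by
  have heig : ∀ (a : ℂ) (x : V), T x = a • x → H x = (starRingEnd ℂ a) • K x := by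
    intro a x hx
    ext y
    rw [← hH.eq, ← hT, hx, LinearMap.smul_apply, map_smul, smul_eq_mul, map_mul, hK.eq,
      smul_eq_mul]
  have hadj : ∀ x y, K (T x) y = K x (T y) := fun x y ↦ by rw [hT, ← hK.eq, hT, hH.eq]
  by_cases hiso : ∃ x : V, x ≠ 0 ∧ (∃ a : ℂ, T x = a • x) ∧ K x x = 0
  · obtain ⟨x, hx, ⟨a, ha⟩, hxx⟩ := hiso
    exact .of_eigenvector hH hK hbal hx (heig a x ha) hxx ih
  have hiso' : ∀ (a : ℂ) (x : V), T x = a • x → x ≠ 0 → K x x ≠ 0 :=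
    fun a x hx h0 hxx ↦ hiso ⟨x, h0, ⟨a, hx⟩, hxx⟩
  have hreal : ∀ (a : ℂ) (x : V), T x = a • x → x ≠ 0 → starRingEnd ℂ a = a := by
    intro a x hx h0
    have h1 := hadj x x
    rw [hx] at h1
    simp only [map_smulₛₗ, LinearMap.smul_apply, smul_eq_mul, RingHom.id_apply] at h1
    exact mul_right_cancel₀ (hiso' a x hx h0) h1
  have hgen : ∀ a : ℂ, T.maxGenEigenspace a ≤ T.eigenspace a := by
    intro a x hx
    obtain ⟨l, hl⟩ := (End.mem_maxGenEigenspace T a x).1 hx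
    rw [End.mem_eigenspace_iff, ← sub_eq_zero]
    have hstep : ∀ x, (T - a • 1) ((T - a • 1) x) = 0 → (T - a • 1) x = 0 := by
      intro x hx
      set y := (T - a • 1) x with hy
      have hTy : T y = a • y := by simpa [sub_eq_zero] using hx
      by_contra h0
      refine hiso' a y hTy h0 ?_
      nth_rewrite 1 [hy]
      have ha := hreal a y hTy h0
      simp [hadj, hTy, ha]
    have : (T - a • 1) x = 0 := by
      clear hx
      induction l generalizing x with
      | zero =>
        have : x = 0 := by simpa using hl
        rw [this, map_zero]
      | succ l ihl =>
        rw [pow_succ] at hl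
        exact hstep x (ihl hl)
    simpa using this
  have hdef := fun s : ℝ ↦ hK.exists_definite (T.eigenspace (s : ℂ)) fun x hx h0 ↦
    hiso' s x (End.mem_eigenspace_iff.1 hx) h0
  choose ε hε using hdef
  let S : Finset ℝ := (T.finite_hasEigenvalue).toFinset.image Complex.re
  have hS : ∀ a : ℂ, T.HasEigenvalue a → a.re ∈ S ∧ (a.re : ℂ) = a := by
    intro a ha
    obtain ⟨x, hx⟩ := ha.exists_hasEigenvector
    exact ⟨Finset.mem_image_of_mem _ (by simpa using ha), Complex.conj_eq_iff_re.1
      (hreal a x hx.apply_eq_smul hx.2)⟩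
  have hdec : DefiniteDecomposition H K S (fun s ↦ T.eigenspace (s : ℂ)) ε := by
    refine ⟨fun s _ x hx ↦ ?_, fun s _ s' _ hne x hx y hy ↦ ?_, fun s _ ↦ hε s, ?_, ?_⟩
    · simpa using heig s x (End.mem_eigenspace_iff.1 hx)
    · have h1 := hadj x y
      rw [End.mem_eigenspace_iff.1 hx, End.mem_eigenspace_iff.1 hy] at h1
      simp only [map_smulₛₗ, LinearMap.smul_apply, smul_eq_mul, RingHom.id_apply,
        Complex.conj_ofReal] at h1
      have h2 : ((s : ℂ) - s') * K x y = 0 := by rw [sub_mul, h1, sub_self]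
      refine (mul_eq_zero.1 h2).resolve_left fun h ↦ hne ?_
      exact_mod_cast sub_eq_zero.1 h
    · intro s hs
      obtain ⟨a, ha, rfl⟩ := Finset.mem_image.1 hs
      have ha' : T.HasEigenvalue a := by simpa using ha
      change T.eigenspace (a.re : ℂ) ≠ ⊥
      rw [(hS a ha').2]
      exact ha'
    · rw [eq_top_iff, ← End.iSup_maxGenEigenspace_eq_top T]
      refine iSup_le fun a ↦ (hgen a).trans ?_
      by_cases ha : T.HasEigenvalue a
      · have := Finset.le_sup (f := fun s : ℝ ↦ T.eigenspace (s : ℂ)) (hS a ha).1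
        rwa [(hS a ha).2] at this
      · have : T.eigenspace a = ⊥ := not_not.1 ha
        rw [this]
        exact bot_le
  obtain ⟨a, ha⟩ := End.exists_eigenvalue T
  exact hdec.hasCommonIsotropic ⟨_, (hS a ha).1⟩ hH hK hbal ih

omit [FiniteDimensional ℂ V] in
theorem HasNonnegSubspace.smul {B B' : V →ₗ⋆[ℂ] V →ₗ[ℂ] ℂ} {W : Submodule ℂ V} {k : ℕ} {r : ℝ}
    (hr : 0 ≤ r) (hB' : ∀ x, (B' x x).re = r * (B x x).re) (h : HasNonnegSubspace B W k) :
    HasNonnegSubspace B' W k := by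
  obtain ⟨U, hUW, hk, hU⟩ := h
  exact ⟨U, hUW, hk, fun x hx ↦ by rw [hB']; exact mul_nonneg hr (hU x hx)⟩

omit [FiniteDimensional ℂ V] in
/-- The balance condition is invariant under a projective change of parameter of the pencil. -/
theorem PencilBalanced.real_smul_sub {W : Submodule ℂ V} {k : ℕ} (h : PencilBalanced H K W k)
    (t : ℝ) : PencilBalanced K ((t : ℂ) • K - H) W k := by
  have hinj : Function.Injective fun s : ℝ ↦ t - s⁻¹ := fun a b hab ↦ by simpa using hab
  filter_upwards [hinj.tendsto_cofinite.eventually h, eventually_cofinite_ne (0 : ℝ)] with s hs hs0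
  have hre : ∀ x, (((s : ℂ) • ((t : ℂ) • K - H) - K) x x).re =
      s * ((((t - s⁻¹ : ℝ) : ℂ) • K - H) x x).re := by
    intro x
    simp only [LinearMap.sub_apply, LinearMap.smul_apply, smul_eq_mul, Complex.sub_re,
      Complex.re_ofReal_mul]
    field_simp
    ring
  rcases lt_or_gt_of_ne hs0 with h0 | h0
  · exact ⟨hs.2.smul (neg_nonneg.2 h0.le) fun x ↦ by rw [hre]; simp; ring,
      hs.1.smul (neg_nonneg.2 h0.le) fun x ↦ by
        rw [LinearMap.neg_apply, LinearMap.neg_apply, Complex.neg_re, hre, neg_mul]⟩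
  · exact ⟨hs.1.smul h0.le hre, hs.2.smul h0.le fun x ↦ by
      rw [LinearMap.neg_apply, LinearMap.neg_apply, Complex.neg_re, hre, LinearMap.neg_apply,
        LinearMap.neg_apply, Complex.neg_re, mul_neg]⟩

omit [FiniteDimensional ℂ V] in
theorem HasNonnegSubspace.domRestrict {B : V →ₗ⋆[ℂ] V →ₗ[ℂ] ℂ} {W : Submodule ℂ V} {k : ℕ}
    (h : HasNonnegSubspace B W k) : HasNonnegSubspace (B.domRestrict₁₂ W W) ⊤ k := by
  obtain ⟨U, hUW, hk, hU⟩ := h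
  refine ⟨U.comap W.subtype, le_top, ?_, fun x hx ↦ hU x hx⟩
  rwa [(Submodule.comapSubtypeEquivOfLe hUW).finrank_eq]

omit [FiniteDimensional ℂ V] in
theorem HasCommonIsotropic.of_domRestrict {W : Submodule ℂ V} {k : ℕ}
    (h : HasCommonIsotropic (H.domRestrict₁₂ W W) (K.domRestrict₁₂ W W) ⊤ k) :
    HasCommonIsotropic H K W k := by
  obtain ⟨S, -, hk, hS⟩ := h
  refine ⟨S.map W.subtype, Submodule.map_subtype_le W S, ?_, ?_⟩
  · rwa [Submodule.finrank_map_subtype_eq]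
  · rintro _ ⟨x, hx, rfl⟩ _ ⟨y, hy, rfl⟩
    exact hS x hx y hy

omit [FiniteDimensional ℂ V] in
theorem LinearMap.apply_sum_smul_eq_mulVec {n : ℕ} (B : V →ₗ⋆[ℂ] V →ₗ[ℂ] ℂ) (b : Fin n → V)
    (c : Fin n → ℂ) (i : Fin n) :
    B (b i) (∑ j, c j • b j) = (Matrix.of (fun i j ↦ B (b i) (b j)) *ᵥ c) i := by
  simp [Matrix.mulVec, dotProduct, mul_comm]

omit [FiniteDimensional ℂ V] in
/-- A Hermitian pencil that is degenerate over the polynomial ring has a chain of vectors coming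
from the coefficients of a null vector. -/
theorem exists_chain_of_det_eq_zero (hH : H.IsSymm) (hK : K.IsSymm) {n : ℕ}
    (b : Basis (Fin n) ℂ V)
    (hdet : ((Polynomial.X : Polynomial ℂ) • (Matrix.of fun i j ↦ K (b i) (b j)).map Polynomial.C -
      (Matrix.of fun i j ↦ H (b i) (b j)).map Polynomial.C).det = 0) :
    ∃ x : ℕ → V, H (x 0) = 0 ∧ (∀ i, H (x (i + 1)) = K (x i)) ∧ ∃ i, x i ≠ 0 := by
  obtain ⟨v, hv0, hv⟩ := Matrix.exists_mulVec_eq_zero_iff.2 hdet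
  have hrow : ∀ i, Polynomial.X * ∑ j, Polynomial.C (K (b i) (b j)) * v j =
      ∑ j, Polynomial.C (H (b i) (b j)) * v j := by
    intro i
    have := congrFun hv i
    rw [Matrix.sub_mulVec, Matrix.smul_mulVec, Pi.sub_apply, Pi.zero_apply, sub_eq_zero] at this
    simpa [Matrix.mulVec, dotProduct] using this
  have hext : ∀ {f g : V →ₗ⋆[ℂ] V →ₗ[ℂ] ℂ}, f.IsSymm → g.IsSymm → ∀ x y,
      (∀ i, f (b i) x = g (b i) y) → f x = g y := by
    intro f g hf hg x y h
    refine b.ext fun i ↦ ?_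
    rw [← hf.eq, ← hg.eq, h]
  have happ : ∀ (B : V →ₗ⋆[ℂ] V →ₗ[ℂ] ℂ) (i : Fin n) (m : ℕ),
      B (b i) (∑ j, (v j).coeff m • b j) =
        (∑ j, Polynomial.C (B (b i) (b j)) * v j).coeff m := by
    intro B i m
    simp [mul_comm]
  refine ⟨fun m ↦ ∑ j, (v j).coeff m • b j, ?_, fun m ↦ hext hH hK _ _ fun i ↦ ?_, ?_⟩
  · refine b.ext fun i ↦ ?_
    rw [LinearMap.zero_apply, ← hH.eq, happ, ← hrow, Polynomial.coeff_X_mul_zero, map_zero]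
  · rw [happ, happ, ← hrow, Polynomial.coeff_X_mul]
  · by_contra! h
    refine hv0 (funext fun j ↦ Polynomial.ext fun m ↦ ?_)
    exact Fintype.linearIndependent_iff.1 b.linearIndependent _ (h m) j

omit [FiniteDimensional ℂ V] in
theorem exists_endomorphism_of_det_ne_zero {n : ℕ} (b : Basis (Fin n) ℂ V)
    (hdet : (Matrix.of fun i j ↦ K (b i) (b j)).det ≠ 0) (H : V →ₗ⋆[ℂ] V →ₗ[ℂ] ℂ) :
    ∃ T : End ℂ V, ∀ x y, K y (T x) = H y x := by
  let Φ : (V →ₗ⋆[ℂ] V →ₗ[ℂ] ℂ) → V →ₗ[ℂ] (Fin n → ℂ) := fun B ↦ LinearMap.pi fun i ↦ B (b i)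
  have hinj : Function.Injective (Φ K) := by
    rw [← LinearMap.ker_eq_bot, LinearMap.ker_eq_bot']
    intro x hx
    have h0 : Matrix.of (fun i j ↦ K (b i) (b j)) *ᵥ (b.repr x) = 0 := by
      funext i
      rw [← LinearMap.apply_sum_smul_eq_mulVec, b.sum_repr]
      exact congrFun hx i
    have := Matrix.eq_zero_of_mulVec_eq_zero hdet h0
    exact b.repr.map_eq_zero_iff.1 (DFunLike.coe_injective this)
  have hfr : finrank ℂ V = finrank ℂ (Fin n → ℂ) := by
    rw [finrank_eq_card_basis b, finrank_fintype_fun_eq_card]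
  let e := LinearEquiv.ofInjectiveOfFinrankEq (Φ K) hinj hfr
  refine ⟨e.symm.toLinearMap ∘ₗ Φ H, fun x y ↦ ?_⟩
  have h1 : Φ K (e.symm (Φ H x)) = Φ H x := e.apply_symm_apply _
  rw [← b.sum_repr y]
  simp only [map_sum, LinearMap.sum_apply, map_smulₛₗ, LinearMap.smul_apply]
  exact Finset.sum_congr rfl fun i _ ↦ congrArg _ (congrFun h1 i)

/-- A pair of Hermitian forms whose real pencil is balanced has a common isotropic subspace. -/
theorem PencilBalanced.hasCommonIsotropic {n : ℕ} : ∀ {V : Type u} [AddCommGroup V] [Module ℂ V]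
    [FiniteDimensional ℂ V] {H K : V →ₗ⋆[ℂ] V →ₗ[ℂ] ℂ}, finrank ℂ V = n → H.IsSymm → K.IsSymm →
    ∀ {k : ℕ}, PencilBalanced H K ⊤ k → HasCommonIsotropic H K ⊤ k := by
  induction n using Nat.strong_induction_on with
  | _ n ih =>
  intro V _ _ _ H K hn hH hK k hbal
  have ih' : ∀ {H K : V →ₗ⋆[ℂ] V →ₗ[ℂ] ℂ}, H.IsSymm → K.IsSymm → ∀ W : Submodule ℂ V,
      finrank ℂ W < finrank ℂ V → ∀ k, PencilBalanced H K W k → HasCommonIsotropic H K W k := by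
    intro H K hH hK W hW k hbal
    refine .of_domRestrict (ih (finrank ℂ W) (hn ▸ hW) (V := W) (H := H.domRestrict₁₂ W W)
      (K := K.domRestrict₁₂ W W) rfl ⟨fun x y ↦ hH.eq x y⟩ ⟨fun x y ↦ hK.eq x y⟩ ?_)
    filter_upwards [hbal] with t ht
    exact ⟨ht.1.domRestrict, ht.2.domRestrict⟩
  rcases Nat.eq_zero_or_pos n with h0 | h0
  · obtain ⟨t, ⟨U, -, hk, -⟩, -⟩ := hbal.exists
    have := Submodule.finrank_le U
    exact ⟨⊥, bot_le, by omega, by simp⟩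
  have : Nontrivial V := nontrivial_of_finrank_pos (R := ℂ) (hn ▸ h0)
  let b := finBasis ℂ V
  by_cases hdet : ((Polynomial.X : Polynomial ℂ) •
      (Matrix.of fun i j ↦ K (b i) (b j)).map Polynomial.C -
      (Matrix.of fun i j ↦ H (b i) (b j)).map Polynomial.C).det = 0
  · obtain ⟨x, hx0, hx, hne⟩ := exists_chain_of_det_eq_zero hH hK b hdet
    exact .of_chain hH hK hbal x hx0 hx hne (ih' hH hK)
  · have hroots := Polynomial.finite_setOfPred_isRoot hdet
    have hinf := (hroots.preimage (f := fun t : ℝ ↦ (t : ℂ))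
      Complex.ofReal_injective.injOn).infinite_compl
    obtain ⟨t, ht⟩ := hinf.nonempty
    have hdett : (Matrix.of fun i j ↦ ((t : ℂ) • K - H) (b i) (b j)).det ≠ 0 := by
      refine fun h ↦ ht ?_
      change Polynomial.eval (t : ℂ) _ = 0
      rw [← Polynomial.coe_evalRingHom, RingHom.map_det, ← h]
      congr 1
      ext i j
      simp
      ring
    have hK' := hH.real_smul_sub hK t
    obtain ⟨T, hT⟩ := exists_endomorphism_of_det_ne_zero b hdett K
    obtain ⟨S, hSW, hk, hS⟩ :=
      HasCommonIsotropic.of_endomorphism hK hK' (hbal.real_smul_sub t) T hT (ih' hK hK')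
    refine ⟨S, hSW, hk, fun x hx y hy ↦ ?_⟩
    obtain ⟨h1, h2⟩ := hS x hx y hy
    refine ⟨?_, h1⟩
    simpa [h1] using h2

end Pencils

theorem List.SortedLE.le_getD_iff {l : List ℝ} (hl : l.SortedLE) {k : ℕ} (hk : 1 ≤ k)
    (hkl : k ≤ l.length) (c : ℝ) :
    c ≤ l.getD (l.length - k) 0 ↔ k ≤ l.countP (c ≤ ·) := by
  have hlt : l.length - k < l.length := by omega
  rw [List.getD_eq_getElem _ _ hlt]
  have hmono := hl.monotone_get
  constructor
  · intro h
    rw [← List.take_append_drop (l.length - k) l, List.countP_append]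
    have : (l.drop (l.length - k)).countP (c ≤ ·) = k := by
      rw [List.countP_eq_length.2, List.length_drop]
      · omega
      · intro a ha
        obtain ⟨i, hi, rfl⟩ := List.getElem_of_mem ha
        rw [List.length_drop] at hi
        rw [List.getElem_drop, decide_eq_true_iff]
        exact h.trans (hmono (a := ⟨l.length - k, hlt⟩)
          (b := ⟨l.length - k + i, by omega⟩) (by simp))
    omega
  · intro h
    by_contra! hc
    rw [← List.take_append_drop (l.length - k + 1) l, List.countP_append] at h
    have h1 : (l.take (l.length - k + 1)).countP (c ≤ ·) = 0 := by
      rw [List.countP_eq_zero]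
      intro a ha
      obtain ⟨i, hi, rfl⟩ := List.getElem_of_mem ha
      rw [List.length_take] at hi
      rw [List.getElem_take, decide_eq_true_iff, not_le]
      refine lt_of_le_of_lt (hmono (a := ⟨i, by omega⟩) (b := ⟨l.length - k, hlt⟩) ?_) hc
      rw [Fin.mk_le_mk]
      omega
    have h2 := List.countP_le_length (p := fun x ↦ decide (c ≤ x)) (l := l.drop (l.length - k + 1))
    rw [List.length_drop] at h2
    omega

theorem le_lambdaKth_iff {n k : ℕ} (hk1 : 1 ≤ k) (hkn : k ≤ n) {M : Matrix (Fin n) (Fin n) ℂ}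
    (hM : M.IsHermitian) (c : ℝ) :
    c ≤ lambdaKth M k ↔ k ≤ Fintype.card {i // c ≤ hM.eigenvalues i} := by
  rw [lambdaKth, dif_pos hM]
  set s := Finset.univ.val.map hM.eigenvalues
  have hlen : (s.sort (· ≤ ·)).length = n := by simp [s]
  have hcount : (s.sort (· ≤ ·)).countP (c ≤ ·) = Fintype.card {i // c ≤ hM.eigenvalues i} := by
    rw [← Multiset.coe_countP, Multiset.sort_eq, Multiset.countP_map, Fintype.card_subtype]
    rfl
  have := List.SortedLE.le_getD_iff (Multiset.pairwise_sort s (· ≤ ·)).sortedLE hk1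
    (hlen.symm ▸ hkn) c
  rwa [hlen, hcount] at this

/-- The sesquilinear form `(x, y) ↦ x* M y`. -/
noncomputable def Matrix.sesqForm {n : ℕ} (M : Matrix (Fin n) (Fin n) ℂ) :
    (Fin n → ℂ) →ₗ⋆[ℂ] (Fin n → ℂ) →ₗ[ℂ] ℂ :=
  LinearMap.mk₂'ₛₗ (starRingEnd ℂ) (RingHom.id ℂ) (fun x y ↦ star x ⬝ᵥ M *ᵥ y)
    (fun x x' y ↦ by simp [add_dotProduct]) (fun c x y ↦ by simp [smul_dotProduct])
    (fun x y y' ↦ by simp [mulVec_add, dotProduct_add])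
    (fun c x y ↦ by simp [mulVec_smul, dotProduct_smul])

theorem Matrix.sesqForm_apply {n : ℕ} (M : Matrix (Fin n) (Fin n) ℂ) (x y : Fin n → ℂ) :
    M.sesqForm x y = star x ⬝ᵥ M *ᵥ y := rfl

theorem Matrix.IsHermitian.isSymm_sesqForm {n : ℕ} {M : Matrix (Fin n) (Fin n) ℂ}
    (hM : M.IsHermitian) : M.sesqForm.IsSymm :=
  ⟨fun x y ↦ by
    rw [sesqForm_apply, sesqForm_apply, starRingEnd_apply, star_dotProduct, star_star,
      star_mulVec, hM.eq, ← dotProduct_mulVec]⟩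

theorem Matrix.IsHermitian.re_sesqForm_sub {n : ℕ} {M : Matrix (Fin n) (Fin n) ℂ}
    (hM : M.IsHermitian) (c : ℝ) (x : Fin n → ℂ) :
    ((M - (c : ℂ) • 1).sesqForm x x).re = ∑ i, (hM.eigenvalues i - c) *
      Complex.normSq (((star hM.eigenvectorUnitary : Matrix.unitaryGroup (Fin n) ℂ).1 *ᵥ x) i) := by
  set U := hM.eigenvectorUnitary
  have h1 : M - (c : ℂ) • 1 = U.1 * diagonal (fun i ↦ ((hM.eigenvalues i - c : ℝ) : ℂ)) *
      (star U.1) := by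
    have e : diagonal (fun i ↦ ((hM.eigenvalues i - c : ℝ) : ℂ)) =
        diagonal (RCLike.ofReal ∘ hM.eigenvalues) - (c : ℂ) • 1 := by
      rw [← diagonal_one, ← diagonal_smul, diagonal_sub]
      congr 1
      ext i
      simp
    rw [e, mul_sub, sub_mul, mul_smul_comm, mul_one, smul_mul_assoc,
      Unitary.mul_star_self_of_mem U.2]
    congr 1
    conv_lhs => rw [hM.spectral_theorem, Unitary.conjStarAlgAut_apply]
  have h2 : (M - (c : ℂ) • 1).sesqForm x x = star (star U.1 *ᵥ x) ⬝ᵥ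
      diagonal (fun i ↦ ((hM.eigenvalues i - c : ℝ) : ℂ)) *ᵥ (star U.1 *ᵥ x) := by
    rw [h1, sesqForm_apply, star_mulVec, star_eq_conjTranspose, conjTranspose_conjTranspose,
      ← dotProduct_mulVec, mulVec_mulVec, mulVec_mulVec, mul_assoc]
  rw [h2]
  simp only [dotProduct, mulVec_diagonal, Complex.re_sum]
  refine Finset.sum_congr rfl fun i _ ↦ ?_
  rw [mul_left_comm, Complex.re_ofReal_mul, Pi.star_apply, Complex.star_def,
    ← Complex.normSq_eq_conj_mul_self, Complex.ofReal_re]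
  rfl

/-- Courant-Fischer: the `k`-th largest eigenvalue is at least `c` if and only if `M - c` is
nonnegative on a `k`-dimensional subspace. -/
theorem le_lambdaKth_iff_hasNonnegSubspace {n k : ℕ} (hk1 : 1 ≤ k) (hkn : k ≤ n)
    {M : Matrix (Fin n) (Fin n) ℂ} (hM : M.IsHermitian) (c : ℝ) :
    c ≤ lambdaKth M k ↔ HasNonnegSubspace (M - (c : ℂ) • 1).sesqForm ⊤ k := by
  classical
  rw [le_lambdaKth_iff hk1 hkn hM]
  let e := Matrix.UnitaryGroup.toLinearEquiv (star hM.eigenvectorUnitary)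
  have hre : ∀ x, ((M - (c : ℂ) • 1).sesqForm x x).re =
      ∑ i, (hM.eigenvalues i - c) * Complex.normSq (e x i) := hM.re_sesqForm_sub c
  constructor
  · intro h
    let J : Set (Fin n) := {i | c ≤ hM.eigenvalues i}
    let Z : Submodule ℂ (Fin n → ℂ) := ⨅ i ∈ Jᶜ, LinearMap.ker (LinearMap.proj i)
    have hZ : Module.finrank ℂ Z = Fintype.card {i // c ≤ hM.eigenvalues i} := by
      rw [(LinearMap.iInfKerProjEquiv ℂ (fun _ : Fin n ↦ ℂ) (I := J) (J := Jᶜ)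
        disjoint_compl_right (by simp)).finrank_eq, Module.finrank_fintype_fun_eq_card]
      rfl
    refine ⟨Z.map e.symm.toLinearMap, le_top, ?_, ?_⟩
    · rw [LinearEquiv.finrank_map_eq e.symm Z, hZ]
      exact h
    · rintro _ ⟨y, hy, rfl⟩
      rw [hre]
      refine Finset.sum_nonneg fun i _ ↦ ?_
      by_cases hi : c ≤ hM.eigenvalues i
      · exact mul_nonneg (sub_nonneg.2 hi) (Complex.normSq_nonneg _)
      · have : y i = 0 := by
          have := (Submodule.mem_iInf _).1 hy i
          exact (Submodule.mem_iInf _).1 this hi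
        simp [this]
  · rintro ⟨U, -, hkU, hU⟩
    let f : U →ₗ[ℂ] ({i // c ≤ hM.eigenvalues i} → ℂ) :=
      (LinearMap.pi fun i ↦ LinearMap.proj i.1) ∘ₗ e.toLinearMap ∘ₗ U.subtype
    have hf : Function.Injective f := by
      rw [← LinearMap.ker_eq_bot, LinearMap.ker_eq_bot']
      rintro ⟨x, hx⟩ h
      have h0 : ∀ i, c ≤ hM.eigenvalues i → e x i = 0 := fun i hi ↦ congrFun h ⟨i, hi⟩
      have hterm : ∀ i ∈ Finset.univ, (hM.eigenvalues i - c) * Complex.normSq (e x i) ≤ 0 := by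
        intro i _
        by_cases hi : c ≤ hM.eigenvalues i
        · simp [h0 i hi]
        · exact mul_nonpos_of_nonpos_of_nonneg (by linarith) (Complex.normSq_nonneg _)
      have hx0 := hU x hx
      rw [hre] at hx0
      have hzero := (Finset.sum_eq_zero_iff_of_nonpos hterm).1
        (le_antisymm (Finset.sum_nonpos hterm) hx0)
      have hex : e x = 0 := by
        ext i
        by_cases hi : c ≤ hM.eigenvalues i
        · exact h0 i hi
        · have := (mul_eq_zero.1 (hzero i (Finset.mem_univ i))).resolve_left
            (by linarith : hM.eigenvalues i - c < 0).ne
          exact Complex.normSq_eq_zero.1 this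
      exact Subtype.ext (e.map_eq_zero_iff.1 hex)
    have := LinearMap.finrank_le_finrank_of_injective hf
    rw [Module.finrank_fintype_fun_eq_card] at this
    omega

theorem Matrix.dotProduct_conjTranspose_mulVec {n : ℕ} (B : Matrix (Fin n) (Fin n) ℂ)
    (x y : Fin n → ℂ) : star x ⬝ᵥ Bᴴ *ᵥ y = star (star y ⬝ᵥ B *ᵥ x) := by
  rw [star_dotProduct, star_mulVec, conjTranspose_conjTranspose, ← dotProduct_mulVec]

/-- The half-plane condition in direction `w` says that `Re (w (A - μ))` is nonnegative on a
`k`-dimensional subspace. -/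
theorem re_le_lambdaKth_iff {n k : ℕ} (hk1 : 1 ≤ k) (hkn : k ≤ n) (A : Matrix (Fin n) (Fin n) ℂ)
    (μ w : ℂ) :
    (w * μ + starRingEnd ℂ w * starRingEnd ℂ μ).re ≤ lambdaKth (w • A + starRingEnd ℂ w • Aᴴ) k ↔
      HasNonnegSubspace (w • (A - μ • 1)).sesqForm ⊤ k := by
  have hM : (w • A + starRingEnd ℂ w • Aᴴ).IsHermitian := by
    rw [IsHermitian, conjTranspose_add, conjTranspose_smul, conjTranspose_smul,
      conjTranspose_conjTranspose, Complex.star_def, Complex.conj_conj, add_comm]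
  rw [le_lambdaKth_iff_hasNonnegSubspace hk1 hkn hM]
  have hre : ∀ x, ((w • A + starRingEnd ℂ w • Aᴴ -
      (((w * μ + starRingEnd ℂ w * starRingEnd ℂ μ).re : ℝ) : ℂ) • 1).sesqForm x x).re =
      2 * ((w • (A - μ • 1)).sesqForm x x).re := by
    intro x
    have h1 : ((w * μ + starRingEnd ℂ w * starRingEnd ℂ μ).re : ℂ) =
        w * μ + starRingEnd ℂ (w * μ) := by
      rw [map_mul, ← Complex.conj_eq_iff_re]
      simp [add_comm]
    have h2 : w • A + starRingEnd ℂ w • Aᴴ - (w * μ + starRingEnd ℂ (w * μ)) • 1 =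
        w • (A - μ • 1) + (w • (A - μ • 1))ᴴ := by
      rw [conjTranspose_smul, conjTranspose_sub, conjTranspose_smul, conjTranspose_one,
        Complex.star_def, map_mul]
      module
    rw [h1, h2, sesqForm_apply, add_mulVec, dotProduct_add, dotProduct_conjTranspose_mulVec,
      Complex.add_re, Complex.star_def, Complex.conj_re, sesqForm_apply]
    ring
  constructor <;> intro h
  · exact h.smul (r := 1 / 2) (by norm_num) fun x ↦ by rw [hre]; ring
  · exact h.smul zero_le_two hre

theorem hasNonnegSubspace_smul_of_unit {n k : ℕ} {B : Matrix (Fin n) (Fin n) ℂ}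
    (h : ∀ ξ ∈ Set.Ico (0 : ℝ) (2 * Real.pi),
      HasNonnegSubspace (Complex.exp (ξ * Complex.I) • B).sesqForm ⊤ k) (w : ℂ) :
    HasNonnegSubspace (w • B).sesqForm ⊤ k := by
  obtain ⟨ξ, hξ, hw⟩ : ∃ ξ ∈ Set.Ico (0 : ℝ) (2 * Real.pi),
      w = (‖w‖ : ℂ) * Complex.exp (ξ * Complex.I) := by
    rcases le_or_gt 0 w.arg with h0 | h0
    · exact ⟨w.arg, ⟨h0, by linarith [w.arg_le_pi, Real.pi_pos]⟩,
        (Complex.norm_mul_exp_arg_mul_I w).symm⟩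
    · refine ⟨w.arg + 2 * Real.pi, ⟨by linarith [w.neg_pi_lt_arg], by linarith⟩, ?_⟩
      push_cast
      rw [add_mul, Complex.exp_add, Complex.exp_two_pi_mul_I, mul_one,
        Complex.norm_mul_exp_arg_mul_I]
  refine (h ξ hξ).smul (norm_nonneg w) fun x ↦ ?_
  conv_lhs => rw [hw]
  rw [mul_smul, sesqForm_apply, smul_mulVec, dotProduct_smul, smul_eq_mul, Complex.re_ofReal_mul]
  rfl

/-- If every rotation of `B` has nonnegative real part on a `k`-dimensional subspace, then `B`
vanishes on a `k`-dimensional subspace. -/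
theorem exists_isotropic_of_hasNonnegSubspace {n k : ℕ} {B : Matrix (Fin n) (Fin n) ℂ}
    (h : ∀ w : ℂ, HasNonnegSubspace (w • B).sesqForm ⊤ k) :
    ∃ S : Submodule ℂ (Fin n → ℂ), k ≤ Module.finrank ℂ S ∧
      ∀ x ∈ S, ∀ y ∈ S, star x ⬝ᵥ B *ᵥ y = 0 := by
  have hH : (B + Bᴴ).IsHermitian := isHermitian_add_transpose_self B
  have hK : (Complex.I • (B - Bᴴ)).IsHermitian := by
    rw [IsHermitian, conjTranspose_smul, conjTranspose_sub, conjTranspose_conjTranspose,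
      Complex.star_def, Complex.conj_I, neg_smul, ← smul_neg, neg_sub]
  have hre : ∀ (t : ℝ) (x : Fin n → ℂ),
      (((t : ℂ) • (Complex.I • (B - Bᴴ)).sesqForm - (B + Bᴴ).sesqForm) x x).re =
      2 * (((-1 + t * Complex.I) • B).sesqForm x x).re := by
    intro t x
    simp only [LinearMap.sub_apply, LinearMap.smul_apply, sesqForm_apply, smul_mulVec, sub_mulVec,
      add_mulVec, dotProduct_smul, dotProduct_sub, dotProduct_add, dotProduct_conjTranspose_mulVec,
      smul_eq_mul]
    generalize star x ⬝ᵥ B *ᵥ x = z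
    simp
    ring
  obtain ⟨S, -, hk, hS⟩ := PencilBalanced.hasCommonIsotropic (k := k) rfl hH.isSymm_sesqForm
    hK.isSymm_sesqForm (.of_forall fun t ↦ ⟨(h (-1 + t * Complex.I)).smul zero_le_two (hre t),
      (h (1 - t * Complex.I)).smul zero_le_two fun x ↦ by
        rw [LinearMap.neg_apply, LinearMap.neg_apply, Complex.neg_re, hre]
        simp only [sesqForm_apply, smul_mulVec, dotProduct_smul, smul_eq_mul]
        simp
        ring⟩)
  refine ⟨S, hk, fun x hx y hy ↦ ?_⟩
  obtain ⟨h1, h2⟩ := hS x hx y hy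
  simp only [sesqForm_apply, smul_mulVec, sub_mulVec, add_mulVec, dotProduct_smul, dotProduct_sub,
    dotProduct_add, smul_eq_mul, mul_eq_zero, Complex.I_ne_zero, false_or] at h1 h2
  linear_combination (h1 + h2) / 2

open scoped ComplexOrder in
theorem mem_rankKRange_of_isotropic {n k : ℕ} {A : Matrix (Fin n) (Fin n) ℂ} {μ : ℂ}
    (S : Submodule ℂ (Fin n → ℂ)) (hk : k ≤ Module.finrank ℂ S)
    (hS : ∀ x ∈ S, ∀ y ∈ S, star x ⬝ᵥ (A - μ • 1) *ᵥ y = 0) : μ ∈ rankKRange k A := by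
  let S' : Submodule ℂ (EuclideanSpace ℂ (Fin n)) :=
    S.comap (WithLp.linearEquiv 2 ℂ (Fin n → ℂ)).toLinearMap
  have hS' : Module.finrank ℂ S' = Module.finrank ℂ S :=
    ((WithLp.linearEquiv 2 ℂ (Fin n → ℂ)).ofSubmodule' S).finrank_eq
  let b := stdOrthonormalBasis ℂ S'
  let c : Fin k → EuclideanSpace ℂ (Fin n) := fun i ↦ b (Fin.castLE (hk.trans_eq hS'.symm) i)
  have hc : Orthonormal ℂ c :=
    (b.orthonormal.comp_linearIsometry S'.subtypeₗᵢ).comp _ (Fin.castLE_injective _)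
  have hcS : ∀ i, (c i).ofLp ∈ S := fun i ↦ (b (Fin.castLE (hk.trans_eq hS'.symm) i)).2
  let C : Matrix (Fin n) (Fin k) ℂ := Matrix.of fun i j ↦ c j i
  have hmul : ∀ (M : Matrix (Fin n) (Fin n) ℂ) (i j : Fin k),
      (Cᴴ * M * C) i j = star (c i).ofLp ⬝ᵥ M *ᵥ (c j).ofLp := by
    intro M i j
    rw [Matrix.mul_assoc, Matrix.mul_apply']
    rfl
  have hCC : Cᴴ * C = 1 := by
    ext i j
    have h1 := hmul 1 i j
    rw [Matrix.mul_one, one_mulVec] at h1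
    rw [h1, dotProduct_comm, ← EuclideanSpace.inner_eq_star_dotProduct, orthonormal_iff_ite.1 hc,
      Matrix.one_apply]
  have hCA : Cᴴ * A * C = μ • 1 := by
    rw [← sub_eq_zero, ← hCC]
    ext i j
    have h1 := (hmul (A - μ • 1) i j).trans (hS _ (hcS i) _ (hcS j))
    rw [Matrix.mul_sub, Matrix.sub_mul, Matrix.mul_smul, Matrix.mul_one, Matrix.smul_mul] at h1
    exact h1
  refine ⟨C * Cᴴ, isHermitian_mul_conjTranspose_self C, ?_, ?_, ?_⟩
  · rw [Matrix.mul_assoc, ← Matrix.mul_assoc Cᴴ, hCC, Matrix.one_mul]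
  · rw [rank_self_mul_conjTranspose, ← rank_conjTranspose_mul_self, hCC, rank_one, Fintype.card_fin]
  · calc C * Cᴴ * A * (C * Cᴴ) = C * (Cᴴ * A * C) * Cᴴ := by simp only [Matrix.mul_assoc]
      _ = _ := by rw [hCA, Matrix.mul_smul, Matrix.mul_one, Matrix.smul_mul]

theorem hasNonnegSubspace_of_mem_rankKRange {n k : ℕ} {A : Matrix (Fin n) (Fin n) ℂ} {μ : ℂ}
    (hμ : μ ∈ rankKRange k A) (w : ℂ) : HasNonnegSubspace (w • (A - μ • 1)).sesqForm ⊤ k := by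
  obtain ⟨P, hP, hPP, hrank, hPA⟩ := hμ
  refine ⟨LinearMap.range P.mulVecLin, le_top, hrank.ge, ?_⟩
  rintro _ ⟨x, rfl⟩
  have h0 : P * (A - μ • 1) * P = 0 := by
    rw [Matrix.mul_sub, Matrix.sub_mul, Matrix.mul_smul, Matrix.mul_one, Matrix.smul_mul, hPP, hPA,
      sub_self]
  have h1 : star (P *ᵥ x) ⬝ᵥ (A - μ • 1) *ᵥ (P *ᵥ x) = 0 := by
    rw [star_mulVec, hP.eq, ← dotProduct_mulVec, mulVec_mulVec, mulVec_mulVec, h0,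
      zero_mulVec, dotProduct_zero]
  rw [mulVecLin_apply, sesqForm_apply, smul_mulVec, dotProduct_smul, h1, smul_zero,
    Complex.zero_re]

theorem rankKRange_eq_iInter_halfPlanes {n k : ℕ} (hk1 : 1 ≤ k) (hkn : k ≤ n)
    (A : Matrix (Fin n) (Fin n) ℂ) :
    rankKRange k A =
      ⋂ ξ ∈ Set.Ico (0 : ℝ) (2 * Real.pi),
        {μ : ℂ | (Complex.exp (ξ * Complex.I) * μ
              + Complex.exp (-(ξ * Complex.I)) * (starRingEnd ℂ) μ).re
            ≤ lambdaKth (Complex.exp (ξ * Complex.I) • A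
              + Complex.exp (-(ξ * Complex.I)) • Aᴴ) k} := by
  ext μ
  have hexp : ∀ ξ : ℝ, Complex.exp (-(ξ * Complex.I)) =
      starRingEnd ℂ (Complex.exp (ξ * Complex.I)) := fun ξ ↦ by
    rw [← Complex.exp_conj, map_mul, Complex.conj_ofReal, Complex.conj_I, mul_neg]
  simp only [Set.mem_iInter, Set.mem_ofPred_eq, hexp, re_le_lambdaKth_iff hk1 hkn]
  refine ⟨fun hμ ξ _ ↦ hasNonnegSubspace_of_mem_rankKRange hμ _, fun h ↦ ?_⟩
  obtain ⟨S, hk, hS⟩ :=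
    exists_isotropic_of_hasNonnegSubspace (hasNonnegSubspace_smul_of_unit h)
  exact mem_rankKRange_of_isotropic S hk hS
end

section
/- Let A be an n×n complex matrix and 1 ≤ k ≤ n. Then the rank-k numerical range Λ_k(A) is a convex subset of ℂ. -/
open Matrix

open scoped InnerProductSpace

section Invariant

variable {F : Type*} [AddCommGroup F] [Module ℂ F]

theorem mem_sup_span_singleton_iff {W : Submodule ℂ F} {x z : F} :
    z ∈ W ⊔ ℂ ∙ x ↔ ∃ w ∈ W, ∃ a : ℂ, w + a • x = z := by
  simp [Submodule.mem_sup, Submodule.mem_span_singleton]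

variable [FiniteDimensional ℂ F]

/-- A linear map has an eigenvector modulo an invariant subspace `W` inside any invariant
subspace `R` not contained in `W`. -/
theorem exists_eigenvector_mod (T : F →ₗ[ℂ] F) (W R : Submodule ℂ F)
    (hW : ∀ x ∈ W, T x ∈ W) (hR : ∀ x ∈ R, T x ∈ R) (hRW : ¬ R ≤ W) :
    ∃ x ∈ R, x ∉ W ∧ ∃ c : ℂ, T x - c • x ∈ W := by
  let S : Module.End ℂ (F ⧸ W) := W.mapQ W T hW
  let R' : Submodule ℂ (F ⧸ W) := R.map W.mkQ
  have hS : ∀ z ∈ R', S z ∈ R' := by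
    rintro _ ⟨x, hx, rfl⟩
    exact ⟨T x, hR x hx, rfl⟩
  have hne : Nontrivial R' := by
    obtain ⟨x, hx, hxW⟩ := SetLike.not_le_iff_exists.mp hRW
    refine ⟨⟨⟨W.mkQ x, x, hx, rfl⟩, 0, fun h => hxW ?_⟩⟩
    simpa using congrArg Subtype.val h
  obtain ⟨c, hc⟩ := Module.End.exists_eigenvalue (LinearMap.restrict S hS)
  obtain ⟨⟨_, x, hx, rfl⟩, hv⟩ := hc.exists_hasEigenvector
  refine ⟨x, hx, fun h => hv.2 ?_, c, ?_⟩
  · ext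
    simpa using h
  · have h := congrArg Subtype.val hv.apply_eq_smul
    rw [← Submodule.Quotient.mk_eq_zero, Submodule.Quotient.mk_sub, sub_eq_zero]
    exact h

end Invariant

section Neutral

variable {E : Type*} [NormedAddCommGroup E] [InnerProductSpace ℂ E]

/-- A symmetric operator that is positive definite on one summand and negative definite on the
other is injective. -/
theorem eq_zero_of_definite_summands {g : E →ₗ[ℂ] E} (hg : g.IsSymmetric)
    {U V : Submodule ℂ E} (hUV : U ⊔ V = ⊤)
    (hU : ∀ u ∈ U, u ≠ 0 → 0 < (⟪g u, u⟫_ℂ).re)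
    (hV : ∀ v ∈ V, v ≠ 0 → (⟪g v, v⟫_ℂ).re < 0) {x : E} (hx : g x = 0) : x = 0 := by
  obtain ⟨u, hu, v, hv, rfl⟩ := Submodule.mem_sup.mp (hUV ▸ Submodule.mem_top : x ∈ U ⊔ V)
  have h1 : ⟪g (u + v), u⟫_ℂ = 0 := by rw [hx, inner_zero_left]
  have h2 : ⟪g (u + v), v⟫_ℂ = 0 := by rw [hx, inner_zero_left]
  rw [map_add, inner_add_left] at h1 h2
  have h3 : (⟪g v, u⟫_ℂ).re = (⟪g u, v⟫_ℂ).re := by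
    rw [hg v u, ← inner_conj_symm, Complex.conj_re]
  have h4 : (⟪g u, u⟫_ℂ).re = (⟪g v, v⟫_ℂ).re := by
    have e1 := congrArg Complex.re h1
    have e2 := congrArg Complex.re h2
    simp only [Complex.add_re, Complex.zero_re] at e1 e2
    linarith
  by_cases hu0 : u = 0
  · by_cases hv0 : v = 0
    · simp [hu0, hv0]
    · have := hV v hv hv0
      simp [← h4, hu0] at this
  · have h5 := hU u hu hu0
    by_cases hv0 : v = 0
    · simp [h4, hv0] at h5
    · linarith [hV v hv hv0]

/-- In the span of a positive and a negative vector there is a neutral vector `u + s • v`. -/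
theorem exists_neutral_add_smul {g : E →ₗ[ℂ] E} (hg : g.IsSymmetric) {u v : E}
    (hu : 0 < (⟪g u, u⟫_ℂ).re) (hv : (⟪g v, v⟫_ℂ).re < 0) :
    ∃ s : ℝ, ⟪g (u + (s : ℂ) • v), u + (s : ℂ) • v⟫_ℂ = 0 := by
  have hre : ∀ s : ℝ, (⟪g (u + (s : ℂ) • v), u + (s : ℂ) • v⟫_ℂ).re =
      (⟪g v, v⟫_ℂ).re * (s * s) + 2 * (⟪g u, v⟫_ℂ).re * s + (⟪g u, u⟫_ℂ).re := by
    intro s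
    have h3 : (⟪g v, u⟫_ℂ).re = (⟪g u, v⟫_ℂ).re := by
      rw [hg v u, ← inner_conj_symm, Complex.conj_re]
    simp only [map_add, map_smul, inner_add_left, inner_add_right, inner_smul_left,
      inner_smul_right, Complex.conj_ofReal, Complex.add_re, Complex.re_ofReal_mul, h3]
    ring
  obtain ⟨s, hs⟩ := exists_quadratic_eq_zero (a := (⟪g v, v⟫_ℂ).re)
    (b := 2 * (⟪g u, v⟫_ℂ).re) (c := (⟪g u, u⟫_ℂ).re) hv.ne
    ⟨√(discrim _ _ _), (Real.mul_self_sqrt (by unfold discrim; nlinarith)).symm⟩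
  refine ⟨s, Complex.ext ?_ ?_⟩
  · rw [hre, hs, Complex.zero_re]
  · exact Complex.conj_eq_iff_im.mp (hg.conj_inner_sym _ _)

variable [FiniteDimensional ℂ E]

/-- An invariant subspace of dimension less than half of that of the space can be enlarged, within
the invariant subspaces, by a neutral vector orthogonal to it. -/
theorem exists_neutral_extension {H T : E →ₗ[ℂ] E} (hH : H.IsSymmetric)
    (hHinj : Function.Injective H) (hT : ∀ x y, ⟪H (T x), y⟫_ℂ = ⟪H x, T y⟫_ℂ)
    (hreal : ∀ t : ℝ, t ≠ 0 → ∀ x, T x = (t : ℂ) • x → x = 0)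
    {U V W : Submodule ℂ E} {p : ℕ} (hEp : Module.finrank ℂ E = 2 * p)
    (hUp : Module.finrank ℂ U = p) (hVp : Module.finrank ℂ V = p)
    (hU : ∀ u ∈ U, u ≠ 0 → 0 < (⟪H u, u⟫_ℂ).re)
    (hV : ∀ v ∈ V, v ≠ 0 → (⟪H v, v⟫_ℂ).re < 0)
    (hWp : Module.finrank ℂ W < p) (hWT : ∀ x ∈ W, T x ∈ W) :
    ∃ x, x ∉ W ∧ (∀ w ∈ W, ⟪H w, x⟫_ℂ = 0) ∧ ⟪H x, x⟫_ℂ = 0 ∧ ∃ c : ℂ, T x - c • x ∈ W := by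
  let Q : Submodule ℂ E := (W.map H)ᗮ
  have memQ : ∀ x, x ∈ Q ↔ ∀ w ∈ W, ⟪H w, x⟫_ℂ = 0 := by
    intro x
    simp [Q, Submodule.mem_orthogonal]
  have hQfin : Module.finrank ℂ W + Module.finrank ℂ Q = 2 * p := by
    rw [← hEp, ← (W.map H).finrank_add_finrank_orthogonal,
      (Submodule.equivMapOfInjective H hHinj W).finrank_eq]
  have hQT : ∀ x ∈ Q, T x ∈ Q := by
    intro x hx
    rw [memQ] at hx ⊢
    intro w hw
    rw [← hT]
    exact hx _ (hWT w hw)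
  have hQW : ∀ x ∈ Q, ∀ w ∈ W, ⟪H x, w⟫_ℂ = 0 := by
    intro x hx w hw
    rw [hH, ← inner_conj_symm, (memQ x).mp hx w hw, map_zero]
  by_cases hTQ : Q.map T ≤ W
  · have meets : ∀ Y : Submodule ℂ E, Module.finrank ℂ Y = p → ∃ y ∈ Y, y ∈ Q ∧ y ≠ 0 := by
      intro Y hY
      have h1 := Submodule.finrank_sup_add_finrank_inf_eq Y Q
      have h2 := Submodule.finrank_le (Y ⊔ Q)
      have h3 : Y ⊓ Q ≠ ⊥ := by
        intro h
        rw [h, finrank_bot] at h1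
        omega
      obtain ⟨y, hy, hy0⟩ := Submodule.exists_mem_ne_zero_of_ne_bot h3
      exact ⟨y, hy.1, hy.2, hy0⟩
    obtain ⟨u, huU, huQ, hu0⟩ := meets U hUp
    obtain ⟨v, hvV, hvQ, hv0⟩ := meets V hVp
    have hu := hU u huU hu0
    have hv := hV v hvV hv0
    obtain ⟨s, hs⟩ := exists_neutral_add_smul hH hu hv
    have hxQ : u + (s : ℂ) • v ∈ Q := Q.add_mem huQ (Q.smul_mem _ hvQ)
    refine ⟨u + (s : ℂ) • v, fun hxW => ?_, (memQ _).mp hxQ, hs, 0, ?_⟩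
    · have h1 := hQW u huQ _ hxW
      have h2 := hQW v hvQ _ hxW
      have h3 : (⟪H v, u⟫_ℂ).re = (⟪H u, v⟫_ℂ).re := by
        rw [hH v u, ← inner_conj_symm, Complex.conj_re]
      rw [inner_add_right, inner_smul_right] at h1 h2
      have e1 := congrArg Complex.re h1
      have e2 := congrArg Complex.re h2
      simp only [Complex.add_re, Complex.zero_re, Complex.re_ofReal_mul] at e1 e2
      rw [h3] at e2
      have e3 : (⟪H u, u⟫_ℂ).re = s * s * (⟪H v, v⟫_ℂ).re := by linear_combination e1 - s * e2
      exact absurd (mul_nonpos_of_nonneg_of_nonpos (mul_self_nonneg s) hv.le)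
        (not_le.mpr (e3 ▸ hu))
    · rw [zero_smul, sub_zero]
      exact hTQ ⟨_, hxQ, rfl⟩
  · obtain ⟨x, ⟨y, hyQ, rfl⟩, hxW, c, hc⟩ := exists_eigenvector_mod T W (Q.map T) hWT
      (by rintro _ ⟨y, hy, rfl⟩; exact ⟨T y, hQT y hy, rfl⟩) hTQ
    have hxQ := hQT y hyQ
    refine ⟨T y, hxW, (memQ _).mp hxQ, ?_, c, hc⟩
    have key : ⟪H (T y), T (T y)⟫_ℂ = c * ⟪H (T y), T y⟫_ℂ := by
      have := hQW _ hxQ _ hc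
      rwa [inner_sub_right, inner_smul_right, sub_eq_zero] at this
    by_cases hc0 : c = 0
    · rw [hT]
      have h0 := hQW _ hyQ _ hc
      rwa [hc0, zero_smul, sub_zero] at h0
    · by_cases him : c.im = 0
      · exfalso
        have hct : c = (c.re : ℂ) := Complex.ext rfl (by simpa using him)
        have hre0 : c.re ≠ 0 := fun h => hc0 (by rw [hct, h, Complex.ofReal_zero])
        let G : E →ₗ[ℂ] E := T - c • LinearMap.id
        have hGW : ∀ w ∈ W, G w ∈ W := fun w hw => W.sub_mem (hWT w hw) (W.smul_mem c hw)
        have hGinj : Function.Injective G := by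
          rw [injective_iff_map_eq_zero]
          intro z hz
          refine hreal c.re hre0 z ?_
          rw [← hct]
          exact sub_eq_zero.mp hz
        have hsurj : Function.Surjective (G.restrict hGW) := by
          refine LinearMap.surjective_of_injective ?_
          intro a b hab
          exact Subtype.ext (hGinj (congrArg Subtype.val hab))
        obtain ⟨w, hw⟩ := hsurj ⟨T (T y) - c • T y, hc⟩
        have : (w : E) = T y := hGinj (congrArg Subtype.val hw)
        exact hxW (this ▸ w.2)
      · have h1 : ⟪H (T (T y)), T y⟫_ℂ = (starRingEnd ℂ c) * ⟪H (T y), T y⟫_ℂ := by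
          rw [hH, ← inner_conj_symm, key, map_mul, inner_conj_symm, ← hH]
        rw [hT, key] at h1
        have h2 : (c - starRingEnd ℂ c) * ⟪H (T y), T y⟫_ℂ = 0 := by
          rw [sub_mul, h1, sub_self]
        refine (mul_eq_zero.mp h2).resolve_left fun h => him ?_
        exact Complex.conj_eq_iff_im.mp (sub_eq_zero.mp h).symm

/-- Invariant neutral subspaces exist in every dimension up to half of that of the space. -/
theorem exists_neutral_invariant {H T : E →ₗ[ℂ] E} (hH : H.IsSymmetric)
    (hHinj : Function.Injective H) (hT : ∀ x y, ⟪H (T x), y⟫_ℂ = ⟪H x, T y⟫_ℂ)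
    (hreal : ∀ t : ℝ, t ≠ 0 → ∀ x, T x = (t : ℂ) • x → x = 0)
    {U V : Submodule ℂ E} {p : ℕ} (hEp : Module.finrank ℂ E = 2 * p)
    (hUp : Module.finrank ℂ U = p) (hVp : Module.finrank ℂ V = p)
    (hU : ∀ u ∈ U, u ≠ 0 → 0 < (⟪H u, u⟫_ℂ).re)
    (hV : ∀ v ∈ V, v ≠ 0 → (⟪H v, v⟫_ℂ).re < 0) {m : ℕ} (hm : m ≤ p) :
    ∃ W : Submodule ℂ E, Module.finrank ℂ W = m ∧ (∀ x ∈ W, T x ∈ W) ∧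
      ∀ x ∈ W, ∀ y ∈ W, ⟪H x, y⟫_ℂ = 0 := by
  induction m with
  | zero => exact ⟨⊥, finrank_bot ℂ E, by simp, by simp⟩
  | succ m ih =>
    obtain ⟨W, hWm, hWT, hWH⟩ := ih (by omega)
    obtain ⟨x, hxW, hWx, hxx, c, hc⟩ := exists_neutral_extension hH hHinj hT hreal hEp hUp hVp
      hU hV (by omega) hWT
    have hxW' : ∀ w ∈ W, ⟪H x, w⟫_ℂ = 0 := by
      intro w hw
      rw [hH, ← inner_conj_symm, hWx w hw, map_zero]
    refine ⟨W ⊔ ℂ ∙ x, ?_, ?_, ?_⟩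
    · have hx0 : x ≠ 0 := fun h => hxW (h ▸ W.zero_mem)
      have hinf : W ⊓ ℂ ∙ x = ⊥ :=
        disjoint_iff.mp (Submodule.disjoint_span_singleton' hx0 |>.mpr hxW)
      have h1 := Submodule.finrank_sup_add_finrank_inf_eq W (ℂ ∙ x)
      rwa [hinf, finrank_bot, add_zero, finrank_span_singleton hx0, hWm] at h1
    · intro z hz
      obtain ⟨w, hw, a, rfl⟩ := mem_sup_span_singleton_iff.mp hz
      have : T (w + a • x) = (T w + a • (T x - c • x)) + (a * c) • x := by
        rw [map_add, map_smul, smul_sub, smul_smul]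
        abel
      rw [this]
      exact mem_sup_span_singleton_iff.mpr
        ⟨_, W.add_mem (hWT w hw) (W.smul_mem a hc), a * c, rfl⟩
    · intro z hz z' hz'
      obtain ⟨w, hw, a, rfl⟩ := mem_sup_span_singleton_iff.mp hz
      obtain ⟨w', hw', a', rfl⟩ := mem_sup_span_singleton_iff.mp hz'
      simp [hWH w hw w' hw', hWx w hw, hxW' w' hw', hxx]

/-- If the quadratic form of `f` is a positive real multiple of the norm on one half of the space
and a negative one on a complementary half, then `f` has an isotropic subspace of half the
dimension. -/
theorem exists_isotropic (f : E →ₗ[ℂ] E) {U V : Submodule ℂ E} {p : ℕ} (hUV : U ⊔ V = ⊤)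
    (hEp : Module.finrank ℂ E = 2 * p)
    (hUp : Module.finrank ℂ U = p) (hVp : Module.finrank ℂ V = p) {a b : ℝ} (ha : 0 < a)
    (hb : b < 0) (hU : ∀ u ∈ U, ⟪u, f u⟫_ℂ = (a : ℂ) * ⟪u, u⟫_ℂ)
    (hV : ∀ v ∈ V, ⟪v, f v⟫_ℂ = (b : ℂ) * ⟪v, v⟫_ℂ) :
    ∃ W : Submodule ℂ E, Module.finrank ℂ W = p ∧ ∀ x ∈ W, ∀ y ∈ W, ⟪x, f y⟫_ℂ = 0 := by
  let H : E →ₗ[ℂ] E := f + f.adjoint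
  let K : E →ₗ[ℂ] E := Complex.I • (f - f.adjoint)
  have hH : H.IsSymmetric := by
    intro x y
    simp only [H, LinearMap.add_apply, inner_add_left, inner_add_right,
      LinearMap.adjoint_inner_left, LinearMap.adjoint_inner_right]
    ring
  have hK : K.IsSymmetric := by
    intro x y
    simp only [K, LinearMap.smul_apply, LinearMap.sub_apply, inner_sub_left, inner_sub_right,
      inner_smul_left, inner_smul_right,
      LinearMap.adjoint_inner_left, LinearMap.adjoint_inner_right, Complex.conj_I]
    ring
  have diag : ∀ (r : ℝ) (x : E), ⟪x, f x⟫_ℂ = (r : ℂ) * ⟪x, x⟫_ℂ →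
      ⟪H x, x⟫_ℂ = ((2 * r * ‖x‖ ^ 2 : ℝ) : ℂ) ∧ ⟪K x, x⟫_ℂ = 0 := by
    intro r x hx
    have hx' : ⟪f x, x⟫_ℂ = (r : ℂ) * ⟪x, x⟫_ℂ := by
      rw [← inner_conj_symm, hx, map_mul, Complex.conj_ofReal, inner_conj_symm]
    constructor
    · simp only [H, LinearMap.add_apply, inner_add_left, LinearMap.adjoint_inner_left, hx, hx',
        inner_self_eq_norm_sq_to_K]
      push_cast
      simp only [Complex.coe_algebraMap]
      ring
    · simp only [K, LinearMap.smul_apply, LinearMap.sub_apply, inner_sub_left,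
        inner_smul_left, LinearMap.adjoint_inner_left, hx, hx', sub_self, mul_zero]
  have hUH : ∀ u ∈ U, u ≠ 0 → 0 < (⟪H u, u⟫_ℂ).re := by
    intro u hu hu0
    rw [(diag a u (hU u hu)).1, Complex.ofReal_re]
    have := norm_pos_iff.mpr hu0
    positivity
  have hVH : ∀ v ∈ V, v ≠ 0 → (⟪H v, v⟫_ℂ).re < 0 := by
    intro v hv hv0
    rw [(diag b v (hV v hv)).1, Complex.ofReal_re]
    have := pow_pos (norm_pos_iff.mpr hv0) 2
    nlinarith
  have hHinj : Function.Injective H := by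
    rw [injective_iff_map_eq_zero]
    exact fun x => eq_zero_of_definite_summands hH hUV hUH hVH
  let T : E →ₗ[ℂ] E := (LinearEquiv.ofInjectiveEndo H hHinj).symm.toLinearMap ∘ₗ K
  have hHT : ∀ x, H (T x) = K x := fun x =>
    (LinearEquiv.ofInjectiveEndo H hHinj).apply_symm_apply (K x)
  have hT : ∀ x y, ⟪H (T x), y⟫_ℂ = ⟪H x, T y⟫_ℂ := by
    intro x y
    rw [hHT, hK, hH, hHT]
  have hreal : ∀ t : ℝ, t ≠ 0 → ∀ x, T x = (t : ℂ) • x → x = 0 := by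
    intro t ht x hx
    have hx' : K x = (t : ℂ) • H x := by rw [← hHT, hx, map_smul]
    let g : E →ₗ[ℂ] E := H - ((t⁻¹ : ℝ) : ℂ) • K
    have hg : g.IsSymmetric := by
      intro x y
      simp only [g, LinearMap.sub_apply, LinearMap.smul_apply, inner_sub_left, inner_sub_right,
        inner_smul_left, inner_smul_right, Complex.conj_ofReal, hH x y, hK x y]
    have hgd : ∀ (r : ℝ) (x : E), ⟪x, f x⟫_ℂ = (r : ℂ) * ⟪x, x⟫_ℂ → ⟪g x, x⟫_ℂ = ⟪H x, x⟫_ℂ := by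
      intro r x hx
      simp only [g, LinearMap.sub_apply, LinearMap.smul_apply, inner_sub_left, inner_smul_left,
        (diag r x hx).2, mul_zero, sub_zero]
    refine eq_zero_of_definite_summands hg hUV ?_ ?_ (x := x) ?_
    · intro u hu
      rw [hgd a u (hU u hu)]
      exact hUH u hu
    · intro v hv
      rw [hgd b v (hV v hv)]
      exact hVH v hv
    · have : (t : ℂ) ≠ 0 := by exact_mod_cast ht
      rw [LinearMap.sub_apply, LinearMap.smul_apply, hx', smul_smul, Complex.ofReal_inv,
        inv_mul_cancel₀ this, one_smul, sub_self]
  obtain ⟨W, hWp, hWT, hWH⟩ := exists_neutral_invariant hH hHinj hT hreal hEp hUp hVp hUH hVH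
    le_rfl
  refine ⟨W, hWp, fun x hx y hy => ?_⟩
  have h1 := hWH x hx y hy
  have h2 := hWH _ (hWT x hx) y hy
  rw [hHT] at h2
  simp only [H, K, LinearMap.add_apply, LinearMap.smul_apply, LinearMap.sub_apply,
    inner_add_left, inner_sub_left, inner_smul_left, LinearMap.adjoint_inner_left] at h1 h2
  have h3 := (mul_eq_zero.mp h2).resolve_left (by simp)
  linear_combination (h1 - h3) / 2

/-- Subspace form of the convexity of the rank-`k` numerical range. -/
theorem exists_compression_convex (f : E →ₗ[ℂ] E) {U V : Submodule ℂ E} {k : ℕ}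
    (hUk : Module.finrank ℂ U = k) (hVk : Module.finrank ℂ V = k) {a b : ℂ}
    (hU : ∀ x ∈ U, ∀ y ∈ U, ⟪x, f y⟫_ℂ = a * ⟪x, y⟫_ℂ)
    (hV : ∀ x ∈ V, ∀ y ∈ V, ⟪x, f y⟫_ℂ = b * ⟪x, y⟫_ℂ) {s t : ℝ} (hs : 0 < s) (ht : 0 < t)
    (hst : s + t = 1) (hab : a ≠ b) :
    ∃ W : Submodule ℂ E, Module.finrank ℂ W = k ∧
      ∀ x ∈ W, ∀ y ∈ W, ⟪x, f y⟫_ℂ = (s * a + t * b) * ⟪x, y⟫_ℂ := by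
  have hd : a - b ≠ 0 := sub_ne_zero.mpr hab
  have hst' : (s : ℂ) + t = 1 := by exact_mod_cast hst
  have hnormSq : 0 < Complex.normSq (a - b) := Complex.normSq_pos.mpr hd
  have hdisj : U ⊓ V = ⊥ := by
    rw [eq_bot_iff]
    rintro x ⟨hxU, hxV⟩
    have h := (hU x hxU x hxU).symm.trans (hV x hxV x hxV)
    rw [← sub_eq_zero, ← sub_mul] at h
    exact inner_self_eq_zero.mp ((mul_eq_zero.mp h).resolve_left hd)
  let M : Submodule ℂ E := U ⊔ V
  let g : E →ₗ[ℂ] E := starRingEnd ℂ (a - b) • (f - (s * a + t * b) • LinearMap.id)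
  let gM : M →ₗ[ℂ] M := M.orthogonalProjectionOnto.toLinearMap ∘ₗ g ∘ₗ M.subtype
  have hgM : ∀ x y : M, ⟪x, gM y⟫_ℂ =
      starRingEnd ℂ (a - b) * (⟪(x : E), f y⟫_ℂ - (s * a + t * b) * ⟪(x : E), (y : E)⟫_ℂ) := by
    intro x y
    have : ⟪x, gM y⟫_ℂ = ⟪(x : E), g y⟫_ℂ := by
      simp [gM]
    rw [this]
    simp only [g, LinearMap.smul_apply, LinearMap.sub_apply, LinearMap.id_apply, inner_smul_right,
      inner_sub_right]
  have finrank_comap : ∀ Y : Submodule ℂ E, Y ≤ M →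
      Module.finrank ℂ (Y.comap M.subtype) = Module.finrank ℂ Y := fun Y hY =>
    (Submodule.comapSubtypeEquivOfLe hY).finrank_eq
  have hsup : U.comap M.subtype ⊔ V.comap M.subtype = ⊤ := by
    refine Submodule.map_injective_of_injective M.injective_subtype ?_
    rw [Submodule.map_sup, Submodule.map_comap_subtype, Submodule.map_comap_subtype,
      Submodule.map_top, Submodule.range_subtype, inf_eq_right.mpr le_sup_left,
      inf_eq_right.mpr le_sup_right]
  have hMk : Module.finrank ℂ M = 2 * k := by
    have h := Submodule.finrank_sup_add_finrank_inf_eq U V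
    rw [hdisj, finrank_bot, hUk, hVk] at h
    exact h.trans (two_mul k).symm
  obtain ⟨W, hWk, hW⟩ := exists_isotropic gM hsup hMk
    ((finrank_comap U le_sup_left).trans hUk) ((finrank_comap V le_sup_right).trans hVk)
    (a := t * Complex.normSq (a - b)) (b := -(s * Complex.normSq (a - b)))
    (mul_pos ht hnormSq) (neg_neg_of_pos (mul_pos hs hnormSq))
    (by
      intro u hu
      rw [hgM, hU u hu u hu, Submodule.coe_inner]
      push_cast
      rw [Complex.normSq_eq_conj_mul_self]
      linear_combination (-starRingEnd ℂ (a - b) * a * ⟪(u : E), (u : E)⟫_ℂ) * hst')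
    (by
      intro v hv
      rw [hgM, hV v hv v hv, Submodule.coe_inner]
      push_cast
      rw [Complex.normSq_eq_conj_mul_self]
      linear_combination (-starRingEnd ℂ (a - b) * b * ⟪(v : E), (v : E)⟫_ℂ) * hst')
  refine ⟨W.map M.subtype, by rw [Submodule.finrank_map_subtype_eq, hWk], ?_⟩
  rintro _ ⟨x, hx, rfl⟩ _ ⟨y, hy, rfl⟩
  have h := hW x hx y hy
  rw [hgM] at h
  exact sub_eq_zero.mp ((mul_eq_zero.mp h).resolve_left ((map_ne_zero _).mpr hd))

end Neutral

theorem mem_rankKRange_iff {n k : ℕ} (A : Matrix (Fin n) (Fin n) ℂ) (μ : ℂ) :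
    μ ∈ rankKRange k A ↔ ∃ W : Submodule ℂ (EuclideanSpace ℂ (Fin n)),
      Module.finrank ℂ W = k ∧
        ∀ x ∈ W, ∀ y ∈ W, ⟪x, A.toEuclideanLin y⟫_ℂ = μ * ⟪x, y⟫_ℂ := by
  constructor
  · rintro ⟨P, hP, hPP, hPk, hPA⟩
    have hsymm : P.toEuclideanLin.IsSymmetric := Matrix.isSymmetric_toEuclideanLin_iff.mpr hP
    refine ⟨LinearMap.range P.toEuclideanLin, ?_, ?_⟩
    · rw [← hPk, Matrix.rank_eq_finrank_range_toLin P (EuclideanSpace.basisFun _ ℂ).toBasis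
        (EuclideanSpace.basisFun _ ℂ).toBasis, Matrix.toEuclideanLin_eq_toLin_orthonormal]
    · rintro _ ⟨x, rfl⟩ _ ⟨y, rfl⟩
      have h1 : P.toEuclideanLin (A.toEuclideanLin (P.toEuclideanLin y)) =
          μ • P.toEuclideanLin y := by
        have := congrArg (fun B => Matrix.toEuclideanLin B y) hPA
        simpa [Matrix.toLpLin_mul_same] using this
      have h2 : P.toEuclideanLin (P.toEuclideanLin y) = P.toEuclideanLin y := by
        have := congrArg (fun B => Matrix.toEuclideanLin B y) hPP
        simpa [Matrix.toLpLin_mul_same] using this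
      rw [hsymm, h1, inner_smul_right, hsymm x, h2]
  · rintro ⟨W, hWk, hW⟩
    let p : EuclideanSpace ℂ (Fin n) →ₗ[ℂ] EuclideanSpace ℂ (Fin n) := W.starProjection
    let P : Matrix (Fin n) (Fin n) ℂ := Matrix.toEuclideanLin.symm p
    have hP : P.toEuclideanLin = p := Matrix.toEuclideanLin.apply_symm_apply p
    have hpp : ∀ x, p (p x) = p x := fun x =>
      W.starProjection_eq_self_iff.mpr (W.starProjection_apply_mem x)
    have hsymm : p.IsSymmetric := W.starProjection_isSymmetric
    refine ⟨P, ?_, ?_, ?_, ?_⟩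
    · rwa [← Matrix.isSymmetric_toEuclideanLin_iff, hP]
    · apply Matrix.toEuclideanLin.injective
      ext1 x
      simp [Matrix.toLpLin_mul_same, hP, hpp]
    · rw [Matrix.rank_eq_finrank_range_toLin P (EuclideanSpace.basisFun _ ℂ).toBasis
        (EuclideanSpace.basisFun _ ℂ).toBasis, ← Matrix.toEuclideanLin_eq_toLin_orthonormal, hP,
        ← hWk]
      exact congrArg (fun Y : Submodule ℂ _ => Module.finrank ℂ Y) W.range_starProjection
    · apply Matrix.toEuclideanLin.injective
      ext1 x
      have h : p (A.toEuclideanLin (p x)) = μ • p x := by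
        refine ext_inner_left ℂ fun y => ?_
        rw [← hsymm, hW (p y) (W.starProjection_apply_mem y) (p x)
          (W.starProjection_apply_mem x), inner_smul_right, hsymm, hpp]
      simpa [Matrix.toLpLin_mul_same, hP] using h

theorem rankKRange_convex {n k : ℕ} (hk1 : 1 ≤ k) (hkn : k ≤ n)
    (A : Matrix (Fin n) (Fin n) ℂ) :
    Convex ℝ (rankKRange k A) := by
  rw [convex_iff_forall_pos]
  intro a ha b hb s t hs ht hst
  by_cases hab : a = b
  · rwa [hab, Convex.combo_self hst]
  · rw [mem_rankKRange_iff] at ha hb ⊢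
    obtain ⟨U, hUk, hU⟩ := ha
    obtain ⟨V, hVk, hV⟩ := hb
    exact exists_compression_convex _ hUk hVk hU hV hs ht hst hab
end

section
/- Let A be an n×n complex normal matrix with eigenvalues λ_1, …, λ_n (listed with multiplicity) and 1 ≤ k ≤ n. Then the rank-k numerical range of A equals the intersection, over all index sets 1 ≤ j_1 < ⋯ < j_{n−k+1} ≤ n, of the convex hulls conv{λ_{j_1}, …, λ_{j_{n−k+1}}}. -/
open Matrix

/-- `IsCompressionOf b a` says that some compression of the real diagonal matrix with entries `b`
is the diagonal matrix with entries `a`. -/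
def IsCompressionOf {ι κ : Type*} [Fintype ι] [DecidableEq ι] [DecidableEq κ]
    (b : ι → ℝ) (a : κ → ℝ) : Prop :=
  ∃ Y : Matrix ι κ ℝ, Yᵀ * Y = 1 ∧ Yᵀ * diagonal b * Y = diagonal a

namespace IsCompressionOf

theorem trans {ι κ ν : Type*} [Fintype ι] [Fintype κ] [DecidableEq ι] [DecidableEq κ]
    [DecidableEq ν] {b : ι → ℝ} {c : κ → ℝ} {a : ν → ℝ}
    (h₁ : IsCompressionOf b c) (h₂ : IsCompressionOf c a) : IsCompressionOf b a := by
  obtain ⟨Y, hY, hbY⟩ := h₁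
  obtain ⟨Z, hZ, hcZ⟩ := h₂
  refine ⟨Y * Z, ?_, ?_⟩
  · calc (Y * Z)ᵀ * (Y * Z) = Zᵀ * (Yᵀ * Y) * Z := by
          simp only [transpose_mul, Matrix.mul_assoc]
      _ = 1 := by rw [hY, Matrix.mul_one, hZ]
  · calc (Y * Z)ᵀ * diagonal b * (Y * Z) = Zᵀ * (Yᵀ * diagonal b * Y) * Z := by
          simp only [transpose_mul, Matrix.mul_assoc]
      _ = diagonal a := by rw [hbY, hcZ]

theorem of_forall_eq {ι : Type*} [Fintype ι] [DecidableEq ι] {b a : ι → ℝ} (h : ∀ i, b i = a i) :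
    IsCompressionOf b a :=
  ⟨1, by simp, by simp [funext h]⟩

/-- The set of pairs `(b, a)` for which `a` is a compression of `b` is closed. -/
theorem of_tendsto {ι κ : Type*} [Fintype ι] [Fintype κ] [DecidableEq ι] [DecidableEq κ]
    {b : ℕ → ι → ℝ} {a : ℕ → κ → ℝ} {b₀ : ι → ℝ} {a₀ : κ → ℝ}
    (hb : Filter.Tendsto b Filter.atTop (nhds b₀)) (ha : Filter.Tendsto a Filter.atTop (nhds a₀))
    (h : ∀ m, IsCompressionOf (b m) (a m)) : IsCompressionOf b₀ a₀ := by
  choose Y hY hbY using h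
  have hmem : ∀ m, Y m ∈ (Set.Icc (fun _ _ => -1) (fun _ _ => 1) : Set (ι → κ → ℝ)) := by
    intro m
    have key : ∀ i j, (Y m i j) ^ 2 ≤ 1 := by
      intro i j
      have h1 := congrFun (congrFun (hY m) j) j
      rw [Matrix.mul_apply, Matrix.one_apply_eq] at h1
      rw [← h1, sq]
      exact Finset.single_le_sum (f := fun l => (Y m)ᵀ j l * Y m l j)
        (fun l _ => mul_self_nonneg (Y m l j)) (Finset.mem_univ i)
    exact ⟨fun i j => (abs_le_one_iff_mul_self_le_one.2 (by nlinarith [key i j]) |> abs_le.1).1,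
      fun i j => (abs_le_one_iff_mul_self_le_one.2 (by nlinarith [key i j]) |> abs_le.1).2⟩
  obtain ⟨Y₀, -, φ, hφ, hlim⟩ := (isCompact_Icc (α := ι → κ → ℝ)).tendsto_subseq hmem
  have hlim' : Filter.Tendsto (fun m => Y (φ m)) Filter.atTop (nhds (Y₀ : Matrix ι κ ℝ)) := hlim
  have hcont₁ : Continuous fun Z : Matrix ι κ ℝ => Zᵀ * Z :=
    continuous_id.matrix_transpose.matrix_mul continuous_id
  have hcont₂ : Continuous fun q : Matrix ι κ ℝ × (ι → ℝ) => q.1ᵀ * diagonal q.2 * q.1 :=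
    (continuous_fst.matrix_transpose.matrix_mul continuous_snd.matrix_diagonal).matrix_mul
      continuous_fst
  have h₁ := (hcont₁.tendsto Y₀).comp hlim'
  have h₂ := (hcont₂.tendsto (Y₀, b₀)).comp (hlim'.prodMk_nhds (hb.comp hφ.tendsto_atTop))
  have h₃ := ((continuous_id.matrix_diagonal).tendsto a₀).comp (ha.comp hφ.tendsto_atTop)
  refine ⟨Y₀, tendsto_nhds_unique h₁ ?_, tendsto_nhds_unique h₂ ?_⟩
  · simp only [Function.comp_def, hY, tendsto_const_nhds]
  · simpa only [Function.comp_def, hbY, id] using h₃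

/-- Converse of Cauchy interlacing in codimension one, for strict interlacing. -/
theorem of_strict_interlacing {N : ℕ} {b : Fin (N + 1) → ℝ} {c : Fin N → ℝ}
    (h₁ : ∀ i, b i.castSucc < c i) (h₂ : ∀ i, c i < b i.succ) : IsCompressionOf b c := by
  have hb : StrictMono b := Fin.strictMono_iff_lt_succ.2 fun i => (h₁ i).trans (h₂ i)
  have hlt : ∀ i j, j ≤ i.castSucc → b j < c i := fun i j hj =>
    (hb.monotone hj).trans_lt (h₁ i)
  have hgt : ∀ (i : Fin N) j, i.succ ≤ j → c i < b j := fun i j hj =>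
    (h₂ i).trans_le (hb.monotone hj)
  have hne : ∀ i j, b j - c i ≠ 0 := by
    intro i j
    rcases le_or_gt j i.castSucc with h | h
    · exact (sub_neg.2 (hlt i j h)).ne
    · exact (sub_pos.2 (hgt i j (Fin.castSucc_lt_iff_succ_le.1 h))).ne'
  have hcne : ∀ i l, i ≠ l → c i - c l ≠ 0 := by
    intro i l hil
    rcases lt_or_gt_of_ne hil with h | h
    · exact (sub_neg.2 ((h₂ i).trans (hlt l _ (by simpa [Fin.le_def] using h)))).ne
    · exact (sub_pos.2 ((h₂ l).trans (hlt i _ (by simpa [Fin.le_def] using h)))).ne'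
  set w : Fin (N + 1) → ℝ :=
    fun j => (∏ i, (b j - c i)) / ∏ l ∈ Finset.univ.erase j, (b j - b l) with hw
  have hwpos : ∀ j, 0 < w j := by
    intro j
    have : ∏ l ∈ Finset.univ.erase j, (b j - b l) = ∏ i, (b j - b (j.succAbove i)) := by
      rw [← Finset.compl_singleton, ← Fin.image_succAbove_univ, Finset.prod_image]
      exact fun x _ y _ h => Fin.succAbove_right_injective h
    simp only [hw, this, ← Finset.prod_div_distrib]
    refine Finset.prod_pos fun i _ => ?_
    rcases le_or_gt j i.castSucc with h | h
    · rw [Fin.succAbove_of_le_castSucc _ _ h]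
      exact div_pos_of_neg_of_neg (sub_neg.2 (hlt i j h))
        (sub_neg.2 (hb (h.trans_lt Fin.castSucc_lt_succ)))
    · rw [Fin.succAbove_of_castSucc_lt _ _ h]
      exact div_pos (sub_pos.2 (hgt i j (Fin.castSucc_lt_iff_succ_le.1 h))) (sub_pos.2 (hb h))
  have hsum : ∀ i, ∑ j, w j / (b j - c i) = 0 := by
    intro i
    have hdeg : (Lagrange.nodal (Finset.univ.erase i) c).degree < (N : WithBot ℕ) := by
      rw [Lagrange.degree_nodal, Finset.card_erase_of_mem (Finset.mem_univ i), Finset.card_univ,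
        Fintype.card_fin]
      exact_mod_cast Nat.sub_lt i.pos one_pos
    have h := Lagrange.coeff_eq_sum (s := Finset.univ) (v := b) hb.injective.injOn
      (P := Lagrange.nodal (Finset.univ.erase i) c)
      (hdeg.trans (by rw [Finset.card_univ, Fintype.card_fin]; exact_mod_cast Nat.lt_succ_self N))
    rw [Finset.card_univ, Fintype.card_fin, Nat.add_sub_cancel,
      Polynomial.coeff_eq_zero_of_degree_lt hdeg] at h
    rw [h]
    refine Finset.sum_congr rfl fun j _ => ?_
    rw [Lagrange.eval_nodal]
    simp only [hw]
    rw [← Finset.mul_prod_erase _ _ (Finset.mem_univ i)]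
    field_simp [hne i j]
  set S : Fin N → ℝ := fun i => ∑ j, w j / (b j - c i) ^ 2 with hS
  have hSpos : ∀ i, 0 < S i := fun i =>
    Finset.sum_pos (fun j _ => div_pos (hwpos j) (by have := hne i j; positivity)) ⟨0, by simp⟩
  have horth : ∀ i l, i ≠ l → ∑ j, w j / ((b j - c i) * (b j - c l)) = 0 := by
    intro i l hil
    have : ∑ j, w j / ((b j - c i) * (b j - c l)) =
        (∑ j, w j / (b j - c i) - ∑ j, w j / (b j - c l)) / (c i - c l) := by
      rw [← Finset.sum_sub_distrib, Finset.sum_div]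
      refine Finset.sum_congr rfl fun j _ => ?_
      have := hne i j; have := hne l j; have := hcne i l hil
      field_simp
      ring
    rw [this, hsum, hsum]; simp
  have hgram : ∀ i l, ∑ j, w j / ((b j - c i) * (b j - c l)) = if i = l then S i else 0 := by
    intro i l
    split_ifs with h
    · subst h; simp only [hS, sq]
    · exact horth i l h
  have hgram' : ∀ i l, ∑ j, w j * b j / ((b j - c i) * (b j - c l)) =
      if i = l then c i * S i else 0 := by
    intro i l
    have : ∑ j, w j * b j / ((b j - c i) * (b j - c l)) =
        ∑ j, w j / (b j - c l) + c i * ∑ j, w j / ((b j - c i) * (b j - c l)) := by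
      rw [Finset.mul_sum, ← Finset.sum_add_distrib]
      refine Finset.sum_congr rfl fun j _ => ?_
      have := hne i j; have := hne l j
      field_simp
      ring
    rw [this, hsum, hgram]; simp
  have hsq : ∀ j, √(w j) * √(w j) = w j := fun j => Real.mul_self_sqrt (hwpos j).le
  have hSsq : ∀ i, √(S i) * √(S i) = S i := fun i => Real.mul_self_sqrt (hSpos i).le
  refine ⟨Matrix.of fun j i => √(w j) / (√(S i) * (b j - c i)), ?_, ?_⟩
  · ext i l
    have : ((Matrix.of fun j i => √(w j) / (√(S i) * (b j - c i)))ᵀ *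
        (Matrix.of fun j i => √(w j) / (√(S i) * (b j - c i))) : Matrix (Fin N) (Fin N) ℝ) i l =
        (∑ j, w j / ((b j - c i) * (b j - c l))) / (√(S i) * √(S l)) := by
      rw [Matrix.mul_apply, Finset.sum_div]
      refine Finset.sum_congr rfl fun j _ => ?_
      rw [transpose_apply, of_apply, of_apply, div_mul_div_comm, hsq, div_div (w j)]
      congr 1; ring
    rw [this, hgram, Matrix.one_apply]
    split_ifs with h
    · subst h; rw [hSsq, div_self (hSpos i).ne']
    · simp
  · ext i l
    have : ((Matrix.of fun j i => √(w j) / (√(S i) * (b j - c i)))ᵀ * diagonal b *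
        (Matrix.of fun j i => √(w j) / (√(S i) * (b j - c i))) : Matrix (Fin N) (Fin N) ℝ) i l =
        (∑ j, w j * b j / ((b j - c i) * (b j - c l))) / (√(S i) * √(S l)) := by
      rw [Matrix.mul_apply, Finset.sum_div]
      refine Finset.sum_congr rfl fun j _ => ?_
      rw [mul_diagonal, transpose_apply, of_apply, of_apply, div_mul_eq_mul_div,
        div_mul_div_comm, mul_right_comm, hsq, div_div (w j * b j)]
      congr 1; ring
    rw [this, hgram', diagonal_apply]
    split_ifs with h
    · subst h; rw [hSsq, mul_div_assoc, div_self (hSpos i).ne', mul_one]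
    · simp

/-- Converse of Cauchy interlacing in codimension one. -/
theorem of_interlacing {N : ℕ} {b : Fin (N + 1) → ℝ} {c : Fin N → ℝ}
    (h₁ : ∀ i, b i.castSucc ≤ c i) (h₂ : ∀ i, c i ≤ b i.succ) : IsCompressionOf b c := by
  have hε : Filter.Tendsto (fun m : ℕ => 1 / ((m : ℝ) + 1)) Filter.atTop (nhds 0) :=
    tendsto_one_div_add_atTop_nhds_zero_nat
  refine of_tendsto (b := fun m j => b j + 2 * (j : ℝ) * (1 / ((m : ℝ) + 1)))
    (a := fun m i => c i + (2 * (i : ℝ) + 1) * (1 / ((m : ℝ) + 1))) ?_ ?_ fun m => ?_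
  · refine tendsto_pi_nhds.2 fun j => ?_
    simpa using (hε.const_mul (2 * (j : ℝ))).const_add (b j)
  · refine tendsto_pi_nhds.2 fun i => ?_
    simpa using (hε.const_mul (2 * (i : ℝ) + 1)).const_add (c i)
  · have hpos : 0 < 1 / ((m : ℝ) + 1) := by positivity
    refine of_strict_interlacing (fun i => ?_) fun i => ?_
    · have := h₁ i
      simp only [Fin.val_castSucc]
      nlinarith
    · have := h₂ i
      simp only [Fin.val_succ, Nat.cast_add, Nat.cast_one]
      nlinarith

/-- The Fan–Pall theorem for monotone sequences indexed by `ℕ`. -/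
theorem of_nat_interlacing {k : ℕ} {b a : ℕ → ℝ} (d : ℕ) (hb : Monotone b) (ha : Monotone a)
    (h₁ : ∀ i < k, b i ≤ a i) (h₂ : ∀ i < k, a i ≤ b (i + d)) :
    IsCompressionOf (fun i : Fin (k + d) => b i) (fun i : Fin k => a i) := by
  induction d generalizing b with
  | zero => exact of_forall_eq fun i => le_antisymm (h₁ i i.2) (h₂ i i.2)
  | succ d ih =>
    set c : ℕ → ℝ := fun i => if i < d then b i else max (b i) (a (i - d)) with hc
    have hbc : ∀ i, b i ≤ c i := by
      intro i
      simp only [hc]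
      split_ifs
      · exact le_rfl
      · exact le_max_left _ _
    have hcb : ∀ i < k + d, c i ≤ b (i + 1) := by
      intro i hi
      simp only [hc]
      split_ifs with h
      · exact hb (Nat.le_succ i)
      · refine max_le (hb (Nat.le_succ i)) ?_
        have := h₂ (i - d) (by omega)
        rwa [show i - d + (d + 1) = i + 1 by omega] at this
    have hcm : Monotone c := by
      intro i j hij
      by_cases hi : i < d
      · exact (by simp [hc, hi] : c i = b i).trans_le ((hb hij).trans (hbc j))
      · have hj : ¬ j < d := by omega
        simp only [hc, hi, hj, if_false]
        exact max_le_max (hb hij) (ha (by omega))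
    refine (of_interlacing (N := k + d) (b := fun i => b i) (c := fun i => c i)
      (fun i => hbc i) (fun i => hcb i i.2)).trans (ih hcm (fun i hi => ?_) fun i hi => ?_)
    · simp only [hc]
      split_ifs
      · exact h₁ i hi
      · exact max_le (h₁ i hi) (ha (Nat.sub_le i d))
    · simp [hc]

/-- The **Fan–Pall theorem**, the converse of Cauchy interlacing. -/
theorem of_monotone {k d : ℕ} {b : Fin (k + d) → ℝ} {a : Fin k → ℝ} (hb : Monotone b)
    (ha : Monotone a) (h₁ : ∀ i, b (Fin.castAdd d i) ≤ a i) (h₂ : ∀ i, a i ≤ b (Fin.addNat i d)) :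
    IsCompressionOf b a := by
  rcases Nat.eq_zero_or_pos k with rfl | hk
  · exact ⟨0, by ext i; exact i.elim0, by ext i; exact i.elim0⟩
  have h := of_nat_interlacing (k := k) d
    (b := fun i => b ⟨min i (k + d - 1), by omega⟩) (a := fun i => a ⟨min i (k - 1), by omega⟩)
    (fun i j hij => hb (by simp only [Fin.mk_le_mk]; omega))
    (fun i j hij => ha (by simp only [Fin.mk_le_mk]; omega))
    (fun i hi => by
      convert h₁ ⟨i, hi⟩ using 2 <;> ext <;> simp <;> omega)
    (fun i hi => by
      convert h₂ ⟨i, hi⟩ using 2 <;> ext <;> simp <;> omega)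
  convert h using 2 with i i
  · congr 1; ext; simp; omega
  · congr 1; ext; simp; omega

end IsCompressionOf

/-- A compression relation between the slopes `g / h` of the positive and the negative part of `h`
yields a subspace on which both `diagonal h` and `diagonal g` vanish. -/
theorem IsCompressionOf.exists_isotropic {ι π ν ζ : Type*} [Fintype ι] [Fintype π] [Fintype ν]
    [Fintype ζ] [DecidableEq ι] [DecidableEq π] [DecidableEq ν] [DecidableEq ζ]
    (E : (π ⊕ ν) ⊕ ζ ≃ ι) {h g : ι → ℝ}
    (hpos : ∀ i, 0 < h (E (.inl (.inl i)))) (hneg : ∀ i, h (E (.inl (.inr i))) < 0)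
    (hzero : ∀ i, h (E (.inr i)) = 0) (gzero : ∀ i, g (E (.inr i)) = 0)
    (hc : IsCompressionOf (fun i => g (E (.inl (.inr i))) / h (E (.inl (.inr i))))
      (fun i => g (E (.inl (.inl i))) / h (E (.inl (.inl i))))) :
    ∃ X : Matrix ι (π ⊕ ζ) ℂ, Function.Injective X.mulVec ∧
      Xᴴ * diagonal (fun j => (⟨h j, g j⟩ : ℂ)) * X = 0 := by
  obtain ⟨Y, hY, hYg⟩ := hc
  set R : (π ⊕ ν) ⊕ ζ → π ⊕ ζ → ℝ := fun r c => match r, c with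
    | .inl (.inl i), .inl i' => if i = i' then 1 / √(h (E (.inl (.inl i)))) else 0
    | .inl (.inr j), .inl i' => Y j i' / √(-h (E (.inl (.inr j))))
    | .inr z, .inr z' => if z = z' then 1 else 0
    | _, _ => 0 with hR
  have hspos : ∀ i, √(h (E (.inl (.inl i)))) ≠ 0 := fun i => (Real.sqrt_pos.2 (hpos i)).ne'
  have hsneg : ∀ i, √(-h (E (.inl (.inr i)))) ≠ 0 := fun i =>
    (Real.sqrt_pos.2 (neg_pos.2 (hneg i))).ne'
  have hspos' : ∀ i, √(h (E (.inl (.inl i)))) ^ 2 = h (E (.inl (.inl i))) := fun i =>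
    Real.sq_sqrt (hpos i).le
  have hsneg' : ∀ i, √(-h (E (.inl (.inr i)))) ^ 2 = -h (E (.inl (.inr i))) := fun i =>
    Real.sq_sqrt (neg_pos.2 (hneg i)).le
  have key : ∀ w : ι → ℝ, (∀ i, w (E (.inr i)) = 0) →
      Yᵀ * diagonal (fun i => w (E (.inl (.inr i))) / h (E (.inl (.inr i)))) * Y =
        diagonal (fun i => w (E (.inl (.inl i))) / h (E (.inl (.inl i)))) →
      ∀ c e, ∑ r, R r c * w (E r) * R r e = 0 := by
    intro w w0 hw c e
    simp only [Fintype.sum_sum_type, w0, mul_zero, zero_mul, Finset.sum_const_zero, add_zero]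
    rcases c with c | c <;> rcases e with e | e <;> simp only [hR, mul_zero, zero_mul,
      Finset.sum_const_zero, add_zero]
    have h1 := congrFun (congrFun hw c) e
    rw [Matrix.mul_apply] at h1
    simp only [mul_diagonal, transpose_apply] at h1
    have h2 : ∑ i, Y i c / √(-h (E (.inl (.inr i)))) * w (E (.inl (.inr i))) *
        (Y i e / √(-h (E (.inl (.inr i))))) =
        - ∑ i, Y i c * (w (E (.inl (.inr i))) / h (E (.inl (.inr i)))) * Y i e := by
      rw [← Finset.sum_neg_distrib]
      refine Finset.sum_congr rfl fun i _ => ?_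
      have e1 := hsneg i; have e2 := hsneg' i; have e3 := (hneg i).ne
      have : Y i c / √(-h (E (.inl (.inr i)))) * w (E (.inl (.inr i))) *
        (Y i e / √(-h (E (.inl (.inr i))))) =
          Y i c * w (E (.inl (.inr i))) * Y i e / √(-h (E (.inl (.inr i)))) ^ 2 := by
        field_simp
      rw [this, e2]
      field_simp
    rw [h2, h1, diagonal_apply]
    by_cases hcc : c = e
    · subst hcc
      have e1 := hspos c; have e2 := hspos' c; have e3 := (hpos c).ne'
      simp only [ite_mul, mul_ite, mul_zero, zero_mul, Finset.sum_ite_eq', Finset.mem_univ, if_true]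
      have : 1 / √(h (E (.inl (.inl c)))) * w (E (.inl (.inl c))) *
          (1 / √(h (E (.inl (.inl c))))) =
          w (E (.inl (.inl c))) / √(h (E (.inl (.inl c)))) ^ 2 := by field_simp
      rw [this, e2, add_neg_cancel]
    · rw [if_neg hcc, neg_zero, add_zero]
      refine Finset.sum_eq_zero fun i _ => ?_
      by_cases hi : i = c
      · rw [if_neg (fun h => hcc (hi.symm.trans h)), mul_zero]
      · rw [if_neg hi, zero_mul, zero_mul]
  have keyh := key h hzero (by
    rw [show (fun i => h (E (.inl (.inr i))) / h (E (.inl (.inr i)))) = fun _ => (1 : ℝ) from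
      funext fun i => div_self (hneg i).ne,
      show (fun i => h (E (.inl (.inl i))) / h (E (.inl (.inl i)))) = fun _ => (1 : ℝ) from
      funext fun i => div_self (hpos i).ne', diagonal_one, diagonal_one, Matrix.mul_one, hY])
  have keyg := key g gzero hYg
  refine ⟨Matrix.of fun j c => (R (E.symm j) c : ℂ), ?_, ?_⟩
  · refine (injective_iff_map_eq_zero (Matrix.mulVecLin _)).2 fun v hv => ?_
    have hv' : ∀ r, ∑ c, (R r c : ℂ) * v c = 0 := by
      intro r
      have := congrFun hv (E r)
      simpa [Matrix.mulVec, dotProduct] using this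
    ext (i | i)
    · have := hv' (.inl (.inl i))
      simp only [hR, Fintype.sum_sum_type, Complex.ofReal_zero, zero_mul, Finset.sum_const_zero,
        add_zero, apply_ite Complex.ofReal, ite_mul, Finset.sum_ite_eq, Finset.mem_univ,
        if_true] at this
      refine (mul_eq_zero.1 this).resolve_left ?_
      exact_mod_cast one_div_ne_zero (hspos i)
    · have := hv' (.inr i)
      simpa [hR, Fintype.sum_sum_type, apply_ite Complex.ofReal, ite_mul] using this
  · ext c e
    rw [Matrix.mul_apply, ← E.sum_comp]
    simp only [mul_diagonal, conjTranspose_apply, of_apply, Equiv.symm_apply_apply, Matrix.zero_apply]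
    apply Complex.ext
    · simpa using keyh c e
    · simpa using keyg c e

/-- Enumeration of a finite set along which a given real function is monotone. -/
theorem exists_equiv_monotone {ι : Type*} [Fintype ι] {p : ℕ} (hp : Fintype.card ι = p)
    (τ : ι → ℝ) : ∃ e : Fin p ≃ ι, Monotone fun i => τ (e i) := by
  let e := (Fintype.equivFinOfCardEq hp).symm
  exact ⟨(Tuple.sort (τ ∘ e)).trans e, Tuple.monotone_sort (τ ∘ e)⟩

/-- If the open half-plane `0 < h` contains a minimal number of the points `(h j, g j)` among all
half-planes without nonzero points on the boundary, then the diagonal matrix of these points has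
a large totally isotropic subspace. -/
theorem exists_isotropic_of_minimal {ι : Type*} [Fintype ι] [DecidableEq ι] {h g : ι → ℝ}
    (hg : ∀ j, h j = 0 → g j = 0)
    (hneg : Fintype.card {j // 0 < h j} ≤ Fintype.card {j // h j < 0})
    (hmin : ∀ t : ℝ, (∀ j, h j ≠ 0 → g j / h j ≠ t) →
      Fintype.card {j // 0 < h j} ≤ (Finset.univ.filter fun j => 0 < g j - t * h j).card ∧
      Fintype.card {j // 0 < h j} ≤ (Finset.univ.filter fun j => g j - t * h j < 0).card) :
    ∃ (κ : Type) (_ : Fintype κ) (_ : DecidableEq κ) (X : Matrix ι κ ℂ),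
      Function.Injective X.mulVec ∧ Xᴴ * diagonal (fun j => (⟨h j, g j⟩ : ℂ)) * X = 0 ∧
      Fintype.card κ = (Finset.univ.filter fun j => 0 ≤ h j).card := by
  classical
  obtain ⟨d, hd⟩ := Nat.exists_eq_add_of_le hneg
  set p := Fintype.card {j // 0 < h j} with hp
  obtain ⟨eP, hP⟩ := exists_equiv_monotone hp.symm (fun j => g j.1 / h j.1)
  obtain ⟨eM, hM⟩ := exists_equiv_monotone hd (fun j => g j.1 / h j.1)
  let eZ := (Fintype.equivFin {j // h j = 0}).symm
  have hPs : ∀ j, 0 < h j → ∃ i, (eP i).1 = j := fun j hj =>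
    ⟨eP.symm ⟨j, hj⟩, by simp⟩
  have hMs : ∀ j, h j < 0 → ∃ i, (eM i).1 = j := fun j hj =>
    ⟨eM.symm ⟨j, hj⟩, by simp⟩
  have hgen : ∀ x y : ℝ, x < y → ∃ t, x < t ∧ t < y ∧ ∀ j, g j / h j ≠ t := by
    intro x y hxy
    obtain ⟨t, ht, ht'⟩ := (Set.Ioo_infinite hxy).exists_notMem_finset
      (Finset.univ.image fun j => g j / h j)
    exact ⟨t, ht.1, ht.2, fun j hj => ht' (Finset.mem_image.2 ⟨j, Finset.mem_univ j, hj⟩)⟩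
  have hcomp : IsCompressionOf (fun i => g (eM i).1 / h (eM i).1)
      (fun i => g (eP i).1 / h (eP i).1) := by
    refine IsCompressionOf.of_monotone hM hP (fun i => ?_) fun i => ?_
    · by_contra! hlt
      obtain ⟨t, ht1, ht2, ht⟩ := hgen _ _ hlt
      have hsub : (Finset.univ.filter fun j => 0 < g j - t * h j) ⊆
          (Finset.Ioi i).image (fun i => (eP i).1) ∪
            (Finset.Iio (Fin.castAdd d i)).image (fun i => (eM i).1) := by
        intro j hj
        simp only [Finset.mem_filter, Finset.mem_univ, true_and] at hj
        simp only [Finset.mem_union, Finset.mem_image, Finset.mem_Ioi, Finset.mem_Iio]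
        rcases lt_trichotomy (h j) 0 with h0 | h0 | h0
        · obtain ⟨l, rfl⟩ := hMs j h0
          refine Or.inr ⟨l, lt_of_not_ge fun hle => ?_, rfl⟩
          have := ht2.trans_le (hM hle)
          rw [lt_div_iff_of_neg h0] at this
          linarith
        · simp [h0, hg j h0] at hj
        · obtain ⟨l, rfl⟩ := hPs j h0
          refine Or.inl ⟨l, lt_of_not_ge fun hle => ?_, rfl⟩
          have := (hP hle).trans_lt ht1
          rw [div_lt_iff₀ h0] at this
          linarith
      have h1 := (Finset.card_le_card hsub).trans (Finset.card_union_le _ _)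
      have h2 := (Finset.Ioi i).card_image_le (f := fun i => (eP i).1)
      have h3 := (Finset.Iio (Fin.castAdd d i)).card_image_le (f := fun i => (eM i).1)
      rw [Fin.card_Ioi] at h2
      rw [Fin.card_Iio, Fin.val_castAdd] at h3
      have h4 := (hmin t fun j _ => ht j).1
      have := i.2
      omega
    · by_contra! hlt
      obtain ⟨t, ht1, ht2, ht⟩ := hgen _ _ hlt
      have hsub : (Finset.univ.filter fun j => g j - t * h j < 0) ⊆
          (Finset.Iio i).image (fun i => (eP i).1) ∪
            (Finset.Ioi (Fin.addNat i d)).image (fun i => (eM i).1) := by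
        intro j hj
        simp only [Finset.mem_filter, Finset.mem_univ, true_and] at hj
        simp only [Finset.mem_union, Finset.mem_image, Finset.mem_Ioi, Finset.mem_Iio]
        rcases lt_trichotomy (h j) 0 with h0 | h0 | h0
        · obtain ⟨l, rfl⟩ := hMs j h0
          refine Or.inr ⟨l, lt_of_not_ge fun hle => ?_, rfl⟩
          have := (hM hle).trans_lt ht1
          rw [div_lt_iff_of_neg h0] at this
          linarith
        · simp [h0, hg j h0] at hj
        · obtain ⟨l, rfl⟩ := hPs j h0
          refine Or.inl ⟨l, lt_of_not_ge fun hle => ?_, rfl⟩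
          have := ht2.trans_le (hP hle)
          rw [lt_div_iff₀ h0] at this
          linarith
      have h1 := (Finset.card_le_card hsub).trans (Finset.card_union_le _ _)
      have h2 := (Finset.Iio i).card_image_le (f := fun i => (eP i).1)
      have h3 := (Finset.Ioi (Fin.addNat i d)).card_image_le (f := fun i => (eM i).1)
      rw [Fin.card_Iio] at h2
      rw [Fin.card_Ioi, Fin.val_addNat] at h3
      have h4 := (hmin t fun j _ => ht j).2
      have := i.2
      omega
  let f : (Fin p ⊕ Fin (p + d)) ⊕ Fin (Fintype.card {j // h j = 0}) → ι :=
    Sum.elim (Sum.elim (fun i => (eP i).1) fun i => (eM i).1) fun i => (eZ i).1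
  have hf : Function.Bijective f := by
    constructor
    · have hPM : ∀ i l, (eP i).1 ≠ (eM l).1 := fun i l hil =>
        ((eP i).2.trans_eq (congrArg h hil)).not_gt (eM l).2
      have hPZ : ∀ i l, (eP i).1 ≠ (eZ l).1 := fun i l hil =>
        (eP i).2.ne' ((congrArg h hil).trans (eZ l).2)
      have hMZ : ∀ i l, (eM i).1 ≠ (eZ l).1 := fun i l hil =>
        (eM i).2.ne ((congrArg h hil).trans (eZ l).2)
      exact ((Subtype.val_injective.comp eP.injective).sumElim
        (Subtype.val_injective.comp eM.injective) hPM).sumElim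
        (Subtype.val_injective.comp eZ.injective) (by rintro (i | i) l; exacts [hPZ i l, hMZ i l])
    · intro j
      rcases lt_trichotomy (h j) 0 with h0 | h0 | h0
      · exact ⟨.inl (.inr (eM.symm ⟨j, h0⟩)), by simp [f]⟩
      · exact ⟨.inr (eZ.symm ⟨j, h0⟩), by simp [f]⟩
      · exact ⟨.inl (.inl (eP.symm ⟨j, h0⟩)), by simp [f]⟩
  obtain ⟨X, hX, hX0⟩ := IsCompressionOf.exists_isotropic (Equiv.ofBijective f hf) (h := h) (g := g)
    (fun i => (eP i).2) (fun i => (eM i).2) (fun i => (eZ i).2) (fun i => hg _ (eZ i).2) hcomp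
  refine ⟨_, inferInstance, inferInstance, X, hX, hX0, ?_⟩
  rw [Fintype.card_sum, Fintype.card_fin, Fintype.card_fin, hp, Fintype.card_subtype,
    Fintype.card_subtype, ← Finset.card_union_of_disjoint]
  · congr 1
    ext j
    simp [le_iff_lt_or_eq, eq_comm]
  · exact Finset.disjoint_filter.2 fun j _ h1 h2 => h1.ne' h2

/-- If every closed half-plane through the origin contains at least `k` of the points `z j`, then
`diagonal z` has a totally isotropic subspace of dimension at least `k`. -/
theorem exists_isotropic_of_halfplanes {ι : Type*} [Fintype ι] [DecidableEq ι] {k : ℕ} {z : ι → ℂ}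
    (hk : ∀ u : ℂ, k ≤ (Finset.univ.filter fun j => 0 ≤ (u * z j).re).card) :
    ∃ (κ : Type) (_ : Fintype κ) (_ : DecidableEq κ) (X : Matrix ι κ ℂ),
      Function.Injective X.mulVec ∧ Xᴴ * diagonal z * X = 0 ∧ k ≤ Fintype.card κ := by
  classical
  let G : Set ℂ := {u | u ≠ 0 ∧ ∀ j, z j ≠ 0 → (u * z j).re ≠ 0}
  have hG : G.Nonempty := by
    obtain ⟨t, ht⟩ := Infinite.exists_notMem_finset (Finset.univ.image fun j => (z j).re / (z j).im)
    refine ⟨⟨1, t⟩, fun h => one_ne_zero (congrArg Complex.re h), fun j hj h0 => ?_⟩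
    simp only [Complex.mul_re, one_mul] at h0
    by_cases him : (z j).im = 0
    · exact hj (Complex.ext (by simpa [him] using h0) him)
    · refine ht (Finset.mem_image.2 ⟨j, Finset.mem_univ j, ?_⟩)
      rw [div_eq_iff him]
      linarith
  obtain ⟨u, ⟨hu0, huG⟩, hu⟩ : ∃ u ∈ G, ∀ v ∈ G,
      (Finset.univ.filter fun j => 0 < (u * z j).re).card ≤
        (Finset.univ.filter fun j => 0 < (v * z j).re).card :=
    let c := fun u : ℂ => (Finset.univ.filter fun j => 0 < (u * z j).re).card
    ⟨Function.argminOn c G hG, Function.argminOn_mem c G hG,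
      fun _ hv => Function.argminOn_le c G hv⟩
  have hz : ∀ j, (u * z j).re = 0 → z j = 0 := fun j hj => by_contra fun h => huG j h hj
  obtain ⟨κ, i₁, i₂, X, hX, hX0, hcard⟩ := exists_isotropic_of_minimal
    (h := fun j => (u * z j).re) (g := fun j => (u * z j).im)
    (fun j hj => by simp [hz j hj]) (by
      have hGneg : -u ∈ G := ⟨neg_ne_zero.2 hu0, fun j hj => by
        rw [neg_mul, Complex.neg_re]
        exact neg_ne_zero.2 (huG j hj)⟩
      rw [Fintype.card_subtype, Fintype.card_subtype]
      simpa only [neg_mul, Complex.neg_re, neg_pos] using hu _ hGneg) (by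
      intro t ht
      set v : ℂ := ⟨-t, -1⟩ * u with hv
      have hre : ∀ j, (v * z j).re = (u * z j).im - t * (u * z j).re := by
        intro j
        rw [hv, mul_assoc, Complex.mul_re]
        ring
      have hv0 : v ≠ 0 := mul_ne_zero (fun h => by simpa using congrArg Complex.im h) hu0
      have hvre : ∀ j, z j ≠ 0 → (v * z j).re ≠ 0 := by
        intro j hj h0
        rw [hre] at h0
        refine ht j (huG j hj) ?_
        rw [div_eq_iff (huG j hj)]
        linarith
      have h1 := hu v ⟨hv0, hvre⟩
      have h2 := hu (-v) ⟨neg_ne_zero.2 hv0, fun j hj => by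
        rw [neg_mul, Complex.neg_re]
        exact neg_ne_zero.2 (hvre j hj)⟩
      simp only [neg_mul, Complex.neg_re, neg_pos, hre] at h1 h2
      rw [Fintype.card_subtype]
      exact ⟨h1, h2⟩)
  refine ⟨κ, i₁, i₂, X, hX, ?_, (hk u).trans_eq hcard.symm⟩
  have hdiag : diagonal (fun j => (⟨(u * z j).re, (u * z j).im⟩ : ℂ)) = u • diagonal z := by
    rw [← diagonal_smul]
    rfl
  rw [hdiag, Matrix.mul_smul, Matrix.smul_mul] at hX0
  exact (smul_eq_zero.1 hX0).resolve_left hu0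

open scoped ComplexOrder in
/-- A frame `X` with `Xᴴ A X = μ Xᴴ X` and at least `k` columns shows that `μ` belongs to the
rank-`k` numerical range of `A`. -/
theorem mem_rankKRange_of_frame {n k : ℕ} {κ : Type*} [Fintype κ]
    {A : Matrix (Fin n) (Fin n) ℂ} {μ : ℂ} (X : Matrix (Fin n) κ ℂ)
    (hX : Function.Injective X.mulVec) (hκ : k ≤ Fintype.card κ)
    (hA : Xᴴ * A * X = μ • (Xᴴ * X)) : μ ∈ rankKRange k A := by
  classical
  obtain ⟨f⟩ : Nonempty (Fin k ↪ κ) := Function.Embedding.nonempty_of_card_le (by simpa using hκ)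
  set Z : Matrix (Fin n) (Fin k) ℂ := X.submatrix id f with hZ
  have hZinj : Function.Injective Z.mulVec :=
    Matrix.mulVec_injective_iff.2 ((Matrix.mulVec_injective_iff.1 hX).comp f f.injective)
  have hZA : Zᴴ * A * Z = μ • (Zᴴ * Z) := by
    have := congrArg (fun M => M.submatrix f f) hA
    ext i j
    exact congrFun (congrFun this i) j
  set K : Matrix (Fin k) (Fin k) ℂ := Zᴴ * Z with hK
  have hKpos : K.PosDef := PosDef.conjTranspose_mul_self Z hZinj
  have hdet : IsUnit K.det := (Matrix.isUnit_iff_isUnit_det K).1 hKpos.isUnit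
  have hKinv : K⁻¹ᴴ = K⁻¹ := by rw [conjTranspose_nonsing_inv, hKpos.isHermitian.eq]
  have hPZ : Z * K⁻¹ * Zᴴ * Z = Z := by
    rw [Matrix.mul_assoc _ Zᴴ Z, ← hK, Matrix.mul_assoc, nonsing_inv_mul _ hdet, Matrix.mul_one]
  refine ⟨Z * K⁻¹ * Zᴴ, ?_, ?_, le_antisymm ?_ ?_, ?_⟩
  · rw [IsHermitian, conjTranspose_mul, conjTranspose_mul, conjTranspose_conjTranspose, hKinv,
      Matrix.mul_assoc]
  · rw [← Matrix.mul_assoc, ← Matrix.mul_assoc, hPZ]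
  · rw [Matrix.mul_assoc]
    exact (rank_mul_le_left _ _).trans (rank_le_width Z)
  · have hrank : Z.rank = k := by
      rw [← rank_conjTranspose_mul_self, ← hK, rank_of_isUnit K hKpos.isUnit, Fintype.card_fin]
    calc k = (Z * K⁻¹ * Zᴴ * Z).rank := by rw [hPZ, hrank]
      _ ≤ _ := rank_mul_le_left _ _
  · calc Z * K⁻¹ * Zᴴ * A * (Z * K⁻¹ * Zᴴ) = Z * K⁻¹ * (Zᴴ * A * Z) * (K⁻¹ * Zᴴ) := by
          simp only [Matrix.mul_assoc]
      _ = μ • (Z * (K⁻¹ * K) * (K⁻¹ * Zᴴ)) := by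
          rw [hZA, Matrix.mul_smul, Matrix.smul_mul, Matrix.mul_assoc Z]
      _ = μ • (Z * K⁻¹ * Zᴴ) := by
          rw [nonsing_inv_mul _ hdet, Matrix.mul_one, Matrix.mul_assoc]

/-- A vector fixed by the projection `P`, whose coordinates in the eigenbasis are supported in
`J`, exhibits `μ` as a convex combination of the eigenvalues indexed by `J`. -/
theorem mem_convexHull_of_mem_rankKRange {n k : ℕ} (hk1 : 1 ≤ k) (hkn : k ≤ n)
    {A U : Matrix (Fin n) (Fin n) ℂ} {lam : Fin n → ℂ}
    (hU : U ∈ Matrix.unitaryGroup (Fin n) ℂ) (hA : A = U * Matrix.diagonal lam * Uᴴ) {μ : ℂ}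
    (hμ : μ ∈ rankKRange k A) {J : Finset (Fin n)} (hJ : J.card = n - k + 1) :
    μ ∈ convexHull ℝ (lam '' (J : Set (Fin n))) := by
  obtain ⟨P, hPH, hPP, hPk, hPA⟩ := hμ
  let L : LinearMap.range P.mulVecLin →ₗ[ℂ] ({j // j ∉ J} → ℂ) :=
    (LinearMap.funLeft ℂ ℂ Subtype.val ∘ₗ Uᴴ.mulVecLin).domRestrict (LinearMap.range P.mulVecLin)
  have hL : LinearMap.ker L ≠ ⊥ := by
    refine LinearMap.ker_ne_bot_of_finrank_lt ?_
    rw [Module.finrank_fintype_fun_eq_card, Fintype.card_subtype_compl, Fintype.card_coe,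
      Fintype.card_fin, hJ]
    have : Module.finrank ℂ (LinearMap.range P.mulVecLin) = k := hPk
    omega
  obtain ⟨⟨x, x', rfl⟩, hx, hx0⟩ := Submodule.exists_mem_ne_zero_of_ne_bot hL
  set x := P.mulVecLin x' with hxdef
  have hPx : P *ᵥ x = x := by
    rw [hxdef, mulVecLin_apply, mulVec_mulVec, hPP]
  set y := Uᴴ *ᵥ x with hy
  have hyJ : ∀ j ∉ J, y j = 0 := fun j hj => congrFun (LinearMap.mem_ker.1 hx) ⟨j, hj⟩
  have hUy : U *ᵥ y = x := by
    rw [hy, mulVec_mulVec, show U * Uᴴ = 1 from (mem_unitaryGroup_iff.1 hU), one_mulVec]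
  have hy0 : y ≠ 0 := by
    intro h
    apply hx0
    ext1
    change x = 0
    rw [← hUy, h, mulVec_zero]
  have hxy : star x ⬝ᵥ x = star y ⬝ᵥ y := by
    conv_rhs => rw [hy, star_mulVec, conjTranspose_conjTranspose, ← dotProduct_mulVec, ← hy, hUy]
  have hquad : star x ⬝ᵥ (A *ᵥ x) = star y ⬝ᵥ (diagonal lam *ᵥ y) := by
    conv_rhs => rw [hy, star_mulVec, conjTranspose_conjTranspose, ← dotProduct_mulVec,
      mulVec_mulVec, mulVec_mulVec, ← hA]
  have hval : star x ⬝ᵥ (A *ᵥ x) = μ * (star x ⬝ᵥ x) := by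
    have h1 : star x ⬝ᵥ (A *ᵥ x) = star x ⬝ᵥ ((P * A * P) *ᵥ x) := by
      rw [← mulVec_mulVec, hPx, ← mulVec_mulVec, dotProduct_mulVec (star x) P]
      congr 1
      conv_lhs => rw [← hPx, star_mulVec, hPH.eq]
    rw [h1, hPA, smul_mulVec, hPx, dotProduct_smul, smul_eq_mul]
  have hsum : ∑ j ∈ J, (Complex.normSq (y j) : ℂ) * lam j =
      μ * ∑ j ∈ J, (Complex.normSq (y j) : ℂ) := by
    rw [hval, hxy] at hquad
    have e1 : star y ⬝ᵥ y = ∑ j ∈ J, (Complex.normSq (y j) : ℂ) := by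
      rw [dotProduct, ← Finset.sum_subset (Finset.subset_univ J)]
      · exact Finset.sum_congr rfl fun j _ => (Complex.normSq_eq_conj_mul_self).symm
      · intro j _ hj; simp [hyJ j hj]
    have e2 : star y ⬝ᵥ (diagonal lam *ᵥ y) = ∑ j ∈ J, (Complex.normSq (y j) : ℂ) * lam j := by
      rw [dotProduct, ← Finset.sum_subset (Finset.subset_univ J)]
      · refine Finset.sum_congr rfl fun j _ => ?_
        rw [mulVec_diagonal, Complex.normSq_eq_conj_mul_self, Pi.star_apply, RCLike.star_def]
        ring
      · intro j _ hj; simp [hyJ j hj]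
    rw [← e1, ← e2, hquad]
  have hpos : 0 < ∑ j ∈ J, Complex.normSq (y j) := by
    obtain ⟨j, hj⟩ := Function.ne_iff.1 hy0
    have hjJ : j ∈ J := by_contra fun h => hj (hyJ j h)
    exact Finset.sum_pos' (fun j _ => Complex.normSq_nonneg _) ⟨j, hjJ, Complex.normSq_pos.2 hj⟩
  have hcm : μ = J.centerMass (fun j => Complex.normSq (y j)) lam := by
    have hne : ((∑ j ∈ J, Complex.normSq (y j) : ℝ) : ℂ) ≠ 0 := by exact_mod_cast hpos.ne'
    rw [Finset.centerMass, Complex.real_smul, Complex.ofReal_inv, eq_inv_mul_iff_mul_eq₀ hne,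
      Complex.ofReal_sum, mul_comm, ← hsum]
    simp only [Complex.real_smul]
  rw [hcm]
  exact J.centerMass_mem_convexHull (fun j _ => Complex.normSq_nonneg _) hpos
    fun j hj => Set.mem_image_of_mem lam hj

/-- For a normal matrix `A` with eigenvalues `lam 1, …, lam n` (listed with multiplicity,
i.e. `A = U (diagonal lam) U*` for a unitary `U`), the rank-`k` numerical range is the
intersection of the convex hulls of all `n - k + 1` element subfamilies of the eigenvalues. -/
theorem rankKRange_normal_eq_iInter_convexHull {n k : ℕ} (hk1 : 1 ≤ k) (hkn : k ≤ n)
    (A U : Matrix (Fin n) (Fin n) ℂ) (lam : Fin n → ℂ)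
    (hU : U ∈ Matrix.unitaryGroup (Fin n) ℂ)
    (hA : A = U * Matrix.diagonal lam * Uᴴ) :
    rankKRange k A =
      ⋂ J ∈ {J : Finset (Fin n) | J.card = n - k + 1},
        convexHull ℝ (lam '' (J : Set (Fin n))) := by
  ext μ
  refine ⟨fun hμ => Set.mem_iInter₂.2 fun J hJ =>
    mem_convexHull_of_mem_rankKRange hk1 hkn hU hA hμ hJ, fun hμ => ?_⟩
  obtain ⟨κ, _, _, X, hX, hX0, hcard⟩ := exists_isotropic_of_halfplanes (k := k)
    (z := fun j => lam j - μ) (by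
      intro u
      by_contra! hlt
      have hcompl := Finset.card_filter_add_card_filter_not (s := (Finset.univ : Finset (Fin n)))
        fun j => 0 ≤ (u * (lam j - μ)).re
      rw [Finset.card_univ, Fintype.card_fin] at hcompl
      obtain ⟨J, hJsub, hJ⟩ := Finset.exists_subset_card_eq
        (s := Finset.univ.filter fun j => ¬ 0 ≤ (u * (lam j - μ)).re) (n := n - k + 1) (by omega)
      have hconv : Convex ℝ {w : ℂ | (u * w).re < (u * μ).re} :=
        convex_halfSpace_lt (f := fun w : ℂ => (u * w).re)
          ⟨fun x y => by simp only [mul_add, Complex.add_re],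
            fun c x => by simp only [mul_smul_comm, Complex.smul_re]⟩ _
      have hmem := convexHull_min (t := {w : ℂ | (u * w).re < (u * μ).re}) (by
        rintro _ ⟨j, hj, rfl⟩
        have := (Finset.mem_filter.1 (hJsub hj)).2
        rw [mul_sub, Complex.sub_re] at this
        exact sub_neg.1 (not_le.1 this)) hconv (Set.mem_iInter₂.1 hμ J hJ)
      exact lt_irrefl (u * μ).re hmem)
  have hUU : Uᴴ * U = 1 := mem_unitaryGroup_iff'.1 hU
  refine mem_rankKRange_of_frame (U * X) ?_ hcard ?_
  · have hUinj : Function.Injective U.mulVec :=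
      Function.LeftInverse.injective (g := Uᴴ.mulVec) fun v => by
        rw [mulVec_mulVec, hUU, one_mulVec]
    intro v w hvw
    refine hX (hUinj ?_)
    rw [mulVec_mulVec, mulVec_mulVec, hvw]
  · have hdiag : diagonal (fun j => lam j - μ) = diagonal lam - μ • (1 : Matrix _ _ ℂ) := by
      rw [← diagonal_one, ← diagonal_smul, diagonal_sub]
      simp
    rw [hdiag, Matrix.mul_sub, Matrix.sub_mul, sub_eq_zero, Matrix.mul_smul, Matrix.mul_one,
      Matrix.smul_mul] at hX0
    calc (U * X)ᴴ * A * (U * X) = Xᴴ * (Uᴴ * U) * diagonal lam * (Uᴴ * U) * X := by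
          rw [hA, conjTranspose_mul]
          simp only [Matrix.mul_assoc]
      _ = μ • (Xᴴ * (Uᴴ * U) * X) := by
          rw [hUU, Matrix.mul_one, Matrix.mul_one, hX0]
      _ = μ • ((U * X)ᴴ * (U * X)) := by
          rw [conjTranspose_mul]
          simp only [Matrix.mul_assoc]
end

section
/- Let A be an n×n complex matrix and 1 ≤ k ≤ n. Then 0 ∈ Λ_k(A) if and only if there is an invertible matrix S ∈ M_n(ℂ) such that S*AS has the k×k zero matrix as its leading principal k×k submatrix. -/
open Matrix

/-- The first columns of an invertible matrix can be prescribed to be a basis of the range of a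
given matrix. -/
lemma exists_isUnit_col_mem_range {n k : ℕ} (hkn : k ≤ n) (P : Matrix (Fin n) (Fin n) ℂ)
    (hP : P.rank = k) :
    ∃ S : Matrix (Fin n) (Fin n) ℂ, IsUnit S ∧
      ∀ j : Fin n, (j : ℕ) < k → S.col j ∈ LinearMap.range P.mulVecLin := by
  obtain ⟨V, hV⟩ := Submodule.exists_isCompl (LinearMap.range P.mulVecLin)
  have hdim : Module.finrank ℂ V = n - k := by
    have h := Submodule.finrank_add_eq_of_isCompl hV
    rw [← Matrix.rank, hP, Module.finrank_fin_fun] at h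
    omega
  let bW := Module.finBasisOfFinrankEq ℂ (LinearMap.range P.mulVecLin) hP
  let bV := Module.finBasisOfFinrankEq ℂ V hdim
  let b := ((bW.prod bV).map (Submodule.prodEquivOfIsCompl _ _ hV)).reindex
    (finSumFinEquiv.trans (finCongr (Nat.add_sub_cancel' hkn)))
  refine ⟨(Matrix.of b)ᵀ, ?_, fun j hj => ?_⟩
  · rw [← Matrix.linearIndependent_cols_iff_isUnit]
    exact b.linearIndependent
  · have hb : b j = bW ⟨j, hj⟩ := by
      have hj' : (finSumFinEquiv.trans (finCongr (Nat.add_sub_cancel' hkn))).symm j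
          = Sum.inl ⟨j, hj⟩ := by
        rw [Equiv.symm_apply_eq]
        ext
        simp
      rw [Module.Basis.reindex_apply, hj']
      simp
    change b j ∈ _
    rw [hb]
    exact (bW _).2

open scoped ComplexOrder in
/-- The Gram formula for the orthogonal projection onto the column space of `T`. -/
lemma exists_projection_of_injective {n k : ℕ} (A : Matrix (Fin n) (Fin n) ℂ)
    (T : Matrix (Fin n) (Fin k) ℂ) (hT : Function.Injective T.mulVec) (hA : Tᴴ * A * T = 0) :
    ∃ P : Matrix (Fin n) (Fin n) ℂ,
      P.IsHermitian ∧ P * P = P ∧ P.rank = k ∧ P * A * P = 0 := by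
  have hpd : (Tᴴ * T).PosDef := Matrix.PosDef.conjTranspose_mul_self T hT
  have hdet : IsUnit (Tᴴ * T).det := (Matrix.isUnit_iff_isUnit_det _).1 hpd.isUnit
  have hPT : T * (Tᴴ * T)⁻¹ * Tᴴ * T = T := by
    rw [Matrix.mul_assoc, Matrix.mul_assoc, Matrix.nonsing_inv_mul _ hdet, Matrix.mul_one]
  refine ⟨T * (Tᴴ * T)⁻¹ * Tᴴ, isHermitian_mul_mul_conjTranspose T hpd.isHermitian.inv, ?_, ?_, ?_⟩
  · rw [← Matrix.mul_assoc, ← Matrix.mul_assoc, hPT]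
  · have hrank : T.rank = k := by
      rw [← Matrix.rank_conjTranspose_mul_self, Matrix.rank_of_isUnit _ hpd.isUnit,
        Fintype.card_fin]
    apply le_antisymm
    · rw [Matrix.mul_assoc]
      exact (Matrix.rank_mul_le_left _ _).trans hrank.le
    · calc k = (T * (Tᴴ * T)⁻¹ * Tᴴ * T).rank := by rw [hPT, hrank]
        _ ≤ _ := Matrix.rank_mul_le_left _ _
  · calc T * (Tᴴ * T)⁻¹ * Tᴴ * A * (T * (Tᴴ * T)⁻¹ * Tᴴ)
        = T * (Tᴴ * T)⁻¹ * (Tᴴ * A * T) * ((Tᴴ * T)⁻¹ * Tᴴ) := by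
          simp only [Matrix.mul_assoc]
      _ = 0 := by rw [hA, Matrix.mul_zero, Matrix.zero_mul]

/-- `0 ∈ Λ_k(A)` iff `S*AS` has `0_k` as its leading principal `k × k` submatrix for some
invertible `S`. -/
theorem zero_mem_rankKRange_iff_exists_invertible {n k : ℕ} (hk1 : 1 ≤ k) (hkn : k ≤ n)
    (A : Matrix (Fin n) (Fin n) ℂ) :
    0 ∈ rankKRange k A ↔
      ∃ S : Matrix (Fin n) (Fin n) ℂ, IsUnit S ∧
        ∀ i j : Fin n, (i : ℕ) < k → (j : ℕ) < k → (Sᴴ * A * S) i j = 0 := by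
  constructor
  · rintro ⟨P, hH, -, hr, hPAP⟩
    rw [zero_smul] at hPAP
    obtain ⟨S, hS, hcol⟩ := exists_isUnit_col_mem_range hkn P hr
    refine ⟨S, hS, fun i j hi hj => ?_⟩
    obtain ⟨x, hx⟩ := hcol i hi
    obtain ⟨y, hy⟩ := hcol j hj
    rw [Matrix.mulVecLin_apply] at hx hy
    have hentry : (Sᴴ * A * S) i j = star (S.col i) ⬝ᵥ A *ᵥ S.col j := by
      rw [Matrix.mul_assoc, Matrix.mul_apply_eq_vecMul]
      rfl
    rw [hentry, ← hx, ← hy, Matrix.star_mulVec, hH.eq, ← Matrix.dotProduct_mulVec,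
      Matrix.mulVec_mulVec, Matrix.mulVec_mulVec, hPAP, Matrix.zero_mulVec,
      dotProduct_zero]
  · rintro ⟨S, hS, h0⟩
    have hT : Function.Injective (S.submatrix id (Fin.castLE hkn)).mulVec := by
      rw [Matrix.mulVec_injective_iff]
      exact (Matrix.linearIndependent_cols_iff_isUnit.2 hS).comp _ (Fin.castLE_injective hkn)
    obtain ⟨P, hH, hP, hr, hPAP⟩ := exists_projection_of_injective A _ hT <| by
      ext i j
      exact h0 (Fin.castLE hkn i) (Fin.castLE hkn j) i.2 j.2
    exact ⟨P, hH, hP, hr, by rw [hPAP, zero_smul]⟩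
end

section
/- Let A be an n×n complex matrix and 1 ≤ k ≤ n. If μ ∈ Λ_k(A), then for every ξ ∈ [0, 2π) one has e^{iξ}μ + e^{-iξ}μ̄ ≤ λ_k(e^{iξ}A + e^{-iξ}A*); that is, Λ_k(A) ⊆ Ω_k(A). -/
open Matrix

/-- If the entry of index `j` of the sorted values of `f` is below `c`, then more than `j` values
of `f` are below `c`. -/
theorem lt_card_filter_of_sort_getD_lt {ι : Type*} [Fintype ι] (f : ι → ℝ) {c : ℝ} {j : ℕ}
    (hj : j < Fintype.card ι)
    (h : ((Finset.univ.val.map f).sort (· ≤ ·)).getD j 0 < c) :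
    j < (Finset.univ.filter fun i => f i < c).card := by
  set l := (Finset.univ.val.map f).sort (· ≤ ·) with hl
  have hlen : l.length = Fintype.card ι := by simp [hl]
  have hsort : l.Pairwise (· ≤ ·) := Multiset.pairwise_sort _ _
  have hjl : j < l.length := hlen ▸ hj
  rw [List.getD_eq_getElem _ _ hjl] at h
  have hcount : l.countP (fun x => decide (x < c))
      = (Finset.univ.filter fun i => f i < c).card := by
    rw [← Multiset.coe_countP, hl, Multiset.sort_eq, Multiset.countP_map]
    rfl
  have htake : (l.take (j + 1)).countP (fun x => decide (x < c)) = (l.take (j + 1)).length := by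
    rw [List.countP_eq_length]
    intro a ha
    obtain ⟨i, hi, rfl⟩ := List.mem_iff_getElem.1 ha
    rw [List.length_take] at hi
    rw [List.getElem_take]
    have hij : i ≤ j := by omega
    refine decide_eq_true (lt_of_le_of_lt ?_ h)
    rcases hij.eq_or_lt with rfl | hlt
    · exact le_rfl
    · exact List.pairwise_iff_getElem.1 hsort i j _ _ hlt
  have hle := (List.take_sublist (j + 1) l).countP_le (p := fun x => decide (x < c))
  rw [htake, List.length_take, hcount] at hle
  omega

/-- A Hermitian form is diagonal in coordinates with respect to an orthonormal eigenbasis. -/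
theorem Matrix.IsHermitian.star_dotProduct_mulVec_eq_sum {ι : Type*} [Fintype ι] [DecidableEq ι]
    {H : Matrix ι ι ℂ} (hH : H.IsHermitian) (x : ι → ℂ) :
    star x ⬝ᵥ H *ᵥ x = ∑ i, ((hH.eigenvalues i
      * Complex.normSq ((star (hH.eigenvectorUnitary : Matrix ι ι ℂ) *ᵥ x) i) : ℝ) : ℂ) := by
  have hs := hH.spectral_theorem
  rw [Unitary.conjStarAlgAut_apply] at hs
  set U : Matrix ι ι ℂ := (hH.eigenvectorUnitary : Matrix ι ι ℂ)
  have hx : star x ᵥ* U = star (star U *ᵥ x) := by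
    rw [star_mulVec, star_eq_conjTranspose, conjTranspose_conjTranspose]
  conv_lhs => rw [hs, ← mulVec_mulVec, ← mulVec_mulVec, dotProduct_mulVec, hx]
  refine Finset.sum_congr rfl fun i _ => ?_
  rw [mulVec_diagonal]
  simp only [Pi.star_apply, Function.comp_apply, Complex.ofReal_mul, Complex.normSq_eq_conj_mul_self,
    RCLike.star_def, Complex.coe_algebraMap]
  ring

/-- The squared norm of a vector in coordinates with respect to an orthonormal eigenbasis. -/
theorem Matrix.IsHermitian.star_dotProduct_self_eq_sum {ι : Type*} [Fintype ι] [DecidableEq ι]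
    {H : Matrix ι ι ℂ} (hH : H.IsHermitian) (x : ι → ℂ) :
    star x ⬝ᵥ x = ∑ i, ((
      Complex.normSq ((star (hH.eigenvectorUnitary : Matrix ι ι ℂ) *ᵥ x) i) : ℝ) : ℂ) := by
  have hU : (hH.eigenvectorUnitary : Matrix ι ι ℂ)
      * star (hH.eigenvectorUnitary : Matrix ι ι ℂ) = 1 :=
    Unitary.coe_mul_star_self _
  set U : Matrix ι ι ℂ := (hH.eigenvectorUnitary : Matrix ι ι ℂ)
  have hx : star x ᵥ* U = star (star U *ᵥ x) := by
    rw [star_mulVec, star_eq_conjTranspose, conjTranspose_conjTranspose]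
  have hxx : star x ⬝ᵥ x = star (star U *ᵥ x) ⬝ᵥ (star U *ᵥ x) := by
    rw [← hx, ← dotProduct_mulVec, mulVec_mulVec, hU, one_mulVec]
  rw [hxx]
  refine Finset.sum_congr rfl fun i _ => ?_
  rw [Complex.normSq_eq_conj_mul_self]
  rfl

/-- One half of the Courant–Fischer principle: a Hermitian form bounded below by `c` on a
`k`-dimensional subspace has its `k`-th largest eigenvalue at least `c`. -/
theorem le_lambdaKth_of_subspace {n k : ℕ} (hk1 : 1 ≤ k) (hkn : k ≤ n)
    {H : Matrix (Fin n) (Fin n) ℂ} (hH : H.IsHermitian) {c : ℝ}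
    (V : Submodule ℂ (Fin n → ℂ)) (hV : Module.finrank ℂ V = k)
    (hc : ∀ x ∈ V, c * (star x ⬝ᵥ x).re ≤ (star x ⬝ᵥ H *ᵥ x).re) :
    c ≤ lambdaKth H k := by
  by_contra! hlt
  rw [lambdaKth, dif_pos hH] at hlt
  have hcard := lt_card_filter_of_sort_getD_lt hH.eigenvalues
    (by rw [Fintype.card_fin]; omega) hlt
  set U : Matrix (Fin n) (Fin n) ℂ := (hH.eigenvectorUnitary : Matrix (Fin n) (Fin n) ℂ)
  let f : V →ₗ[ℂ] ({i // ¬ hH.eigenvalues i < c} → ℂ) :=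
    LinearMap.funLeft ℂ ℂ Subtype.val ∘ₗ (star U).mulVecLin ∘ₗ V.subtype
  have hfin : Module.finrank ℂ ({i // ¬ hH.eigenvalues i < c} → ℂ) < Module.finrank ℂ V := by
    rw [hV, Module.finrank_fintype_fun_eq_card, Fintype.card_subtype_compl, Fintype.card_fin,
      Fintype.card_subtype]
    omega
  obtain ⟨x, hxf, hx0⟩ := (Submodule.ne_bot_iff _).1 (LinearMap.ker_ne_bot_of_finrank_lt hfin)
  have hzero : ∀ i, ¬ hH.eigenvalues i < c → (star U *ᵥ (x : Fin n → ℂ)) i = 0 := by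
    intro i hi
    have hfx : f x = 0 := hxf
    exact congrFun hfx ⟨i, hi⟩
  have hle := hc x x.2
  rw [hH.star_dotProduct_mulVec_eq_sum, hH.star_dotProduct_self_eq_sum, ← Complex.ofReal_sum,
    ← Complex.ofReal_sum, Complex.ofReal_re, Complex.ofReal_re, Finset.mul_sum] at hle
  refine hle.not_gt (Finset.sum_lt_sum (fun i _ => ?_) ?_)
  · by_cases hi : hH.eigenvalues i < c
    · exact mul_le_mul_of_nonneg_right hi.le (Complex.normSq_nonneg _)
    · rw [hzero i hi]; simp
  · by_contra! hall
    apply hx0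
    have hy : star U *ᵥ (x : Fin n → ℂ) = 0 := by
      funext i
      by_cases hi : hH.eigenvalues i < c
      · by_contra h0
        exact (hall i (Finset.mem_univ i)).not_gt
          (mul_lt_mul_of_pos_right hi (Complex.normSq_pos.2 h0))
      · exact hzero i hi
    have hU : U * star U = 1 := Unitary.coe_mul_star_self _
    apply Subtype.ext
    rw [← one_mulVec (x : Fin n → ℂ), ← hU, ← mulVec_mulVec, hy, mulVec_zero]
    rfl

/-- `Λ_k(A) ⊆ Ω_k(A)`. -/
theorem rankKRange_subset_Omega {n k : ℕ} (hk1 : 1 ≤ k) (hkn : k ≤ n)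
    (A : Matrix (Fin n) (Fin n) ℂ) (μ : ℂ) (hμ : μ ∈ rankKRange k A) :
    ∀ ξ ∈ Set.Ico (0 : ℝ) (2 * Real.pi),
      (Complex.exp (ξ * Complex.I) * μ
          + Complex.exp (-(ξ * Complex.I)) * (starRingEnd ℂ) μ).re
        ≤ lambdaKth (Complex.exp (ξ * Complex.I) • A
          + Complex.exp (-(ξ * Complex.I)) • Aᴴ) k := by
  intro ξ _
  obtain ⟨P, hP, hPP, hrank, hPA⟩ := hμ
  set e := Complex.exp (ξ * Complex.I)
  have he : Complex.exp (-(ξ * Complex.I)) = star e := by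
    rw [Complex.star_def, ← Complex.exp_conj]
    simp
  rw [he]
  have hH : (e • A + star e • Aᴴ).IsHermitian := by
    rw [Matrix.IsHermitian, conjTranspose_add, conjTranspose_smul, conjTranspose_smul,
      conjTranspose_conjTranspose, star_star, add_comm]
  refine le_lambdaKth_of_subspace hk1 hkn hH (LinearMap.range P.mulVecLin) hrank ?_
  rintro _ ⟨z, rfl⟩
  rw [mulVecLin_apply]
  set x := P *ᵥ z with hx
  have hPx : P *ᵥ x = x := by rw [hx, mulVec_mulVec, hPP]
  have hxP : star x ᵥ* P = star x := by
    conv_rhs => rw [← hPx, star_mulVec, hP.eq]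
  have hform : ∀ B : Matrix (Fin n) (Fin n) ℂ, star x ⬝ᵥ B *ᵥ x = star x ⬝ᵥ (P * B * P) *ᵥ x := by
    intro B
    rw [← mulVec_mulVec, hPx, ← mulVec_mulVec, dotProduct_mulVec (star x) P, hxP]
  have hPAH : P * Aᴴ * P = star μ • P := by
    have h := congrArg conjTranspose hPA
    rwa [conjTranspose_mul, conjTranspose_mul, conjTranspose_smul, hP.eq, ← mul_assoc] at h
  have hreal : (star x ⬝ᵥ x).im = 0 := by
    rw [hH.star_dotProduct_self_eq_sum, ← Complex.ofReal_sum, Complex.ofReal_im]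
  rw [add_mulVec, smul_mulVec, smul_mulVec, dotProduct_add, dotProduct_smul, dotProduct_smul,
    hform A, hform Aᴴ, hPA, hPAH, smul_mulVec, smul_mulVec, hPx, dotProduct_smul, dotProduct_smul]
  simp only [smul_eq_mul, ← mul_assoc, ← add_mul, Complex.mul_re _ (star x ⬝ᵥ x), hreal, mul_zero,
    sub_zero]
  exact le_rfl
end
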